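/- arXiv:2411.13371 — 6 statements merged into one kernel-verified Lean document; each statement's English description precedes it below -/
import Mathlib

section
/- Let α and β be dotted compositions, and fix dotted permutations w_α and w_β representing α on S and β on T with every element of S less than every element of T. Then, in sQSym, L_α · L_β = Σ_P sign(P) · L_{Γ(P)}, where the sum is over all fundamental paths P in the (α,β)-grid. -/
/-! ## Dotted compositions -/

/-- An entry of a dotted composition: either an undotted positive integer
or a dotted nonnegative integer. -/
inductive DEntry : Type
  | undot : ℕ+ → DEntry
  | dot : ℕ → DEntry
  deriving DecidableEq

/-- A dotted composition is a finite sequence of dotted-composition entries. -/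
abbrev DComp : Type := List DEntry

namespace DEntry

/-- Is the entry dotted? -/
def isDot : DEntry → Bool
  | undot _ => false
  | dot _ => true

/-- The numerical value of an entry. -/
def val : DEntry → ℕ
  | undot a => a
  | dot a => a

/-- The sum of two entries, defined when not both are dotted; the sum is dotted
iff one of the two entries is dotted. -/
def add? : DEntry → DEntry → Option DEntry
  | undot a, undot b => some (undot (a + b))
  | undot a, dot b => some (dot (a + b))
  | dot a, undot b => some (dot (a + b))
  | dot _, dot _ => none

end DEntry

namespace DComp

/-- The total degree `|α|`. -/
def deg (α : DComp) : ℕ := (α.map DEntry.val).sum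

/-- The fermionic degree `m_α`: the number of dotted entries. -/
def fdeg (α : DComp) : ℕ := (α.filter (fun e => e.isDot)).length

/-- Cover relation for the order `⪯`: `α` covers `β` when `α` is obtained from `β`
by replacing two adjacent undotted parts of `β` by their (undotted) sum. -/
def StrongCover (β α : DComp) : Prop :=
  ∃ (l r : DComp) (a b : ℕ+),
    β = l ++ DEntry.undot a :: DEntry.undot b :: r ∧
    α = l ++ DEntry.undot (a + b) :: r

/-- `StrongLe β α` means `β ⪯ α` (β strongly refines α): the reflexive-transitive
closure of the cover relation `StrongCover`. -/
def StrongLe : DComp → DComp → Prop := Relation.ReflTransGen StrongCover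

/-- Cover relation for the order `⊴`: `α` covers `β` when `α` is obtained from `β`
by replacing two adjacent parts of `β`, at most one of which is dotted, by their sum
(dotted iff one of the two parts was dotted). -/
def WeakCover (β α : DComp) : Prop :=
  ∃ (l r : DComp) (x y z : DEntry),
    β = l ++ x :: y :: r ∧ DEntry.add? x y = some z ∧ α = l ++ z :: r

/-- `WeakLe β α` means `β ⊴ α` (β weakly refines α). -/
def WeakLe : DComp → DComp → Prop := Relation.ReflTransGen WeakCover

/-- The near concatenation `α ⊙ β`, defined when `α` and `β` are nonempty and
not both the last entry of `α` and the first entry of `β` are dotted. -/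
def nearConcat (α β : DComp) : Option DComp :=
  match β with
  | [] => none
  | y :: ys =>
    match α.getLast? with
    | none => none
    | some x => (DEntry.add? x y).map (fun z => α.dropLast ++ z :: ys)

end DComp

/-! ## Quasisymmetric functions in superspace as a free `ℚ`-module -/

/-- `sQSym`: the free `ℚ`-module with basis indexed by dotted compositions. -/
abbrev sQSym : Type := DComp →₀ ℚ

/-- The monomial quasisymmetric function in superspace `M_α`, as a basis element. -/
noncomputable def Mono (α : DComp) : sQSym := Finsupp.single α 1

/-- The fundamental quasisymmetric function in superspace `L_α = ∑_{β ⪯ α} M_β`. -/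
noncomputable def Fund (α : DComp) : sQSym := ∑ᶠ β ∈ {β | DComp.StrongLe β α}, Mono β

/-- The bilinear product `•` with `M_α • M_β = M_{α·β}` (concatenation). -/
noncomputable def cdot (F G : sQSym) : sQSym :=
  F.sum fun α a => G.sum fun β b => (a * b) • Mono (α ++ β)

/-- The bilinear product `⊙` with `M_α ⊙ M_β = M_{α⊙β}` when the near concatenation
is defined, and `M_α ⊙ M_β = 0` otherwise. -/
noncomputable def odot (F G : sQSym) : sQSym :=
  F.sum fun α a => G.sum fun β b =>
    match DComp.nearConcat α β with
    | some γ => (a * b) • Mono γ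
    | none => 0

/-- The antipode `S`, the `ℚ`-linear map determined by
`S(M_α) = (-1)^{ℓ(α) + binom(m_α, 2)} ∑_{γ ⊵ Rev(α)} M_γ`. -/
noncomputable def antipode (F : sQSym) : sQSym :=
  F.sum fun α c =>
    (c * (-1 : ℚ) ^ (α.length + Nat.choose (DComp.fdeg α) 2)) •
      ∑ᶠ γ ∈ {γ | DComp.WeakLe α.reverse γ}, Mono γ

/-! ## Grids, paths, shuffles -/

/-- A step of a lattice path: horizontal `(1,0)`, vertical `(0,1)`, a diagonal step
`D3 k` crossing one column and `k` rows, or a diagonal step `D4 k` crossing one row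
and `k` columns. -/
inductive GStep : Type
  | H : GStep
  | V : GStep
  | D3 : ℕ → GStep
  | D4 : ℕ → GStep
  deriving DecidableEq

/-- The endpoint of a step started at position `p = (x, y)` (`x` = columns crossed
so far, `y` = rows crossed so far). -/
def stepTarget : GStep → ℕ × ℕ → ℕ × ℕ
  | .H, p => (p.1 + 1, p.2)
  | .V, p => (p.1, p.2 + 1)
  | .D3 k, p => (p.1 + 1, p.2 + k)
  | .D4 k, p => (p.1 + k, p.2 + 1)

/-- The final position of a path (a list of steps) starting at `(0,0)`. -/
def pathEnd (steps : List GStep) : ℕ × ℕ := steps.foldl (fun p s => stepTarget s p) (0, 0)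

/-- The list of lattice points visited by a path starting at `(0,0)`. -/
def pathVertices (steps : List GStep) : List (ℕ × ℕ) :=
  steps.scanl (fun p s => stepTarget s p) (0, 0)

/-- The cell in (0-based) column `jc` and row `ic` lies below the path. -/
def CellBelow (steps : List GStep) (jc ic : ℕ) : Prop :=
  ∃ p ∈ pathVertices steps, p.1 ≤ jc ∧ ic + 1 ≤ p.2

/-- A path is valid for the step predicate `ok` and ends at `endPos`. -/
def PathOKWith (ok : ℕ × ℕ → GStep → Prop) (endPos : ℕ × ℕ) (steps : List GStep) : Prop :=
  (∀ pre s post, steps = pre ++ s :: post → ok (pathEnd pre) s) ∧ pathEnd steps = endPos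

/-! ## The overlapping-shuffle product on `sQSym` -/

/-- Validity of a step of an overlapping shuffle of `α` and `β` at position `p`:
steps `(1,0)`, `(0,1)` and `(1,1)`, where diagonal steps over cells whose column
label and row label are both dotted are forbidden. -/
def OStepOK (α β : DComp) (p : ℕ × ℕ) : GStep → Prop
  | .H => p.1 < α.length
  | .V => p.2 < β.length
  | .D3 k => k = 1 ∧ p.1 < α.length ∧ p.2 < β.length ∧
      ¬((α.getD p.1 (DEntry.undot 1)).isDot = true ∧
        (β.getD p.2 (DEntry.undot 1)).isDot = true)
  | .D4 _ => False

/-- The dotted composition `γ(P)` associated to an overlapping shuffle `P` of `α`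
and `β`: a horizontal step over column `q` contributes `α_q`, a vertical step over
row `p` contributes `β_p`, and a diagonal step contributes `α_q + β_p` (dotted iff
`α_q` or `β_p` is dotted). -/
def oGamma (α β : DComp) (steps : List GStep) : DComp :=
  (steps.foldl (fun (st : (ℕ × ℕ) × DComp) s =>
    let e : DEntry := match s with
      | .H => α.getD st.1.1 (DEntry.undot 1)
      | .V => β.getD st.1.2 (DEntry.undot 1)
      | _ => (DEntry.add? (α.getD st.1.1 (DEntry.undot 1))
                (β.getD st.1.2 (DEntry.undot 1))).getD (DEntry.undot 1)
    (stepTarget s st.1, st.2 ++ [e])) ((0, 0), [])).2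

open Classical in
/-- The sign of an overlapping shuffle: `(−1)^{number of cells with both labels
dotted lying below the path}`. -/
noncomputable def osign (α β : DComp) (steps : List GStep) : ℚ :=
  (-1) ^ (((Finset.range α.length ×ˢ Finset.range β.length).filter
    (fun c => (α.getD c.1 (DEntry.undot 1)).isDot = true ∧
      (β.getD c.2 (DEntry.undot 1)).isDot = true ∧ CellBelow steps c.1 c.2)).card)

/-- `M_α M_β = ∑_P sign(P) M_{γ(P)}`, the sum over all overlapping shuffles of `α`
and `β`. -/
noncomputable def monoMul (α β : DComp) : sQSym :=
  ∑ᶠ P ∈ {P : List GStep | PathOKWith (OStepOK α β) (α.length, β.length) P},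
    osign α β P • Mono (oGamma α β P)

/-- The product of `sQSym`: the `ℚ`-bilinear product given on the monomial basis by
overlapping shuffles. -/
noncomputable def qmul (F G : sQSym) : sQSym :=
  F.sum fun α a => G.sum fun β b => (a * b) • monoMul α β

/-! ## Dotted permutations -/

/-- An entry of a dotted permutation: an undotted integer or a dotted natural
number. -/
inductive PEntry : Type
  | undot : ℤ → PEntry
  | dot : ℕ → PEntry
  deriving DecidableEq

instance : Inhabited PEntry := ⟨.undot 0⟩

/-- Is the entry dotted? -/
def PEntry.isDot : PEntry → Bool
  | .undot _ => false
  | .dot _ => true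

/-- The list of the undotted values of `w`, in order (this is `w°`). -/
def undotVals (w : List PEntry) : List ℤ :=
  w.filterMap (fun e => match e with | .undot v => some v | .dot _ => none)

/-- A dotted permutation: the undotted entries are pairwise distinct. -/
def IsDPerm (w : List PEntry) : Prop := (undotVals w).Nodup

/-- Increment the last entry of a dotted composition if it is undotted. -/
def bumpLast : DComp → DComp
  | [] => [DEntry.undot 1]
  | [DEntry.undot a] => [DEntry.undot (a + 1)]
  | [DEntry.dot a] => [DEntry.dot a]
  | x :: xs => x :: bumpLast xs

/-- The dotted composition `comp(w)` of a dotted permutation `w`: its undotted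
parts are the gaps between consecutive descents of `w` (`i` is a descent when
`w°_i > w°_{i+1}` or `w°_i` is immediately followed in `w` by a dotted entry), and
each dotted entry of `w` is inserted in the corresponding position.  Equivalently,
reading `w` from left to right: a dotted entry is appended as a dotted part, and an
undotted entry extends the previous undotted part by `1` exactly when the preceding
entry of `w` is undotted with smaller value (no descent), and otherwise starts a new
undotted part equal to `1`. -/
def compW (w : List PEntry) : DComp :=
  (w.foldl (fun (st : DComp × Option PEntry) e =>
    match e, st.2 with
    | .dot a, _ => (st.1 ++ [DEntry.dot a], some e)
    | .undot v, some (.undot u) =>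
        if u < v then (bumpLast st.1, some e) else (st.1 ++ [DEntry.undot 1], some e)
    | .undot _, _ => (st.1 ++ [DEntry.undot 1], some e)) ([], none)).1

/-! ## Fundamental paths and fundamental shuffles -/

/-- The labels of a (contiguous) run are undotted and strictly increasing. -/
def IncrUndotRun (l : List PEntry) : Prop :=
  (∀ e ∈ l, e.isDot = false) ∧
    l.Chain' (fun x y => ∃ u v : ℤ, x = .undot u ∧ y = .undot v ∧ u < v)

/-- Validity at position `p` of a step of a fundamental path in the
`(α,β)`-grid with column labels `wα` and row labels `wβ`:
(1) horizontal and (2) vertical unit steps are always allowed; (3) if the column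
label is dotted and the next `k` row labels are increasing and undotted, a diagonal
step crossing one column and `k` rows; (4) symmetrically with rows and columns
exchanged. -/
def FStepOK (wα wβ : List PEntry) (p : ℕ × ℕ) : GStep → Prop
  | .H => p.1 < wα.length
  | .V => p.2 < wβ.length
  | .D3 k => 1 ≤ k ∧ p.1 < wα.length ∧ p.2 + k ≤ wβ.length ∧
      (wα.getD p.1 default).isDot = true ∧ IncrUndotRun ((wβ.drop p.2).take k)
  | .D4 k => 1 ≤ k ∧ p.2 < wβ.length ∧ p.1 + k ≤ wα.length ∧
      (wβ.getD p.2 default).isDot = true ∧ IncrUndotRun ((wα.drop p.1).take k)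

/-- The entry of the dotted permutation `Π(P)` contributed by one step: the column
label for a horizontal step, the row label for a vertical step, the dotted value
`(a+k)·` for a type-(3) step over the dotted column label `ȧ` crossing `k` rows, and
the dotted value `(b+k)·` for a type-(4) step over the dotted row label `ḃ`. -/
def PiStep (wα wβ : List PEntry) (p : ℕ × ℕ) : GStep → PEntry
  | .H => wα.getD p.1 default
  | .V => wβ.getD p.2 default
  | .D3 k => match wα.getD p.1 default with
      | .dot a => .dot (a + k)
      | e => e
  | .D4 k => match wβ.getD p.2 default with
      | .dot b => .dot (b + k)
      | e => e

/-- The dotted permutation `Π(P)` corresponding to a fundamental path `P`. -/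
def PiP (wα wβ : List PEntry) (steps : List GStep) : List PEntry :=
  (steps.foldl (fun (st : (ℕ × ℕ) × List PEntry) s =>
    (stepTarget s st.1, st.2 ++ [PiStep wα wβ st.1 s])) ((0, 0), [])).2

open Classical in
/-- The sign of a fundamental path: `(−1)^{number of cells whose row and column
labels are both dotted lying below the path}`. -/
noncomputable def fsign (wα wβ : List PEntry) (steps : List GStep) : ℚ :=
  (-1) ^ (((Finset.range wα.length ×ˢ Finset.range wβ.length).filter
    (fun c => (wα.getD c.1 default).isDot = true ∧
      (wβ.getD c.2 default).isDot = true ∧ CellBelow steps c.1 c.2)).card)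

/-! ## Generic grid sums -/

def sd : GStep → ℕ × ℕ
  | .H => (1, 0)
  | .V => (0, 1)
  | .D3 k => (1, k)
  | .D4 k => (k, 1)

theorem stepTarget_eq (s : GStep) (p : ℕ × ℕ) :
    stepTarget s p = (p.1 + (sd s).1, p.2 + (sd s).2) := by
  cases s <;> simp [stepTarget, sd]

def walk (p : ℕ × ℕ) (P : List GStep) : ℕ × ℕ := P.foldl (fun p s => stepTarget s p) p

theorem walk_shift (P : List GStep) (p : ℕ × ℕ) :
    walk p P = (p.1 + (pathEnd P).1, p.2 + (pathEnd P).2) := by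
  have key : ∀ (P : List GStep) (p q : ℕ × ℕ),
      walk (p.1 + q.1, p.2 + q.2) P = (p.1 + (walk q P).1, p.2 + (walk q P).2) := by
    intro P
    induction P with
    | nil => intro p q; rfl
    | cons s P ih =>
      intro p q
      have := ih p (stepTarget s q)
      simp only [walk, List.foldl_cons, stepTarget_eq] at this ⊢
      rw [← this]
      congr 2 <;> ring
  have := key P p (0, 0)
  simpa [walk, pathEnd] using this

theorem pathEnd_cons (s : GStep) (P : List GStep) :
    pathEnd (s :: P) = ((sd s).1 + (pathEnd P).1, (sd s).2 + (pathEnd P).2) := by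
  have := walk_shift P (sd s)
  rw [← this]
  simp [walk, pathEnd, stepTarget_eq]

theorem cellBelow_nil (j i : ℕ) : ¬ CellBelow [] j i := by
  simp [CellBelow, pathVertices]

theorem mem_scanl_shift (P : List GStep) (p q : ℕ × ℕ) :
    q ∈ P.scanl (fun p s => stepTarget s p) p ↔
      ∃ r ∈ pathVertices P, q = (p.1 + r.1, p.2 + r.2) := by
  have key : ∀ (P : List GStep) (p q : ℕ × ℕ),
      P.scanl (fun p s => stepTarget s p) (p.1 + q.1, p.2 + q.2) =
        (P.scanl (fun p s => stepTarget s p) q).map (fun r => (p.1 + r.1, p.2 + r.2)) := by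
    intro P
    induction P with
    | nil => intro p q; simp
    | cons s P ih =>
      intro p q
      have := ih p (stepTarget s q)
      simp only [List.scanl_cons, List.map_cons, stepTarget_eq] at this ⊢
      rw [← this]
      congr 3 <;> ring
  have := key P p (0, 0)
  simp only [add_zero] at this
  rw [this]
  simp only [List.mem_map, pathVertices]
  constructor
  · rintro ⟨r, h, rfl⟩; exact ⟨r, h, rfl⟩
  · rintro ⟨r, h, rfl⟩; exact ⟨r, h, rfl⟩

theorem zero_mem_vertices (P : List GStep) : (0, 0) ∈ pathVertices P := by
  cases P <;> simp [pathVertices, List.scanl_cons]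

theorem cellBelow_cons (s : GStep) (P : List GStep) (j i : ℕ) :
    CellBelow (s :: P) j i ↔ (sd s).1 ≤ j ∧
      (i < (sd s).2 ∨ ((sd s).2 ≤ i ∧ CellBelow P (j - (sd s).1) (i - (sd s).2))) := by
  unfold CellBelow
  constructor
  · rintro ⟨p, hp, h1, h2⟩
    simp only [pathVertices, List.scanl_cons, List.mem_cons] at hp
    rcases hp with rfl | hp
    · simp at h2
    · rw [mem_scanl_shift] at hp
      obtain ⟨r, hr, rfl⟩ := hp
      simp only [stepTarget_eq] at h1 h2
      simp only [zero_add] at h1 h2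
      refine ⟨by omega, ?_⟩
      by_cases h : i < (sd s).2
      · exact Or.inl h
      · refine Or.inr ⟨by omega, r, hr, by omega, by omega⟩
  · rintro ⟨h1, h2⟩
    have : ∀ r ∈ pathVertices P, ((sd s).1 + r.1, (sd s).2 + r.2) ∈ pathVertices (s :: P) := by
      intro r hr
      simp only [pathVertices, List.scanl_cons, List.mem_cons]
      right
      rw [mem_scanl_shift]
      exact ⟨r, hr, by simp [stepTarget_eq]⟩
    rcases h2 with h2 | ⟨h2, r, hr, h3, h4⟩
    · exact ⟨_, this _ (zero_mem_vertices P), by simpa using h1, by simpa using h2⟩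
    · exact ⟨_, this _ hr, by simp; omega, by simp; omega⟩

section Generic

variable {X : Type} (d : X → Bool) (e0 : X)
  (ok : List X → List X → GStep → Prop) (lab : List X → List X → GStep → X)

def dc (u : List X) : ℕ := u.countP d

open Classical in
noncomputable def gcnt (u w : List X) (P : List GStep) : ℕ :=
  ((Finset.range u.length ×ˢ Finset.range w.length).filter
    (fun c => d (u.getD c.1 e0) = true ∧
      d (w.getD c.2 e0) = true ∧ CellBelow P c.1 c.2)).card

def gout : List X → List X → List GStep → List X
  | _, _, [] => []
  | u, w, s :: P => lab u w s :: gout (u.drop (sd s).1) (w.drop (sd s).2) P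

def gpaths (u w : List X) : Set (List GStep) :=
  {P | PathOKWith (fun p s => ok (u.drop p.1) (w.drop p.2) s) (u.length, w.length) P}

theorem dc_eq_sum (u : List X) :
    dc d u = ∑ i ∈ Finset.range u.length, if d (u.getD i e0) = true then 1 else 0 := by
  induction u with
  | nil => simp [dc]
  | cons x u ih =>
    rw [List.length_cons, Finset.sum_range_succ']
    simp only [List.getD_cons_succ, List.getD_cons_zero]
    rw [← ih]
    simp [dc, List.countP_cons]

open Classical in
theorem gcnt_eq_sum (u w : List X) (P : List GStep) :
    gcnt d e0 u w P = ∑ j ∈ Finset.range u.length, ∑ i ∈ Finset.range w.length,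
      if (d (u.getD j e0) = true ∧ d (w.getD i e0) = true ∧ CellBelow P j i) then 1 else 0 := by
  rw [gcnt, Finset.card_filter, Finset.sum_product]

theorem gcnt_nil (u w : List X) : gcnt d e0 u w [] = 0 := by
  simp [gcnt, cellBelow_nil]

theorem sum_split {M : Type*} [AddCommMonoid M] (f : ℕ → M) (a n : ℕ) (h : a ≤ n) :
    ∑ i ∈ Finset.range n, f i =
      ∑ i ∈ Finset.range a, f i + ∑ i ∈ Finset.range (n - a), f (a + i) := by
  obtain ⟨m, rfl⟩ := Nat.exists_eq_add_of_le h
  rw [Finset.sum_range_add]; simp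

open Classical in
theorem gcnt_cons (u w : List X) (s : GStep) (P : List GStep)
    (h1 : (sd s).1 ≤ u.length) (h2 : (sd s).2 ≤ w.length) :
    gcnt d e0 u w (s :: P) = dc d (w.take (sd s).2) * dc d (u.drop (sd s).1) +
      gcnt d e0 (u.drop (sd s).1) (w.drop (sd s).2) P := by
  rw [gcnt_eq_sum, gcnt_eq_sum, sum_split _ _ _ h1]
  have e1 : ∀ j ∈ Finset.range (sd s).1, (∑ i ∈ Finset.range w.length,
      if (d (u.getD j e0) = true ∧ d (w.getD i e0) = true ∧ CellBelow (s :: P) j i)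
        then 1 else 0) = 0 := by
    intro j hj
    apply Finset.sum_eq_zero
    intro i _
    rw [if_neg]
    rintro ⟨_, _, h⟩
    rw [cellBelow_cons] at h
    simp at hj; omega
  rw [Finset.sum_eq_zero e1, zero_add]
  rw [dc_eq_sum d e0 (u.drop _), Finset.mul_sum, List.length_drop, List.length_drop,
    ← Finset.sum_add_distrib]
  apply Finset.sum_congr rfl
  intro j _
  rw [sum_split _ _ _ h2]
  have g1 : (u.drop (sd s).1).getD j e0 = u.getD ((sd s).1 + j) e0 := by
    simp [List.getD_eq_getElem?_getD]
  congr 1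
  · rw [dc_eq_sum d e0 (w.take _), Finset.sum_mul]
    rw [List.length_take, min_eq_left h2]
    apply Finset.sum_congr rfl
    intro i hi
    have hi' : i < (sd s).2 := by simpa using hi
    have g2 : (w.take (sd s).2).getD i e0 = w.getD i e0 := by
      simp [List.getD_eq_getElem?_getD, hi']
    rw [g1, g2]
    have : CellBelow (s :: P) ((sd s).1 + j) i := by
      rw [cellBelow_cons]; exact ⟨by omega, Or.inl hi'⟩
    simp only [this, and_true]
    split_ifs <;> simp_all
  · apply Finset.sum_congr rfl
    intro i hi
    have g2 : (w.drop (sd s).2).getD i e0 = w.getD ((sd s).2 + i) e0 := by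
      simp [List.getD_eq_getElem?_getD]
    rw [g1, g2]
    have : CellBelow (s :: P) ((sd s).1 + j) ((sd s).2 + i) ↔ CellBelow P j i := by
      rw [cellBelow_cons]; simp
    simp only [this]

/-- the step bounds condition -/
def Bnd : Prop := ∀ u w s, ok u w s →
  (sd s).1 ≤ u.length ∧ (sd s).2 ≤ w.length ∧ 0 < (sd s).1 + (sd s).2

variable {ok}

theorem mem_gpaths_nil (u w : List X) : [] ∈ gpaths ok u w ↔ u = [] ∧ w = [] := by
  simp only [gpaths, PathOKWith, Set.mem_ofPred_eq]
  constructor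
  · rintro ⟨_, h⟩
    simp only [pathEnd, List.foldl_nil, Prod.mk.injEq] at h
    exact ⟨List.length_eq_zero_iff.1 h.1.symm, List.length_eq_zero_iff.1 h.2.symm⟩
  · rintro ⟨rfl, rfl⟩
    refine ⟨?_, rfl⟩
    intro pre s post h
    simp at h

theorem mem_gpaths_cons (hb : Bnd ok) (u w : List X) (s : GStep) (P : List GStep) :
    s :: P ∈ gpaths ok u w ↔ ok u w s ∧ P ∈ gpaths ok (u.drop (sd s).1) (w.drop (sd s).2) := by
  simp only [gpaths, PathOKWith, Set.mem_ofPred_eq, pathEnd_cons]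
  have ok0 : (∀ pre s' post, s :: P = pre ++ s' :: post →
      ok (u.drop (pathEnd pre).1) (w.drop (pathEnd pre).2) s') ↔ (ok u w s ∧
      ∀ pre s' post, P = pre ++ s' :: post →
      ok ((u.drop (sd s).1).drop (pathEnd pre).1) ((w.drop (sd s).2).drop (pathEnd pre).2) s') := by
    constructor
    · intro h
      refine ⟨by simpa [pathEnd] using h [] s P rfl, ?_⟩
      intro pre s' post hP
      have := h (s :: pre) s' post (by simp [hP])
      rw [pathEnd_cons] at this
      simpa [List.drop_drop] using this
    · rintro ⟨h, h'⟩ pre s' post hP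
      cases pre with
      | nil =>
        simp only [List.nil_append, List.cons.injEq] at hP
        rw [← hP.1]; simpa [pathEnd] using h
      | cons t pre =>
        simp only [List.cons_append, List.cons.injEq] at hP
        obtain ⟨rfl, hP⟩ := hP
        have := h' pre s' post hP
        rw [pathEnd_cons]
        simpa [List.drop_drop] using this
  rw [ok0, and_assoc]
  apply and_congr_right
  intro h
  obtain ⟨h1, h2, _⟩ := hb _ _ _ h
  apply and_congr_right
  intro _
  simp only [Prod.ext_iff, List.length_drop]
  omega

theorem Bnd.list (hb : Bnd ok) {u w : List X} {s : GStep} (h : ok u w s) :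
    s ∈ ({GStep.H, GStep.V} : Finset GStep) ∪ (Finset.range (w.length + 1)).image GStep.D3 ∪
      (Finset.range (u.length + 1)).image GStep.D4 := by
  obtain ⟨h1, h2, _⟩ := hb _ _ _ h
  cases s <;> simp_all [sd] <;> omega

theorem gpaths_eq (hb : Bnd ok) (u w : List X) (hne : ¬ (u = [] ∧ w = [])) :
    gpaths ok u w = ⋃ s ∈ {s | ok u w s},
      (List.cons s) '' gpaths ok (u.drop (sd s).1) (w.drop (sd s).2) := by
  ext P
  simp only [Set.mem_iUnion, Set.mem_image, Set.mem_ofPred_eq]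
  cases P with
  | nil => simp [mem_gpaths_nil, hne]
  | cons s P =>
    rw [mem_gpaths_cons hb]
    constructor
    · rintro ⟨h, h'⟩; exact ⟨s, h, P, h', rfl⟩
    · rintro ⟨t, h, Q, h', h2⟩
      simp only [List.cons.injEq] at h2
      obtain ⟨rfl, rfl⟩ := h2
      exact ⟨h, h'⟩

theorem okset_finite (hb : Bnd ok) (u w : List X) : {s | ok u w s}.Finite :=
  Set.Finite.subset (Finset.finite_toSet _) (fun _ h => hb.list h)

theorem gpaths_nil_nil (hb : Bnd ok) : gpaths ok ([] : List X) [] = {[]} := by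
  ext P
  cases P with
  | nil => simp [mem_gpaths_nil]
  | cons s P =>
    simp only [mem_gpaths_cons hb, Set.mem_singleton_iff]
    constructor
    · rintro ⟨h, _⟩
      have := hb _ _ _ h
      simp at this; omega
    · intro h; simp at h

theorem gpaths_finite (hb : Bnd ok) (u w : List X) : (gpaths ok u w).Finite := by
  induction hn : u.length + w.length using Nat.strong_induction_on generalizing u w with
  | _ n ih =>
    by_cases hne : u = [] ∧ w = []
    · obtain ⟨rfl, rfl⟩ := hne
      rw [gpaths_nil_nil hb]; exact Set.finite_singleton _
    · rw [gpaths_eq hb _ _ hne]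
      apply Set.Finite.biUnion (okset_finite hb u w)
      intro s hs
      obtain ⟨h1, h2, h3⟩ := hb _ _ _ hs
      apply Set.Finite.image
      apply ih _ _ _ _ rfl
      simp; omega

variable (ok)

noncomputable def gsum (φ : List X → sQSym) (u w : List X) : sQSym :=
  ∑ᶠ P ∈ gpaths ok u w, ((-1 : ℚ) ^ gcnt d e0 u w P) • φ (gout lab u w P)

noncomputable def gsg (u w : List X) (s : GStep) : ℚ :=
  (-1) ^ (dc d (w.take (sd s).2) * dc d (u.drop (sd s).1))

noncomputable def gterm (φ : List X → sQSym) (u w : List X) (s : GStep) : sQSym :=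
  gsg d u w s • gsum d e0 ok lab (fun v => φ (lab u w s :: v)) (u.drop (sd s).1) (w.drop (sd s).2)

variable {ok}

theorem gsum_nil_nil (hb : Bnd ok) (φ : List X → sQSym) :
    gsum d e0 ok lab φ [] [] = φ [] := by
  rw [gsum, gpaths_nil_nil hb, finsum_mem_singleton, gcnt_nil]
  simp [gout]

open Classical in
theorem gsum_rec (hb : Bnd ok) (φ : List X → sQSym) (u w : List X) (hne : ¬ (u = [] ∧ w = [])) :
    gsum d e0 ok lab φ u w =
      (if ok u w .H then gterm d e0 ok lab φ u w .H else 0) +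
      (if ok u w .V then gterm d e0 ok lab φ u w .V else 0) +
      (∑ k ∈ Finset.range (w.length + 1),
        if ok u w (.D3 k) then gterm d e0 ok lab φ u w (.D3 k) else 0) +
      (∑ k ∈ Finset.range (u.length + 1),
        if ok u w (.D4 k) then gterm d e0 ok lab φ u w (.D4 k) else 0) := by
  have step : gsum d e0 ok lab φ u w = ∑ᶠ s ∈ {s | ok u w s}, gterm d e0 ok lab φ u w s := by
    rw [gsum, gpaths_eq hb _ _ hne, finsum_mem_biUnion]
    · apply finsum_mem_congr rfl
      intro s hs
      obtain ⟨h1, h2, _⟩ := hb _ _ _ hs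
      rw [finsum_mem_image (by intro a _ b _ h; simpa using h)]
      rw [gterm, gsum, smul_finsum_mem (gpaths_finite hb _ _)]
      apply finsum_mem_congr rfl
      intro P _
      rw [gcnt_cons d e0 u w s P h1 h2, pow_add, mul_smul]
      rfl
    · intro s _ t _ hst
      rw [Function.onFun, Set.disjoint_left]
      rintro P ⟨Q, _, rfl⟩ ⟨Q', _, h⟩
      simp only [List.cons.injEq] at h
      exact hst h.1.symm
    · exact okset_finite hb u w
    · intro s _
      exact (gpaths_finite hb _ _).image _
  rw [step]
  have : ∑ᶠ s ∈ {s | ok u w s}, gterm d e0 ok lab φ u w s =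
      ∑ s ∈ ({GStep.H, GStep.V} : Finset GStep) ∪
        (Finset.range (w.length + 1)).image GStep.D3 ∪
      (Finset.range (u.length + 1)).image GStep.D4,
        if ok u w s then gterm d e0 ok lab φ u w s else 0 := by
    rw [finsum_mem_def, finsum_eq_sum_of_support_subset]
    · apply Finset.sum_congr rfl
      intro s _
      simp [Set.indicator]
    · intro s hs
      simp only [Function.mem_support, ne_eq, Set.indicator_apply_eq_zero, not_forall] at hs
      obtain ⟨h, _⟩ := hs
      exact_mod_cast hb.list h
  rw [this, Finset.sum_union, Finset.sum_union, Finset.sum_pair (by simp), Finset.sum_image,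
    Finset.sum_image]
  · intro a _ b _ h; simpa using h
  · intro a _ b _ h; simpa using h
  · rw [Finset.disjoint_left]; intro s h h'
    simp at h h'
    rcases h with rfl | rfl <;> simp at h'
  · rw [Finset.disjoint_left]; intro s h h'
    simp at h h'
    obtain ⟨a, _, rfl⟩ := h'
    simp at h

theorem gsum_add (hb : Bnd ok) (φ ψ : List X → sQSym) (u w : List X) :
    gsum d e0 ok lab (fun v => φ v + ψ v) u w =
      gsum d e0 ok lab φ u w + gsum d e0 ok lab ψ u w := by
  simp only [gsum, smul_add]
  exact finsum_mem_add_distrib (gpaths_finite hb u w)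

theorem gsum_zero (u w : List X) :
    gsum d e0 ok lab (fun _ => 0) u w = 0 := by
  simp [gsum]

theorem gsum_map (hb : Bnd ok) (L : sQSym →ₗ[ℚ] sQSym) (φ : List X → sQSym) (u w : List X) :
    gsum d e0 ok lab (fun v => L (φ v)) u w = L (gsum d e0 ok lab φ u w) := by
  simp only [gsum]
  rw [finsum_mem_eq_finite_toFinset_sum _ (gpaths_finite hb u w),
    finsum_mem_eq_finite_toFinset_sum _ (gpaths_finite hb u w), map_sum]
  simp

end Generic
/-! ## The monomial product -/

def okO (u w : DComp) (s : GStep) : Prop := OStepOK u w (0, 0) s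

def labO (u w : DComp) (s : GStep) : DEntry := match s with
  | .H => u.getD 0 (DEntry.undot 1)
  | .V => w.getD 0 (DEntry.undot 1)
  | _ => (DEntry.add? (u.getD 0 (DEntry.undot 1)) (w.getD 0 (DEntry.undot 1))).getD (DEntry.undot 1)

theorem okO_bnd : Bnd okO := by
  intro u w s h
  cases s <;> simp only [okO, OStepOK] at h <;> simp only [sd] <;> omega

theorem getD_drop_zero {X : Type} (u : List X) (n : ℕ) (e : X) :
    (u.drop n).getD 0 e = u.getD n e := by
  simp [List.getD_eq_getElem?_getD]

theorem okO_drop (u w : DComp) (p : ℕ × ℕ) (s : GStep) :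
    okO (u.drop p.1) (w.drop p.2) s ↔ OStepOK u w p s := by
  cases s <;> simp only [okO, OStepOK, getD_drop_zero, List.length_drop, zero_add, Nat.sub_pos_iff_lt]

theorem oGamma_aux (u w : DComp) (P : List GStep) (p : ℕ × ℕ) (acc : DComp) :
    (P.foldl (fun (st : (ℕ × ℕ) × DComp) s =>
    let e : DEntry := match s with
      | .H => u.getD st.1.1 (DEntry.undot 1)
      | .V => w.getD st.1.2 (DEntry.undot 1)
      | _ => (DEntry.add? (u.getD st.1.1 (DEntry.undot 1))
                (w.getD st.1.2 (DEntry.undot 1))).getD (DEntry.undot 1)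
    (stepTarget s st.1, st.2 ++ [e])) (p, acc)).2 =
      acc ++ gout labO (u.drop p.1) (w.drop p.2) P := by
  induction P generalizing p acc with
  | nil => simp [gout]
  | cons s P ih =>
    rw [List.foldl_cons]
    simp only []
    rw [ih]
    simp only [gout, List.append_assoc, List.drop_drop, stepTarget_eq]
    cases s <;> simp only [labO, getD_drop_zero, List.cons_append, List.nil_append]

theorem monoMul_eq (u w : DComp) :
    monoMul u w = gsum DEntry.isDot (DEntry.undot 1) okO labO Mono u w := by
  unfold monoMul gsum
  apply finsum_mem_congr
  · simp only [gpaths, okO_drop]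
  · intro P _
    have : oGamma u w P = gout labO u w P :=
      (oGamma_aux u w P (0, 0) []).trans (by simp)
    rw [this]
    rfl

noncomputable def pre (e : DEntry) : sQSym →ₗ[ℚ] sQSym := Finsupp.lmapDomain ℚ ℚ (List.cons e)

theorem pre_Mono (e : DEntry) (α : DComp) : pre e (Mono α) = Mono (e :: α) := by
  simp [pre, Mono, Finsupp.mapDomain_single]

noncomputable abbrev GO (φ : DComp → sQSym) := gsum DEntry.isDot (DEntry.undot 1) okO labO φ

theorem GO_nil_left (φ : DComp → sQSym) (w : DComp) : GO φ [] w = φ w := by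
  induction w generalizing φ with
  | nil => exact gsum_nil_nil _ _ _ okO_bnd _
  | cons y w ih =>
    rw [GO, gsum_rec _ _ _ okO_bnd _ _ _ (by simp)]
    simp only [GO] at ih
    simp [okO, OStepOK, gterm, gsg, sd, dc, labO, ih]

theorem GO_nil_right (φ : DComp → sQSym) (u : DComp) : GO φ u [] = φ u := by
  induction u generalizing φ with
  | nil => exact gsum_nil_nil _ _ _ okO_bnd _
  | cons y w ih =>
    rw [GO, gsum_rec _ _ _ okO_bnd _ _ _ (by simp)]
    simp only [GO] at ih
    simp [okO, OStepOK, gterm, gsg, sd, dc, labO, ih]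

/-- the sign of crossing a row labelled `y` with the columns `u` remaining -/
noncomputable def sgO (y : DEntry) (u : DComp) : ℚ :=
  if y.isDot then (-1) ^ dc DEntry.isDot u else 1

theorem monoMul_nil_left (w : DComp) : monoMul [] w = Mono w := by
  rw [monoMul_eq]; exact GO_nil_left _ _

theorem monoMul_nil_right (w : DComp) : monoMul w [] = Mono w := by
  rw [monoMul_eq]; exact GO_nil_right _ _

theorem monoMul_cons (x y : DEntry) (u w : DComp) :
    monoMul (x :: u) (y :: w) = pre x (monoMul u (y :: w)) +
      sgO y (x :: u) • pre y (monoMul (x :: u) w) +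
      (match DEntry.add? x y with
        | some z => sgO y u • pre z (monoMul u w)
        | none => 0) := by
  simp only [monoMul_eq]
  rw [gsum_rec _ _ _ okO_bnd _ _ _ (by simp)]
  have h4 : ∀ k, ¬ okO (x :: u) (y :: w) (.D4 k) := by intro k; simp [okO, OStepOK]
  have h3 : ∀ k, okO (x :: u) (y :: w) (.D3 k) ↔ (k = 1 ∧ ¬ (x.isDot = true ∧ y.isDot = true)) := by
    intro k; simp [okO, OStepOK]
  have h1 : okO (x :: u) (y :: w) .H := by simp [okO, OStepOK]
  have h2 : okO (x :: u) (y :: w) .V := by simp [okO, OStepOK]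
  simp only [h4, h3, h1, h2, if_true, if_false, Finset.sum_const_zero, add_zero]
  rw [Finset.sum_eq_single 1 (by intro b _ hb; simp [hb]) (by simp)]
  have hm : ∀ (e : DEntry) (u w : DComp), gsum DEntry.isDot (DEntry.undot 1) okO labO
      (fun v => Mono (e :: v)) u w = pre e (gsum DEntry.isDot (DEntry.undot 1) okO labO Mono u w) := by
    intro e u w
    rw [← gsum_map _ _ _ okO_bnd]
    simp only [pre_Mono]
  simp only [gterm, hm]
  congr 1
  · congr 1
    · simp [sd, gsg, labO, dc]
    · cases y <;> simp [sd, gsg, labO, dc, sgO, DEntry.isDot]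
  · cases x <;> cases y <;> simp [sd, gsg, labO, dc, sgO, DEntry.isDot, DEntry.add?]

/-- bilinear version of the product -/
noncomputable def qm : sQSym →ₗ[ℚ] sQSym →ₗ[ℚ] sQSym :=
  Finsupp.linearCombination ℚ (fun α => Finsupp.linearCombination ℚ (monoMul α))

theorem qmul_eq (F G : sQSym) : qmul F G = qm F G := by
  unfold qmul qm
  rw [Finsupp.linearCombination_apply, Finsupp.sum, Finsupp.sum, LinearMap.sum_apply]
  apply Finset.sum_congr rfl
  intro α _
  rw [LinearMap.smul_apply, Finsupp.linearCombination_apply, Finsupp.smul_sum]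
  simp only [mul_smul]

theorem qm_Mono (α β : DComp) : qm (Mono α) (Mono β) = monoMul α β := by
  simp [qm, Mono]

noncomputable def sgm : sQSym →ₗ[ℚ] sQSym :=
  Finsupp.linearCombination ℚ (fun α => ((-1 : ℚ) ^ dc DEntry.isDot α) • Mono α)

theorem sgm_Mono (α : DComp) : sgm (Mono α) = ((-1 : ℚ) ^ dc DEntry.isDot α) • Mono α := by
  simp [sgm, Mono]

theorem lin_ext {A B : sQSym →ₗ[ℚ] sQSym} (h : ∀ α, A (Mono α) = B (Mono α)) : A = B := by
  apply Finsupp.lhom_ext'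
  intro α
  ext
  simpa [Mono] using DFunLike.congr_fun (h α) _

theorem lin2_ext {A B : sQSym →ₗ[ℚ] sQSym →ₗ[ℚ] sQSym}
    (h : ∀ α β, A (Mono α) (Mono β) = B (Mono α) (Mono β)) : A = B := by
  apply Finsupp.lhom_ext'
  intro α
  ext1
  have := lin_ext (A := A (Mono α)) (B := B (Mono α)) (h α)
  simpa [Mono] using this

theorem qm_nil_left (Y : sQSym) : qm (Mono []) Y = Y := by
  have := lin_ext (A := qm (Mono [])) (B := LinearMap.id) (by
    intro α; simp [qm_Mono, monoMul_nil_left])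
  rw [this]; rfl

theorem qm_nil_right (Y : sQSym) : qm Y (Mono []) = Y := by
  have := lin_ext (A := qm.flip (Mono [])) (B := LinearMap.id) (by
    intro α; simp [qm_Mono, monoMul_nil_right])
  exact DFunLike.congr_fun this Y

theorem sgm_pre_undot (n : ℕ+) (X : sQSym) : sgm (pre (.undot n) X) = pre (.undot n) (sgm X) := by
  have := lin_ext (A := sgm ∘ₗ pre (.undot n)) (B := pre (.undot n) ∘ₗ sgm) (by
    intro α; simp [pre_Mono, sgm_Mono, dc, DEntry.isDot])
  exact DFunLike.congr_fun this X

theorem sgm_pre_dot (n : ℕ) (X : sQSym) : sgm (pre (.dot n) X) = - pre (.dot n) (sgm X) := by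
  have := lin_ext (A := sgm ∘ₗ pre (.dot n)) (B := - pre (.dot n) ∘ₗ sgm) (by
    intro α
    have : dc DEntry.isDot (.dot n :: α) = dc DEntry.isDot α + 1 := by
      rw [dc, List.countP_cons_of_pos (by rfl)]; rfl
    simp [pre_Mono, sgm_Mono, this, pow_succ])
  exact DFunLike.congr_fun this X

theorem qm_uu (m n : ℕ+) (X Y : sQSym) :
    qm (pre (.undot m) X) (pre (.undot n) Y) = pre (.undot m) (qm X (pre (.undot n) Y)) +
      pre (.undot n) (qm (pre (.undot m) X) Y) + pre (.undot (m + n)) (qm X Y) := by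
  have := lin2_ext (A := qm.compl₁₂ (pre (.undot m)) (pre (.undot n)))
    (B := (qm.compl₁₂ LinearMap.id (pre (.undot n))).compr₂ (pre (.undot m)) +
      (qm.compl₁₂ (pre (.undot m)) LinearMap.id).compr₂ (pre (.undot n)) +
      qm.compr₂ (pre (.undot (m + n)))) (by
      intro α β
      simp [pre_Mono, qm_Mono, monoMul_cons, sgO, DEntry.isDot, DEntry.add?])
  exact DFunLike.congr_fun (DFunLike.congr_fun this X) Y

theorem qm_du (m : ℕ) (n : ℕ+) (X Y : sQSym) :
    qm (pre (.dot m) X) (pre (.undot n) Y) = pre (.dot m) (qm X (pre (.undot n) Y)) +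
      pre (.undot n) (qm (pre (.dot m) X) Y) + pre (.dot (m + n)) (qm X Y) := by
  have := lin2_ext (A := qm.compl₁₂ (pre (.dot m)) (pre (.undot n)))
    (B := (qm.compl₁₂ LinearMap.id (pre (.undot n))).compr₂ (pre (.dot m)) +
      (qm.compl₁₂ (pre (.dot m)) LinearMap.id).compr₂ (pre (.undot n)) +
      qm.compr₂ (pre (.dot (m + n)))) (by
      intro α β
      simp [pre_Mono, qm_Mono, monoMul_cons, sgO, DEntry.isDot, DEntry.add?])
  exact DFunLike.congr_fun (DFunLike.congr_fun this X) Y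

theorem qm_ud (m : ℕ+) (n : ℕ) (X Y : sQSym) :
    qm (pre (.undot m) X) (pre (.dot n) Y) = pre (.undot m) (qm X (pre (.dot n) Y)) +
      pre (.dot n) (qm (sgm (pre (.undot m) X)) Y) + pre (.dot (m + n)) (qm (sgm X) Y) := by
  have := lin2_ext (A := qm.compl₁₂ (pre (.undot m)) (pre (.dot n)))
    (B := (qm.compl₁₂ LinearMap.id (pre (.dot n))).compr₂ (pre (.undot m)) +
      (qm.compl₁₂ (sgm ∘ₗ pre (.undot m)) LinearMap.id).compr₂ (pre (.dot n)) +
      (qm.compl₁₂ sgm LinearMap.id).compr₂ (pre (.dot (m + n)))) (by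
      intro α β
      simp [pre_Mono, qm_Mono, sgm_Mono, monoMul_cons, sgO, DEntry.isDot, DEntry.add?])
  exact DFunLike.congr_fun (DFunLike.congr_fun this X) Y

theorem qm_dd (m : ℕ) (n : ℕ) (X Y : sQSym) :
    qm (pre (.dot m) X) (pre (.dot n) Y) = pre (.dot m) (qm X (pre (.dot n) Y)) +
      pre (.dot n) (qm (sgm (pre (.dot m) X)) Y) := by
  have := lin2_ext (A := qm.compl₁₂ (pre (.dot m)) (pre (.dot n)))
    (B := (qm.compl₁₂ LinearMap.id (pre (.dot n))).compr₂ (pre (.dot m)) +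
      (qm.compl₁₂ (sgm ∘ₗ pre (.dot m)) LinearMap.id).compr₂ (pre (.dot n))) (by
      intro α β
      simp [pre_Mono, qm_Mono, sgm_Mono, monoMul_cons, sgO, DEntry.isDot, DEntry.add?])
  exact DFunLike.congr_fun (DFunLike.congr_fun this X) Y
/-! ## Refinements and the fundamental basis -/

theorem strongLe_nil (γ : DComp) : DComp.StrongLe γ [] ↔ γ = [] := by
  constructor
  · intro h
    induction h using Relation.ReflTransGen.head_induction_on with
    | refl => rfl
    | head h _ ih =>
      subst ih
      obtain ⟨l, r, a, b, _, h⟩ := h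
      simp at h
  · rintro rfl; exact Relation.ReflTransGen.refl

theorem strongCover_cons (e : DEntry) {γ α : DComp} (h : DComp.StrongCover γ α) :
    DComp.StrongCover (e :: γ) (e :: α) := by
  obtain ⟨l, r, a, b, rfl, rfl⟩ := h
  exact ⟨e :: l, r, a, b, rfl, rfl⟩

theorem strongLe_cons (e : DEntry) {γ α : DComp} (h : DComp.StrongLe γ α) :
    DComp.StrongLe (e :: γ) (e :: α) :=
  Relation.ReflTransGen.lift (List.cons e) (fun _ _ h => strongCover_cons e h) _ _ h

theorem strongCover_cons_inv {γ α : DComp} {e : DEntry} (h : DComp.StrongCover γ (e :: α)) :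
    (∃ γ', γ = e :: γ' ∧ DComp.StrongCover γ' α) ∨
    (∃ a b : ℕ+, e = .undot (a + b) ∧ γ = .undot a :: .undot b :: α) := by
  obtain ⟨l, r, a, b, rfl, h⟩ := h
  cases l with
  | nil =>
    simp only [List.nil_append, List.cons.injEq] at h
    obtain ⟨rfl, rfl⟩ := h
    exact Or.inr ⟨a, b, rfl, rfl⟩
  | cons f l =>
    simp only [List.cons_append, List.cons.injEq] at h
    obtain ⟨rfl, rfl⟩ := h
    exact Or.inl ⟨_, rfl, l, r, a, b, rfl, rfl⟩

theorem strongLe_dot (a : ℕ) (γ α : DComp) : DComp.StrongLe γ (.dot a :: α) ↔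
    ∃ γ', γ = .dot a :: γ' ∧ DComp.StrongLe γ' α := by
  constructor
  · intro h
    induction h using Relation.ReflTransGen.head_induction_on with
    | refl => exact ⟨α, rfl, Relation.ReflTransGen.refl⟩
    | head h _ ih =>
      obtain ⟨γ', rfl, h'⟩ := ih
      rcases strongCover_cons_inv h with ⟨δ, rfl, h2⟩ | ⟨_, _, h2, _⟩
      · exact ⟨δ, rfl, Relation.ReflTransGen.head h2 h'⟩
      · simp at h2
  · rintro ⟨γ', rfl, h⟩; exact strongLe_cons _ h

theorem strongLe_undot (n : ℕ+) (γ α : DComp) : DComp.StrongLe γ (.undot n :: α) ↔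
    (∃ γ', γ = .undot n :: γ' ∧ DComp.StrongLe γ' α) ∨
    (∃ a b : ℕ+, a + b = n ∧ ∃ γ', γ = .undot a :: γ' ∧ DComp.StrongLe γ' (.undot b :: α)) := by
  constructor
  · intro h
    induction h using Relation.ReflTransGen.head_induction_on with
    | refl => exact Or.inl ⟨α, rfl, Relation.ReflTransGen.refl⟩
    | head h _ ih =>
      rcases ih with ⟨γ', rfl, h'⟩ | ⟨a, b, rfl, γ', rfl, h'⟩
      · rcases strongCover_cons_inv h with ⟨δ, rfl, h2⟩ | ⟨a, b, h2, rfl⟩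
        · exact Or.inl ⟨δ, rfl, Relation.ReflTransGen.head h2 h'⟩
        · simp only [DEntry.undot.injEq] at h2
          exact Or.inr ⟨a, b, h2.symm, _, rfl, strongLe_cons _ h'⟩
      · rcases strongCover_cons_inv h with ⟨δ, rfl, h2⟩ | ⟨c, d, h2, rfl⟩
        · exact Or.inr ⟨a, b, rfl, δ, rfl, Relation.ReflTransGen.head h2 h'⟩
        · simp only [DEntry.undot.injEq] at h2
          subst h2
          refine Or.inr ⟨c, d + b, by rw [add_assoc], _, rfl, ?_⟩
          refine Relation.ReflTransGen.trans (strongLe_cons _ h') ?_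
          exact Relation.ReflTransGen.single ⟨[], α, d, b, rfl, rfl⟩
  · rintro (⟨γ', rfl, h⟩ | ⟨a, b, rfl, γ', rfl, h⟩)
    · exact strongLe_cons _ h
    · exact Relation.ReflTransGen.trans (strongLe_cons _ h)
        (Relation.ReflTransGen.single ⟨[], α, a, b, rfl, rfl⟩)

abbrev un (n : ℕ) : DEntry := .undot n.succPNat

theorem un_inj {m n : ℕ} : un m = un n ↔ m = n := by
  simp

def rset (α : DComp) : Set DComp := {γ | DComp.StrongLe γ α}

theorem rset_nil : rset [] = {[]} := by ext; simp [rset, strongLe_nil]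

theorem rset_dot (a : ℕ) (α : DComp) : rset (.dot a :: α) = List.cons (.dot a) '' rset α := by
  ext γ; simp only [rset, strongLe_dot, Set.mem_image, Set.mem_ofPred_eq]
  constructor
  · rintro ⟨γ', rfl, h⟩; exact ⟨γ', h, rfl⟩
  · rintro ⟨γ', h, rfl⟩; exact ⟨γ', rfl, h⟩

theorem rset_un (n : ℕ) (α : DComp) : rset (un n :: α) =
    (⋃ i ∈ (Finset.range n : Set ℕ), List.cons (un i) '' rset (un (n - 1 - i) :: α)) ∪
      List.cons (un n) '' rset α := by
  ext γ
  simp only [rset, un, Set.mem_image, Set.mem_ofPred_eq, Set.mem_union,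
    Set.mem_iUnion]
  rw [strongLe_undot]
  constructor
  · rintro (⟨γ', rfl, h⟩ | ⟨a, b, hab, γ', rfl, h⟩)
    · right; exact ⟨γ', h, rfl⟩
    · left
      have hab' : (a : ℕ) + b = n + 1 := by
        have := congrArg (fun x : ℕ+ => (x : ℕ)) hab
        simpa using this
      have ha := a.pos
      have hb := b.pos
      refine ⟨a.natPred, ?_, γ', ?_, ?_⟩
      · simp [PNat.natPred]; omega
      · have : (n - 1 - a.natPred).succPNat = b := by
          apply PNat.eq; simp [PNat.natPred]; omega
        rw [this]; exact h
      · simp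
  · rintro (⟨i, hi, γ', h, rfl⟩ | ⟨γ', h, rfl⟩)
    · right
      refine ⟨_, (n - 1 - i).succPNat, ?_, γ', rfl, ?_⟩
      · apply PNat.eq
        simp at hi
        simp; omega
      · exact h
    · left; exact ⟨γ', rfl, h⟩

theorem rset_finite (α : DComp) : (rset α).Finite := by
  induction α with
  | nil => rw [rset_nil]; exact Set.finite_singleton _
  | cons e α ih =>
    cases e with
    | dot a => rw [rset_dot]; exact ih.image _
    | undot n =>
      obtain ⟨m, rfl⟩ : ∃ m : ℕ, n = m.succPNat := ⟨n.natPred, by simp⟩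
      induction m using Nat.strong_induction_on with
      | _ m ihm =>
        have := rset_un m α
        simp only [un] at this
        rw [this]
        apply Set.Finite.union
        · apply Set.Finite.biUnion (Finset.finite_toSet _)
          intro i hi
          apply Set.Finite.image
          apply ihm
          simp at hi; omega
        · exact ih.image _

theorem cons_sum (e : DEntry) (α : DComp) :
    ∑ᶠ γ ∈ List.cons e '' rset α, Mono γ = pre e (Fund α) := by
  rw [finsum_mem_image (by intro a _ b _ h; simpa using h)]
  simp only [← pre_Mono, Fund]
  change ∑ᶠ j ∈ rset α, _ = pre e (∑ᶠ j ∈ rset α, _)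
  rw [finsum_mem_eq_finite_toFinset_sum _ (rset_finite α),
    finsum_mem_eq_finite_toFinset_sum _ (rset_finite α), map_sum]

theorem Fund_nil : Fund [] = Mono [] := by
  change ∑ᶠ j ∈ rset [], _ = _
  rw [rset_nil, finsum_mem_singleton]

theorem Fund_dot (a : ℕ) (α : DComp) : Fund (.dot a :: α) = pre (.dot a) (Fund α) := by
  change ∑ᶠ j ∈ rset _, _ = _
  rw [rset_dot, cons_sum]

theorem Fund_un (n : ℕ) (α : DComp) : Fund (un n :: α) =
    ∑ i ∈ Finset.range n, pre (un i) (Fund (un (n - 1 - i) :: α)) + pre (un n) (Fund α) := by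
  change ∑ᶠ j ∈ rset _, _ = _
  rw [rset_un, finsum_mem_union, cons_sum, finsum_mem_biUnion]
  · rw [finsum_mem_coe_finset]
    simp only [cons_sum]
  · intro s _ t _ hst
    rw [Function.onFun, Set.disjoint_left]
    rintro P ⟨Q, _, rfl⟩ ⟨Q', _, h⟩
    simp only [List.cons.injEq, un_inj] at h
    exact hst h.1.symm
  · exact Finset.finite_toSet _
  · intro i _; exact (rset_finite _).image _
  · rw [Set.disjoint_left]
    rintro γ h ⟨γ', _, rfl⟩
    simp only [Set.mem_iUnion, Set.mem_image] at h
    obtain ⟨i, hi, δ, _, h⟩ := h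
    simp only [List.cons.injEq, un_inj] at h
    simp at hi; omega
  · apply Set.Finite.biUnion (Finset.finite_toSet _)
    intro i hi
    exact (rset_finite _).image _
  · exact (rset_finite _).image _

/-! ## The composition of a word, read from the front -/

def cwo : Option (ℕ × ℤ) → List PEntry → DComp
  | none, [] => []
  | none, .dot a :: w => .dot a :: cwo none w
  | none, .undot z :: w => cwo (some (0, z)) w
  | some (c, _), [] => [un c]
  | some (c, _), .dot a :: w => un c :: .dot a :: cwo none w
  | some (c, l), .undot z :: w => if l < z then cwo (some (c + 1, z)) w else un c :: cwo (some (0, z)) w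

theorem bumpLast_append (D : DComp) (c : ℕ) : bumpLast (D ++ [un c]) = D ++ [un (c + 1)] := by
  induction D with
  | nil => simp [bumpLast]; rfl
  | cons x D ih =>
    cases D with
    | nil =>
      cases x <;> simp [bumpLast] <;> rfl
    | cons y D =>
      simp only [List.cons_append] at ih ⊢
      rw [bumpLast]
      · rw [ih]
      · simp
      · simp

def cstep (st : DComp × Option PEntry) (e : PEntry) : DComp × Option PEntry :=
    match e, st.2 with
    | .dot a, _ => (st.1 ++ [DEntry.dot a], some e)
    | .undot v, some (.undot u) =>
        if u < v then (bumpLast st.1, some e) else (st.1 ++ [DEntry.undot 1], some e)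
    | .undot _, _ => (st.1 ++ [DEntry.undot 1], some e)

theorem cstep_fold (w : List PEntry) :
    (∀ (D : DComp) (o : Option PEntry), (∀ v, o ≠ some (.undot v)) →
      (w.foldl cstep (D, o)).1 = D ++ cwo none w) ∧
    (∀ (D : DComp) (c : ℕ) (l : ℤ),
      (w.foldl cstep (D ++ [un c], some (.undot l))).1 = D ++ cwo (some (c, l)) w) := by
  have u1 : DEntry.undot 1 = un 0 := rfl
  induction w with
  | nil => simp [cwo]
  | cons e w ih =>
    obtain ⟨ih1, ih2⟩ := ih
    constructor
    · intro D o ho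
      cases e with
      | dot a =>
        simp only [List.foldl_cons, cstep]
        rw [ih1 _ _ (by simp)]
        simp [cwo]
      | undot z =>
        have : cstep (D, o) (.undot z) = (D ++ [un 0], some (.undot z)) := by
          rcases o with _ | (v | b)
          · rfl
          · exact absurd rfl (ho v)
          · rfl
        rw [List.foldl_cons, this, ih2]
        simp [cwo]
    · intro D c l
      cases e with
      | dot a =>
        simp only [List.foldl_cons, cstep]
        rw [ih1 _ _ (by simp)]
        simp [cwo]
      | undot z =>
        simp only [List.foldl_cons, cstep]
        by_cases h : l < z
        · rw [if_pos h, bumpLast_append, ih2]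
          simp [cwo, h]
        · rw [if_neg h, u1, ih2]
          simp [cwo, h]

theorem compW_eq (w : List PEntry) : compW w = cwo none w := by
  have := (cstep_fold w).1 [] none (by simp)
  rw [List.nil_append] at this
  rw [← this]
  unfold compW
  congr 2

/-! ## Runs -/

noncomputable def ext (f : ℕ → List PEntry → sQSym) (l : ℤ) : List PEntry → sQSym
  | .undot z :: w => f 0 (.undot z :: w) + if l < z then ext (fun k => f (k + 1)) z w else 0
  | w => f 0 w

theorem ext_nil (f : ℕ → List PEntry → sQSym) (l : ℤ) : ext f l [] = f 0 [] := by
  simp [ext]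

theorem ext_dot (f : ℕ → List PEntry → sQSym) (l : ℤ) (a : ℕ) (w : List PEntry) :
    ext f l (.dot a :: w) = f 0 (.dot a :: w) := by
  simp [ext]

theorem ext_un (f : ℕ → List PEntry → sQSym) (l : ℤ) (z : ℤ) (w : List PEntry) :
    ext f l (.undot z :: w) = f 0 (.undot z :: w) +
      if l < z then ext (fun k => f (k + 1)) z w else 0 := by
  simp [ext]

noncomputable def FW (w : List PEntry) : sQSym := Fund (compW w)

theorem FW_nil : FW [] = Mono [] := by simp [FW, compW_eq, cwo, Fund_nil]

theorem FW_dot (a : ℕ) (w : List PEntry) : FW (.dot a :: w) = pre (.dot a) (FW w) := by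
  simp [FW, compW_eq, cwo, Fund_dot]

theorem Fund_cwo (w : List PEntry) (n : ℕ) (l : ℤ) : Fund (cwo (some (n, l)) w) =
    ∑ i ∈ Finset.range n, pre (un i) (Fund (cwo (some (n - 1 - i, l)) w)) +
      ext (fun k v => pre (un (n + k)) (FW v)) l w := by
  induction w generalizing n l with
  | nil =>
    rw [ext_nil]
    simp only [cwo]
    rw [Fund_un, FW_nil, Fund_nil]; rfl
  | cons e w ih =>
    cases e with
    | dot a =>
      rw [ext_dot]
      simp only [cwo]
      rw [Fund_un, FW_dot, Fund_dot, FW, compW_eq]; rfl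
    | undot z =>
      rw [ext_un]
      have hF : FW (.undot z :: w) = Fund (cwo (some (0, z)) w) := by
        rw [FW, compW_eq, cwo]
      by_cases h : l < z
      · simp only [cwo, h, if_true]
        rw [ih, Finset.sum_range_succ, hF]
        have e1 : n + 1 - 1 - n = 0 := by omega
        rw [e1, add_assoc]
        congr 1
        · apply Finset.sum_congr rfl
          intro i hi
          have : n + 1 - 1 - i = n - 1 - i + 1 := by simp at hi; omega
          rw [this]
        · congr 1
          congr 1
          funext k v
          congr 3; omega
      · simp only [cwo, h, if_false, add_zero]
        rw [Fund_un, hF]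

/-- generating pieces -/
noncomputable def gg (k : ℕ) (v : List PEntry) : sQSym := pre (un k) (FW v)

theorem FW_un (z : ℤ) (w : List PEntry) : FW (.undot z :: w) = ext gg z w := by
  rw [FW, compW_eq, cwo, Fund_cwo]
  simp only [Finset.range_zero, Finset.sum_empty, zero_add]
  rfl

theorem ext_congr (f g : ℕ → List PEntry → sQSym) (l : ℤ) (w : List PEntry)
    (h : ∀ k w', w' <:+ w → f k w' = g k w') : ext f l w = ext g l w := by
  induction w generalizing f g l with
  | nil => rw [ext_nil, ext_nil, h 0 [] (by simp)]
  | cons e w ih =>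
    cases e with
    | dot a => rw [ext_dot, ext_dot, h 0 _ List.suffix_rfl]
    | undot z =>
      rw [ext_un, ext_un, h 0 _ List.suffix_rfl, ih (fun k => f (k + 1)) (fun k => g (k + 1))]
      intro k w' hw
      exact h _ _ (hw.trans (List.suffix_cons _ _))

theorem ext_add (f g : ℕ → List PEntry → sQSym) (l : ℤ) (w : List PEntry) :
    ext (fun k v => f k v + g k v) l w = ext f l w + ext g l w := by
  induction w generalizing f g l with
  | nil => simp [ext_nil]
  | cons e w ih =>
    cases e with
    | dot a => simp [ext_dot]
    | undot z =>
      rw [ext_un, ext_un, ext_un, ih (fun k => f (k + 1)) (fun k => g (k + 1))]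
      split_ifs
      · abel
      · simp

theorem ext_map (L : sQSym →ₗ[ℚ] sQSym) (f : ℕ → List PEntry → sQSym) (l : ℤ) (w : List PEntry) :
    ext (fun k v => L (f k v)) l w = L (ext f l w) := by
  induction w generalizing f l with
  | nil => simp [ext_nil]
  | cons e w ih =>
    cases e with
    | dot a => simp [ext_dot]
    | undot z =>
      rw [ext_un, ext_un, ih (fun k => f (k + 1)), map_add]
      split_ifs <;> simp

theorem ext_swap (H : ℕ → List PEntry → ℕ → List PEntry → sQSym) (a b : ℤ) (u w : List PEntry) :
    ext (fun k u' => ext (fun j w' => H k u' j w') b w) a u =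
      ext (fun j w' => ext (fun k u' => H k u' j w') a u) b w := by
  induction u generalizing a H with
  | nil => simp [ext_nil]
  | cons e u ih =>
    cases e with
    | dot a => simp [ext_dot]
    | undot z =>
      simp only [ext_un _ a]
      split_ifs
      · rw [ih (fun k => H (k + 1)), ← ext_add]
      · simp

theorem ext_le (f : ℕ → List PEntry → sQSym) (l : ℤ) (w : List PEntry)
    (h : ∀ z ∈ undotVals w, ¬ l < z) : ext f l w = f 0 w := by
  cases w with
  | nil => rw [ext_nil]
  | cons e w =>
    cases e with
    | dot a => rw [ext_dot]
    | undot z => rw [ext_un, if_neg (h z (by simp [undotVals])), add_zero]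
/-! ## Fundamental path sums -/

def okF (u w : List PEntry) (s : GStep) : Prop := FStepOK u w (0, 0) s

def labF (u w : List PEntry) (s : GStep) : PEntry := PiStep u w (0, 0) s

theorem okF_bnd : Bnd okF := by
  intro u w s h
  cases s <;> simp only [okF, FStepOK] at h <;> simp only [sd] <;> omega

theorem okF_drop (u w : List PEntry) (p : ℕ × ℕ) (s : GStep)  :
    okF (u.drop p.1) (w.drop p.2) s ↔ FStepOK u w p s := by
  have aux : ∀ a b k : ℕ, 1 ≤ k → (k ≤ a - b ↔ b + k ≤ a) := by omega
  cases s with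
  | H => simp only [okF, FStepOK, List.length_drop, Nat.sub_pos_iff_lt]
  | V => simp only [okF, FStepOK, List.length_drop, Nat.sub_pos_iff_lt]
  | D3 k =>
    simp only [okF, FStepOK, getD_drop_zero, List.length_drop, Nat.sub_pos_iff_lt, zero_add,
      List.drop_zero]
    apply and_congr_right
    intro h
    rw [aux _ _ _ h]
  | D4 k =>
    simp only [okF, FStepOK, getD_drop_zero, List.length_drop, Nat.sub_pos_iff_lt, zero_add,
      List.drop_zero]
    apply and_congr_right
    intro h
    rw [aux _ _ _ h]

theorem labF_drop (u w : List PEntry) (p : ℕ × ℕ) (s : GStep)  :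
    labF (u.drop p.1) (w.drop p.2) s = PiStep u w p s := by
  cases s <;> simp only [labF, PiStep, getD_drop_zero]

theorem PiP_aux (u w : List PEntry) (P : List GStep) (p : ℕ × ℕ) (acc : List PEntry) :
    (P.foldl (fun (st : (ℕ × ℕ) × List PEntry) s =>
    (stepTarget s st.1, st.2 ++ [PiStep u w st.1 s])) (p, acc)).2 =
      acc ++ gout labF (u.drop p.1) (w.drop p.2) P := by
  induction P generalizing p acc with
  | nil => simp [gout]
  | cons s P ih =>
    rw [List.foldl_cons]
    simp only []
    rw [ih]
    simp only [gout, List.append_assoc, List.drop_drop, stepTarget_eq, labF_drop,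
      List.cons_append, List.nil_append]

noncomputable abbrev SF (φ : List PEntry → sQSym) (u w : List PEntry) : sQSym :=
  gsum PEntry.isDot default okF labF φ u w

theorem rhs_eq (u w : List PEntry) :
    (∑ᶠ P ∈ {P : List GStep | PathOKWith (FStepOK u w) (u.length, w.length) P},
        fsign u w P • Fund (compW (PiP u w P))) = SF FW u w := by
  unfold SF gsum
  apply finsum_mem_congr
  · simp only [gpaths, okF_drop]
  · intro P _
    have : PiP u w P = gout labF u w P :=
      (PiP_aux u w P (0, 0) []).trans (by simp)
    rw [this]
    rfl

theorem SF_nil_left (φ : List PEntry → sQSym) (w : List PEntry) : SF φ [] w = φ w := by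
  induction w generalizing φ with
  | nil => exact gsum_nil_nil _ _ _ okF_bnd _
  | cons y w ih =>
    rw [SF, gsum_rec _ _ _ okF_bnd _ _ _ (by simp)]
    simp only [SF] at ih
    have h4 : ∀ k, ¬ okF [] (y :: w) (.D4 k) := by
      intro k; simp only [okF, FStepOK, List.length_nil]; omega
    have h3 : ∀ k, ¬ okF [] (y :: w) (.D3 k) := by
      intro k; simp only [okF, FStepOK, List.length_nil]; omega
    have h1 : ¬ okF [] (y :: w) .H := by simp [okF, FStepOK]
    have h2 : okF [] (y :: w) .V := by simp [okF, FStepOK]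
    simp [h1, h2, h3, h4, gterm, gsg, sd, dc, labF, PiStep, ih]

theorem SF_nil_right (φ : List PEntry → sQSym) (u : List PEntry) : SF φ u [] = φ u := by
  induction u generalizing φ with
  | nil => exact gsum_nil_nil _ _ _ okF_bnd _
  | cons y w ih =>
    rw [SF, gsum_rec _ _ _ okF_bnd _ _ _ (by simp)]
    simp only [SF] at ih
    have h4 : ∀ k, ¬ okF (y :: w) [] (.D4 k) := by
      intro k; simp only [okF, FStepOK, List.length_nil]; omega
    have h3 : ∀ k, ¬ okF (y :: w) [] (.D3 k) := by
      intro k; simp only [okF, FStepOK, List.length_nil]; omega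
    have h1 : okF (y :: w) [] .H := by simp [okF, FStepOK]
    have h2 : ¬ okF (y :: w) [] .V := by simp [okF, FStepOK]
    simp [h1, h2, h3, h4, gterm, gsg, sd, dc, labF, PiStep, ih]

theorem run_one (b : ℤ) : IncrUndotRun [.undot b] := by
  refine ⟨by simp [PEntry.isDot], ?_⟩
  exact List.isChain_singleton _

theorem run_dot (b : ℤ) (a : ℕ) (w : List PEntry) : ¬ IncrUndotRun (.undot b :: .dot a :: w) := by
  rintro ⟨h, _⟩
  have := h (.dot a) (by simp)
  simp [PEntry.isDot] at this

theorem run_dot' (a : ℕ) (w : List PEntry) : ¬ IncrUndotRun (.dot a :: w) := by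
  rintro ⟨h, _⟩
  have := h (.dot a) (by simp)
  simp [PEntry.isDot] at this

theorem run_un (b z : ℤ) (w : List PEntry) : IncrUndotRun (.undot b :: .undot z :: w) ↔
    (b < z ∧ IncrUndotRun (.undot z :: w)) := by
  constructor
  · rintro ⟨h, h'⟩
    have h2 := List.isChain_cons_cons.1 h'
    obtain ⟨⟨u, v, h3, h4, h5⟩, h6⟩ := h2
    simp only [PEntry.undot.injEq] at h3 h4
    subst h3 h4
    exact ⟨h5, fun e he => h e (List.mem_cons_of_mem _ he), h6⟩
  · rintro ⟨h, h1, h2⟩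
    refine ⟨?_, List.isChain_cons_cons.2 ⟨⟨b, z, rfl, rfl, h⟩, h2⟩⟩
    intro e he
    rcases List.mem_cons.1 he with rfl | he
    · rfl
    · exact h1 e he

open Classical in
theorem run_sum' (f : ℕ → List PEntry → sQSym) (b : ℤ) (w : List PEntry) :
    (∑ k ∈ Finset.range (w.length + 1), if IncrUndotRun (.undot b :: w.take k)
      then f k (w.drop k) else 0) = ext f b w := by
  induction w generalizing f b with
  | nil => simp [run_one, ext_nil]
  | cons e w ih =>
    rw [List.length_cons, Finset.sum_range_succ']
    simp only [List.take_succ_cons, List.drop_succ_cons, List.take_zero, List.drop_zero, run_one,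
      if_true]
    cases e with
    | dot a => simp [run_dot, ext_dot]
    | undot z =>
      simp only [run_un, ext_un]
      rw [← ih (fun k => f (k + 1)), add_comm]
      by_cases h : b < z <;> simp [h]

open Classical in
theorem run_sum (f : ℕ → List PEntry → sQSym) (b : ℤ) (w : List PEntry) :
    (∑ k ∈ Finset.range (w.length + 1 + 1),
      if (1 ≤ k ∧ k ≤ w.length + 1 ∧ IncrUndotRun ((.undot b :: w).take k))
      then f k ((PEntry.undot b :: w).drop k) else 0) = ext (fun k => f (k + 1)) b w := by
  rw [Finset.sum_range_succ', ← run_sum']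
  simp only [List.take_succ_cons, List.drop_succ_cons]
  simp only [nonpos_iff_eq_zero, one_ne_zero, false_and, if_false, add_zero]
  apply Finset.sum_congr rfl
  intro k hk
  simp at hk
  have h1 : 1 ≤ k + 1 := by omega
  have h2 : k + 1 ≤ w.length + 1 := by omega
  simp only [h1, h2, true_and]

noncomputable def sgF (u : List PEntry) : ℚ := (-1) ^ dc PEntry.isDot u

theorem okF_H (x : PEntry) (u w : List PEntry) : okF (x :: u) w .H := by
  simp [okF, FStepOK]

theorem okF_V (y : PEntry) (u w : List PEntry) : okF u (y :: w) .V := by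
  simp [okF, FStepOK]

theorem okF_D3 (x y : PEntry) (u w : List PEntry) (k : ℕ) : okF (x :: u) (y :: w) (.D3 k) ↔
    (x.isDot = true ∧ (1 ≤ k ∧ k ≤ w.length + 1 ∧ IncrUndotRun ((y :: w).take k))) := by
  simp [okF, FStepOK]; tauto

theorem okF_D4 (x y : PEntry) (u w : List PEntry) (k : ℕ) : okF (x :: u) (y :: w) (.D4 k) ↔
    (y.isDot = true ∧ (1 ≤ k ∧ k ≤ u.length + 1 ∧ IncrUndotRun ((x :: u).take k))) := by
  simp [okF, FStepOK]; tauto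

theorem nrun (a k : ℕ) (n : ℕ) (u : List PEntry) :
    ¬ (1 ≤ k ∧ k ≤ n ∧ IncrUndotRun ((PEntry.dot a :: u).take k)) := by
  rintro ⟨h, _, h2⟩
  obtain ⟨m, rfl⟩ := Nat.exists_eq_add_of_le' h
  rw [List.take_succ_cons] at h2
  exact run_dot' _ _ h2

theorem dcc_dot (a : ℕ) (u : List PEntry) : dc PEntry.isDot (.dot a :: u) = dc PEntry.isDot u + 1 := by
  rw [dc, List.countP_cons_of_pos (by rfl)]; rfl

theorem dcc_un (a : ℤ) (u : List PEntry) : dc PEntry.isDot (.undot a :: u) = dc PEntry.isDot u := by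
  rw [dc, List.countP_cons_of_neg (by simp [PEntry.isDot])]; rfl

theorem dcc_nil : dc PEntry.isDot [] = 0 := rfl

theorem SF_uu (φ : List PEntry → sQSym) (a b : ℤ) (u w : List PEntry) :
    SF φ (.undot a :: u) (.undot b :: w) =
      SF (fun v => φ (.undot a :: v)) u (.undot b :: w) +
      SF (fun v => φ (.undot b :: v)) (.undot a :: u) w := by
  rw [SF, gsum_rec _ _ _ okF_bnd _ _ _ (by simp)]
  simp only [okF_H, okF_V, okF_D3, okF_D4, PEntry.isDot, if_true, Bool.false_eq_true, false_and,
    if_false, Finset.sum_const_zero, add_zero]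
  simp [gterm, gsg, sd, dcc_nil, dcc_un, labF, PiStep]

theorem SF_dd (φ : List PEntry → sQSym) (a b : ℕ) (u w : List PEntry) :
    SF φ (.dot a :: u) (.dot b :: w) =
      SF (fun v => φ (.dot a :: v)) u (.dot b :: w) +
      sgF (.dot a :: u) • SF (fun v => φ (.dot b :: v)) (.dot a :: u) w := by
  rw [SF, gsum_rec _ _ _ okF_bnd _ _ _ (by simp)]
  simp only [okF_H, okF_V, okF_D3, okF_D4, nrun, if_true, and_false,
    if_false, Finset.sum_const_zero, add_zero]
  simp [gterm, gsg, sd, dcc_nil, dcc_dot, labF, PiStep, sgF]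

theorem SF_du (φ : List PEntry → sQSym) (a : ℕ) (b : ℤ) (u w : List PEntry) :
    SF φ (.dot a :: u) (.undot b :: w) =
      SF (fun v => φ (.dot a :: v)) u (.undot b :: w) +
      SF (fun v => φ (.undot b :: v)) (.dot a :: u) w +
      ext (fun k w' => SF (fun v => φ (.dot (a + (k + 1)) :: v)) u w') b w := by
  classical
  rw [SF, gsum_rec _ _ _ okF_bnd _ _ _ (by simp)]
  have i1 : PEntry.isDot (.dot a) = true := rfl
  have i2 : PEntry.isDot (.undot b) = false := rfl
  simp only [okF_H, okF_V, okF_D3, okF_D4, i1, i2, if_true, Bool.false_eq_true, false_and, true_and,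
    if_false, Finset.sum_const_zero, add_zero]
  rw [← run_sum (fun k w' => SF (fun v => φ (.dot (a + k) :: v)) u w')]
  congr 1
  · simp [gterm, gsg, sd, dcc_nil, dcc_un, labF, PiStep]
  · apply Finset.sum_congr rfl
    intro k _
    by_cases h : (1 ≤ k ∧ k ≤ w.length + 1 ∧ IncrUndotRun ((.undot b :: w).take k))
    · rw [if_pos h, if_pos h]
      have : dc PEntry.isDot ((.undot b :: w).take k) = 0 := by
        rw [dc, List.countP_eq_zero]
        intro e he
        rw [h.2.2.1 e he]; simp
      simp [gterm, gsg, sd, this, labF, PiStep]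
    · rw [if_neg h, if_neg h]

theorem SF_ud (φ : List PEntry → sQSym) (a : ℤ) (b : ℕ) (u w : List PEntry) :
    SF φ (.undot a :: u) (.dot b :: w) =
      SF (fun v => φ (.undot a :: v)) u (.dot b :: w) +
      sgF (.undot a :: u) • SF (fun v => φ (.dot b :: v)) (.undot a :: u) w +
      ext (fun k u' => sgF u' • SF (fun v => φ (.dot (b + (k + 1)) :: v)) u' w) a u := by
  classical
  rw [SF, gsum_rec _ _ _ okF_bnd _ _ _ (by simp)]
  have i1 : PEntry.isDot (.dot b) = true := rfl
  have i2 : PEntry.isDot (.undot a) = false := rfl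
  simp only [okF_H, okF_V, okF_D3, okF_D4, i1, i2, if_true, Bool.false_eq_true, false_and, true_and,
    if_false, Finset.sum_const_zero, add_zero]
  rw [← run_sum (fun k u' => sgF u' • SF (fun v => φ (.dot (b + k) :: v)) u' w)]
  congr 1
  · simp [gterm, gsg, sd, dcc_nil, dcc_un, dcc_dot, labF, PiStep, sgF]
  · apply Finset.sum_congr rfl
    intro k _
    by_cases h : (1 ≤ k ∧ k ≤ u.length + 1 ∧ IncrUndotRun ((.undot a :: u).take k))
    · rw [if_pos h, if_pos h]
      simp [gterm, gsg, sd, labF, PiStep, dcc_nil, dcc_dot, sgF]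
    · rw [if_neg h, if_neg h]

noncomputable def tl (g : ℕ → List PEntry → sQSym) (l : ℤ) : List PEntry → sQSym
  | .undot z :: w => if l < z then ext (fun k => g (k + 1)) z w else 0
  | _ => 0

theorem ext_tl (g : ℕ → List PEntry → sQSym) (l : ℤ) (v : List PEntry) :
    ext g l v = g 0 v + tl g l v := by
  rcases v with _ | ⟨_ | _, v⟩ <;> simp [ext, tl]

theorem tl_dot (g : ℕ → List PEntry → sQSym) (l : ℤ) (a : ℕ) (v : List PEntry) :
    tl g l (.dot a :: v) = 0 := rfl

theorem tl_un (g : ℕ → List PEntry → sQSym) (l z : ℤ) (v : List PEntry) :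
    tl g l (.undot z :: v) = if l < z then ext (fun k => g (k + 1)) z v else 0 := rfl

theorem SF_ext (g : ℕ → List PEntry → sQSym) (l : ℤ) (u w : List PEntry) :
    SF (fun v => ext g l v) u w = SF (g 0) u w + SF (tl g l) u w := by
  simp only [ext_tl]
  exact gsum_add _ _ _ okF_bnd _ _ _ _

theorem SF_zero (u w : List PEntry) : SF (fun _ => 0) u w = 0 := gsum_zero _ _ _ _ _

theorem ext_zero (l : ℤ) (w : List PEntry) : ext (fun _ _ => 0) l w = 0 := by
  induction w generalizing l with
  | nil => simp [ext_nil]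
  | cons e w ih => cases e <;> simp [ext_dot, ext_un, ih]

theorem uv_un (z : ℤ) (w : List PEntry) : undotVals (.undot z :: w) = z :: undotVals w := rfl
theorem uv_dot (z : ℕ) (w : List PEntry) : undotVals (.dot z :: w) = undotVals w := rfl

theorem SF_T (g : ℕ → List PEntry → sQSym) (l : ℤ) (u w : List PEntry)
    (h : ∀ a ∈ undotVals u, a < l) :
    SF (fun v => ext g l v) u w = ext (fun k w' => SF (g k) u w') l w := by
  induction w generalizing g l with
  | nil =>
    rw [SF_nil_right, ext_nil, SF_nil_right, ext_le]
    intro z hz; have := h z hz; omega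
  | cons y w ih =>
    cases u with
    | nil => simp only [SF_nil_left]
    | cons x u =>
      rw [SF_ext]
      cases y with
      | dot b =>
        rw [ext_dot]
        cases x with
        | dot a => rw [SF_dd (tl g l)]; simp only [tl_dot, SF_zero, smul_zero, add_zero]
        | undot a =>
          have := h a (by simp [uv_un])
          rw [SF_ud (tl g l)]; simp only [tl_dot, tl_un, not_lt.2 this.le, if_false, SF_zero, smul_zero, ext_zero, add_zero]
      | undot b =>
        rw [ext_un]
        congr 1
        have key : SF (fun v => tl g l (.undot b :: v)) (x :: u) w =
            if l < b then ext (fun k w' => SF (g (k + 1)) (x :: u) w') b w else 0 := by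
          simp only [tl_un]
          by_cases hl : l < b
          · simp only [hl, if_true]
            apply ih (fun k => g (k + 1))
            intro a ha; exact (h a ha).trans hl
          · simp only [hl, if_false, SF_zero]
        rw [← key]
        cases x with
        | dot a => rw [SF_du]; simp only [tl_dot, SF_zero, ext_zero]; simp
        | undot a =>
          have := h a (by simp [uv_un])
          rw [SF_uu, add_eq_right]
          simp only [tl_un g l a, not_lt.2 this.le, if_false, SF_zero]

noncomputable def brun (f : ℕ → List PEntry → sQSym) : List PEntry → sQSym
  | .undot z :: w => ext f z w
  | _ => 0

theorem SF_S (g : ℕ → List PEntry → sQSym) (l : ℤ) (u w : List PEntry)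
    (h : ∀ b ∈ undotVals w, l < b)
    (hlt : ∀ a ∈ undotVals u, ∀ b ∈ undotVals w, a < b) :
    SF (fun v => ext g l v) u w = ext (fun k u' => SF (g k) u' w +
      brun (fun j w' => SF (g (k + (j + 1))) u' w') w) l u := by
  induction u generalizing g l with
  | nil =>
    rw [ext_nil, SF_nil_left, SF_nil_left, ext_tl]
    congr 1
    rcases w with _ | ⟨b | b, w⟩
    · simp [tl, brun]
    · have := h b (by simp [uv_un])
      simp only [tl, this, if_true, brun, SF_nil_left, zero_add]
    · simp [tl, brun]
  | cons x u ih =>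
    cases w with
    | nil =>
      simp only [SF_nil_right, brun, add_zero]
    | cons y w =>
      rw [SF_ext]
      cases x with
      | dot a =>
        rw [ext_dot]
        congr 1
        cases y with
        | dot b => rw [SF_dd]; simp only [tl_dot, SF_zero]; simp [brun]
        | undot b =>
          have hl := h b (by simp [uv_un])
          rw [SF_du]
          simp only [tl_dot, SF_zero, ext_zero, tl_un, hl, if_true, zero_add, add_zero, brun]
          apply SF_T
          intro a' ha'
          exact hlt a' ha' b (by simp [uv_un])
      | undot a =>
        have key : SF (fun v => tl g l (.undot a :: v)) u (y :: w) =
            if l < a then ext (fun k u' => SF (g (k + 1)) u' (y :: w) +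
              brun (fun j w' => SF (g (k + 1 + (j + 1))) u' w') (y :: w)) a u else 0 := by
          simp only [tl_un]
          by_cases hl : l < a
          · simp only [hl, if_true]
            rw [ih (fun k => g (k + 1))]
            · congr 1
              funext k u'
              congr 2
              funext j w'
              congr 2
              omega
            · intro b hb; exact hlt a (by simp [uv_un]) b hb
            · intro a' ha'; exact hlt a' (by simp [uv_un, ha'])
          · simp only [hl, if_false, SF_zero]
        rw [ext_un, ← key, add_assoc]
        congr 1
        cases y with
        | dot b =>
          rw [SF_ud]; simp only [tl_dot, SF_zero]; simp [brun, ext_zero]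
        | undot b =>
          have hl := h b (by simp [uv_un])
          rw [SF_uu, add_comm]
          congr 1
          simp only [tl_un, hl, if_true, brun, zero_add]
          apply SF_T
          intro a' ha'
          exact hlt a' ha' b (by simp [uv_un])

theorem sgm_FW_aux (n : ℕ) : ∀ u : List PEntry, u.length ≤ n → sgm (FW u) = sgF u • FW u := by
  induction n with
  | zero =>
    intro u hu
    have : u = [] := List.length_eq_zero_iff.1 (by omega)
    subst this
    rw [FW_nil, sgm_Mono, sgF]; rfl
  | succ n ih =>
    intro u hu
    rcases u with _ | ⟨a | a, u⟩
    · rw [FW_nil, sgm_Mono, sgF]; rfl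
    · rw [FW_un, ← ext_map]
      have hu' : u.length ≤ n := by simpa using hu
      have e1 : ∀ (f : ℕ → List PEntry → sQSym) (c : ℕ) (l : ℤ) (u : List PEntry), u.length ≤ n →
          (∀ k v, f k v = gg (k + c) v) →
          ext (fun k v => sgm (f k v)) l u = sgF u • ext f l u := by
        intro f c l u
        induction u generalizing f c l with
        | nil =>
          intro hu hf
          rw [ext_nil, ext_nil, hf, gg, sgm_pre_undot, ih _ hu, map_smul]
        | cons e u ihu =>
          intro hu hf
          cases e with
          | dot b => rw [ext_dot, ext_dot, hf, gg, sgm_pre_undot, ih _ hu, map_smul]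
          | undot b =>
            rw [ext_un, ext_un, hf, gg, sgm_pre_undot, ih _ hu, map_smul]
            rw [ihu (fun k => f (k + 1)) (c + 1) b (by simp at hu; omega)
              (by intro k v; simp only [hf]; congr 1; omega)]
            simp only [sgF, dcc_un]
            split_ifs <;> simp
      rw [e1 gg 0 a u hu' (by simp)]
      simp only [sgF, dcc_un]
    · rw [FW_dot, sgm_pre_dot, ih u (by simpa using hu), map_smul]
      simp only [sgF, dcc_dot, pow_succ]
      simp

theorem sgm_FW (u : List PEntry) : sgm (FW u) = sgF u • FW u := sgm_FW_aux _ u le_rfl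

theorem SF_pre (e : DEntry) (u w : List PEntry) :
    SF (fun v => pre e (FW v)) u w = pre e (SF FW u w) := gsum_map _ _ _ okF_bnd _ _ _ _

theorem SF_gg (k : ℕ) (u w : List PEntry) :
    SF (gg k) u w = pre (un k) (SF FW u w) := SF_pre _ _ _

theorem un_add (k j : ℕ) : DEntry.undot (k.succPNat + j.succPNat) = un (k + (j + 1)) := by
  congr 1
  apply PNat.eq
  simp; omega

theorem uv_suffix {u v : List PEntry} (h : u <:+ v) {a : ℤ} (ha : a ∈ undotVals u) :
    a ∈ undotVals v := by
  obtain ⟨t, rfl⟩ := h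
  simp only [undotVals, List.filterMap_append, List.mem_append] at ha ⊢
  exact Or.inr ha

theorem main_aux (n : ℕ) : ∀ u w : List PEntry, u.length + w.length ≤ n →
    (∀ a ∈ undotVals u, ∀ b ∈ undotVals w, a < b) →
    qm (FW u) (FW w) = SF FW u w := by
  induction n with
  | zero =>
    intro u w h _
    have : u = [] := List.length_eq_zero_iff.1 (by omega)
    subst this
    rw [SF_nil_left, FW_nil, qm_nil_left]
  | succ n ih =>
    intro u w hn hlt
    rcases u with _ | ⟨a | a, u⟩
    · rw [SF_nil_left, FW_nil, qm_nil_left]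
    · rcases w with _ | ⟨b | b, w⟩
      · rw [SF_nil_right, FW_nil, qm_nil_right]
      · -- undotted, undotted
        simp only [List.length_cons] at hn
        rw [SF_uu]
        simp only [FW_un]
        rw [SF_S gg a u (.undot b :: w) (fun z hz => hlt a (by simp [uv_un]) z hz)
          (fun z hz => hlt z (by simp [uv_un, hz])),
          SF_T gg b (.undot a :: u) w (fun z hz => hlt z hz b (by simp [uv_un]))]
        simp only [SF_gg, SF_pre, brun]
        have r1 : ext (fun k u' => pre (un k) (SF FW u' (.undot b :: w)) +
            ext (fun j w' => pre (un (k + (j + 1))) (SF FW u' w')) b w) a u =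
            ext (fun k u' => pre (un k) (qm (FW u') (FW (.undot b :: w))) +
            ext (fun j w' => pre (un (k + (j + 1))) (qm (FW u') (FW w'))) b w) a u := by
          apply ext_congr
          intro k u' hu'
          have hl := hu'.length_le
          congr 1
          · rw [ih]
            · simp; omega
            · intro z hz; exact hlt z (by rw [uv_un]; exact List.mem_cons_of_mem _ (uv_suffix hu' hz))
          · apply ext_congr
            intro j w' hw'
            have hl' := hw'.length_le
            rw [ih]
            · omega
            · intro z hz z' hz'
              exact hlt z (by rw [uv_un]; exact List.mem_cons_of_mem _ (uv_suffix hu' hz)) z'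
                (by rw [uv_un]; exact List.mem_cons_of_mem _ (uv_suffix hw' hz'))
        have r2 : ext (fun k w' => pre (un k) (SF FW (.undot a :: u) w')) b w =
            ext (fun k w' => pre (un k) (qm (FW (.undot a :: u)) (FW w'))) b w := by
          apply ext_congr
          intro k w' hw'
          have hl := hw'.length_le
          rw [ih]
          · simp; omega
          · intro z hz z' hz'
            exact hlt z hz z' (by rw [uv_un]; exact List.mem_cons_of_mem _ (uv_suffix hw' hz'))
        rw [r1, r2]
        have l1 : ∀ Y, qm (ext gg a u) Y = ext (fun k u' => qm (gg k u') Y) a u := fun Y =>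
          (ext_map (qm.flip Y) gg a u).symm
        have l2 : ∀ X, qm X (ext gg b w) = ext (fun k u' => qm X (gg k u')) b w := fun X =>
          (ext_map (qm X) gg b w).symm
        have l3 : ∀ (k : ℕ) (u' : List PEntry), qm (gg k u') (ext gg b w) =
            (pre (un k) (qm (FW u') (ext gg b w)) +
            ext (fun j w' => pre (un (k + (j + 1))) (qm (FW u') (FW w'))) b w) +
            ext (fun j w' => pre (un j) (qm (gg k u') (FW w'))) b w := by
          intro k u'
          rw [l2, l2, ← ext_map, ← ext_add, ← ext_add]
          congr 1
          funext j w'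
          simp only [gg, un, qm_uu, un_add]
          abel
        change qm (ext gg a u) (ext gg b w) = _
        rw [l1]
        simp only [l3]
        rw [ext_add, ext_swap (fun k u' j w' => pre (un j) (qm (gg k u') (FW w')))]
        congr 1
        · simp only [FW_un]
        · congr 1
          funext j w'
          rw [FW_un, l1, ← ext_map]
      · -- undotted, dotted
        simp only [List.length_cons] at hn
        rw [SF_ud]
        simp only [FW_un, FW_dot]
        rw [SF_S gg a u (.dot b :: w) (fun z hz => hlt a (by simp [uv_un]) z hz)
          (fun z hz => hlt z (by simp [uv_un, hz]))]
        simp only [SF_gg, SF_pre, brun, add_zero]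
        have r1 : ext (fun k u' => pre (un k) (SF FW u' (.dot b :: w))) a u =
            ext (fun k u' => pre (un k) (qm (FW u') (FW (.dot b :: w)))) a u := by
          apply ext_congr
          intro k u' hu'
          have hl := hu'.length_le
          rw [ih]
          · simp; omega
          · intro z hz; exact hlt z (by rw [uv_un]; exact List.mem_cons_of_mem _ (uv_suffix hu' hz))
        have r2 : ext (fun k u' => sgF u' • pre (.dot (b + (k + 1))) (SF FW u' w)) a u =
            ext (fun k u' => pre (.dot (b + (k + 1))) (qm (sgm (FW u')) (FW w))) a u := by
          apply ext_congr
          intro k u' hu'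
          have hl := hu'.length_le
          rw [sgm_FW, map_smul, LinearMap.smul_apply, map_smul, ih]
          · omega
          · intro z hz; exact hlt z (by rw [uv_un]; exact List.mem_cons_of_mem _ (uv_suffix hu' hz))
        rw [r1, r2, ← ih (.undot a :: u) w (by simp; omega) hlt]
        have l1 : ∀ Y, qm (ext gg a u) Y = ext (fun k u' => qm (gg k u') Y) a u := fun Y =>
          (ext_map (qm.flip Y) gg a u).symm
        change qm (ext gg a u) _ = _
        rw [← map_smul, ← LinearMap.smul_apply, ← map_smul, ← sgm_FW, FW_un, l1, ← ext_map sgm,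
          ]
        have l4 : pre (.dot b) (qm (ext (fun k v => sgm (gg k v)) a u) (FW w)) =
            ext (fun k v => pre (.dot b) (qm (sgm (gg k v)) (FW w))) a u :=
          (ext_map (pre (.dot b) ∘ₗ qm.flip (FW w)) (fun k v => sgm (gg k v)) a u).symm
        rw [l4, ← ext_add, ← ext_add]
        congr 1
        funext k v
        simp only [gg, un, qm_ud, FW_dot]
        congr 4
        simp; omega
    · rcases w with _ | ⟨b | b, w⟩
      · rw [SF_nil_right, FW_nil, qm_nil_right]
      · -- dotted, undotted
        simp only [List.length_cons] at hn
        rw [SF_du]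
        simp only [FW_un, FW_dot]
        rw [SF_T gg b (.dot a :: u) w (fun z hz => hlt z hz b (by simp [uv_un]))]
        simp only [SF_gg, SF_pre]
        have r2 : ext (fun k w' => pre (un k) (SF FW (.dot a :: u) w')) b w =
            ext (fun k w' => pre (un k) (qm (FW (.dot a :: u)) (FW w'))) b w := by
          apply ext_congr
          intro k w' hw'
          have hl := hw'.length_le
          rw [ih]
          · simp; omega
          · intro z hz z' hz'
            exact hlt z hz z' (by rw [uv_un]; exact List.mem_cons_of_mem _ (uv_suffix hw' hz'))
        have r3 : ext (fun k w' => pre (.dot (a + (k + 1))) (SF FW u w')) b w =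
            ext (fun k w' => pre (.dot (a + (k + 1))) (qm (FW u) (FW w'))) b w := by
          apply ext_congr
          intro k w' hw'
          have hl := hw'.length_le
          rw [ih]
          · omega
          · intro z hz z' hz'
            exact hlt z hz z' (by rw [uv_un]; exact List.mem_cons_of_mem _ (uv_suffix hw' hz'))
        rw [r2, r3, ← ih u (.undot b :: w) (by simp; omega) hlt]
        have l2 : ∀ X, qm X (ext gg b w) = ext (fun k u' => qm X (gg k u')) b w := fun X =>
          (ext_map (qm X) gg b w).symm
        change qm _ (ext gg b w) = _
        rw [FW_un, l2, l2, ← ext_map, ← ext_add, ← ext_add]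
        congr 1
        funext k v
        simp only [gg, un, qm_du, FW_dot]
        rfl
      · -- dotted, dotted
        simp only [List.length_cons] at hn
        rw [SF_dd]
        simp only [FW_dot]
        rw [SF_pre, SF_pre, ← ih u (.dot b :: w) (by simp; omega) hlt,
          ← ih (.dot a :: u) w (by simp; omega) hlt, qm_dd, ← map_smul, ← LinearMap.smul_apply,
          ← map_smul, ← sgm_FW]
        simp only [FW_dot]
/-- Let `wα`, `wβ` be dotted permutations representing `α` on `S`
and `β` on `T`, with every element of `S` less than every element of `T`.  Then
`L_α · L_β = ∑_P sign(P) L_{Γ(P)}`, the sum being over all fundamental paths `P` in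
the `(α,β)`-grid, where `Γ(P) = comp(Π(P))`. -/
theorem fund_mul_fund (α β : DComp) (wα wβ : List PEntry)
    (hwα : IsDPerm wα) (hwβ : IsDPerm wβ)
    (hrα : compW wα = α) (hrβ : compW wβ = β)
    (hlt : ∀ u ∈ undotVals wα, ∀ v ∈ undotVals wβ, u < v) :
    qmul (Fund α) (Fund β) =
      ∑ᶠ P ∈ {P : List GStep | PathOKWith (FStepOK wα wβ) (wα.length, wβ.length) P},
        fsign wα wβ P • Fund (compW (PiP wα wβ P)) := by
  subst hrα hrβ
  rw [qmul_eq, rhs_eq]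
  exact main_aux _ wα wβ le_rfl hlt
end

section
/- For all dotted compositions α and β, L_α • L_β = L_{α·β} in sQSym. -/
namespace SQ
open DComp

def ew : DEntry → ℕ
  | .undot a => a
  | .dot a => a + 1

def wt (α : DComp) : ℕ := (α.map ew).sum

lemma ew_pos (e : DEntry) : 1 ≤ ew e := by
  cases e with
  | undot a => exact a.2
  | dot a => simp [ew]

lemma wt_cons (e : DEntry) (α : DComp) : wt (e :: α) = ew e + wt α := by simp [wt]
lemma wt_append (α β : DComp) : wt (α ++ β) = wt α + wt β := by simp [wt]

lemma wt_zero {α : DComp} (h : wt α = 0) : α = [] := by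
  cases α with
  | nil => rfl
  | cons e t =>
    have := ew_pos e
    rw [wt_cons] at h
    omega

lemma cover_wt {β α : DComp} (h : StrongCover β α) : wt β = wt α := by
  obtain ⟨l, r, a, b, rfl, rfl⟩ := h
  simp [wt_append, wt_cons, ew, add_assoc]

lemma le_wt {β α : DComp} (h : StrongLe β α) : wt β = wt α := by
  unfold StrongLe at h
  induction h with
  | refl => rfl
  | tail _ h2 ih => exact ih.trans (cover_wt h2)

lemma finite_entries (n : ℕ) : {e : DEntry | ew e ≤ n}.Finite := by
  refine Set.Finite.subset (((Set.finite_Iic n).image DEntry.dot).union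
    ((Set.finite_Iic n.succPNat).image DEntry.undot)) ?_
  rintro (a | a) h
  · right
    refine ⟨a, ?_, rfl⟩
    have h : (a : ℕ) ≤ n := h
    rw [Set.mem_Iic, ← PNat.coe_le_coe, Nat.succPNat_coe]
    omega
  · left
    have h : a + 1 ≤ n := h
    exact ⟨a, by simp; omega, rfl⟩

lemma finite_wt (n : ℕ) : {γ : DComp | wt γ ≤ n}.Finite := by
  induction n with
  | zero =>
    refine Set.Finite.subset (Set.finite_singleton []) ?_
    intro γ h
    exact wt_zero (Nat.le_zero.1 h)
  | succ n ih =>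
    refine Set.Finite.subset ((Set.finite_singleton []).union
      (Set.Finite.image2 List.cons (finite_entries (n+1)) ih)) ?_
    intro γ h
    cases γ with
    | nil => left; rfl
    | cons e t =>
      right
      have := ew_pos e
      have h : wt (e :: t) ≤ n + 1 := h
      rw [wt_cons] at h
      exact ⟨e, by simp; omega, t, by simp; omega, rfl⟩

lemma finite_le (α : DComp) : {β | StrongLe β α}.Finite :=
  (finite_wt (wt α)).subset fun _ h => (le_wt h).le

lemma cover_left {β α : DComp} (γ : DComp) (h : StrongCover β α) :
    StrongCover (β ++ γ) (α ++ γ) := by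
  obtain ⟨l, r, a, b, rfl, rfl⟩ := h
  exact ⟨l, r ++ γ, a, b, by simp, by simp⟩

lemma cover_right {β α : DComp} (γ : DComp) (h : StrongCover β α) :
    StrongCover (γ ++ β) (γ ++ α) := by
  obtain ⟨l, r, a, b, rfl, rfl⟩ := h
  exact ⟨γ ++ l, r, a, b, by simp, by simp⟩

lemma le_append {β α β' α' : DComp} (h : StrongLe β α) (h' : StrongLe β' α') :
    StrongLe (β ++ β') (α ++ α') := by
  have h1 : StrongLe (β ++ β') (α ++ β') :=
    Relation.ReflTransGen.lift (· ++ β') (fun _ _ h => cover_left β' h) _ _ h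
  have h2 : StrongLe (α ++ β') (α ++ α') :=
    Relation.ReflTransGen.lift (α ++ ·) (fun _ _ h => cover_right α h) _ _ h'
  exact Relation.ReflTransGen.trans h1 h2

lemma cover_split {γ α β : DComp} (h : StrongCover γ (α ++ β)) :
    ∃ x y, γ = x ++ y ∧ StrongLe x α ∧ StrongLe y β := by
  obtain ⟨l, r, a, b, rfl, h⟩ := h
  rw [List.append_eq_append_iff] at h
  have key : ∀ l r, StrongLe (l ++ DEntry.undot a :: DEntry.undot b :: r)
      (l ++ DEntry.undot (a + b) :: r) := fun l r =>
    Relation.ReflTransGen.single ⟨l, r, a, b, rfl, rfl⟩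
  rcases h with ⟨s, rfl, rfl⟩ | ⟨s, rfl, h⟩
  · exact ⟨α, s ++ DEntry.undot a :: DEntry.undot b :: r, by simp,
      Relation.ReflTransGen.refl, key _ _⟩
  · cases s with
    | nil =>
      simp at h
      subst h
      exact ⟨l, _, rfl, by rw [List.append_nil]; exact Relation.ReflTransGen.refl, key [] r⟩
    | cons e s =>
      simp at h
      obtain ⟨rfl, rfl⟩ := h
      exact ⟨l ++ DEntry.undot a :: DEntry.undot b :: s, β, by simp, key _ _,
        Relation.ReflTransGen.refl⟩

lemma le_split {γ δ : DComp} (h : StrongLe γ δ) : ∀ α β, δ = α ++ β →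
    ∃ x y, γ = x ++ y ∧ StrongLe x α ∧ StrongLe y β := by
  unfold StrongLe at h
  induction h with
  | refl => exact fun α β h => ⟨α, β, h, Relation.ReflTransGen.refl, Relation.ReflTransGen.refl⟩
  | tail _ h2 ih =>
    rintro α β rfl
    obtain ⟨x, y, h3, hx, hy⟩ := cover_split h2
    obtain ⟨x', y', h4, hx', hy'⟩ := ih x y h3
    exact ⟨x', y', h4, hx'.trans hx, hy'.trans hy⟩

lemma app_inj {x y x' y' : DComp} (hw : wt x = wt x') (h : x ++ y = x' ++ y') :
    x = x' ∧ y = y' := by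
  rw [List.append_eq_append_iff] at h
  rcases h with ⟨s, rfl, rfl⟩ | ⟨s, rfl, rfl⟩ <;>
  · rw [wt_append] at hw
    have : s = [] := wt_zero (by omega)
    subst this
    simp

lemma fund_eq (α : DComp) : Fund α = ∑ β ∈ (finite_le α).toFinset, Mono β :=
  finsum_mem_eq_finite_toFinset_sum _ (finite_le α)

lemma cdot_sum (s t : Finset DComp) :
    cdot (∑ x ∈ s, Mono x) (∑ y ∈ t, Mono y) = ∑ x ∈ s, ∑ y ∈ t, Mono (x ++ y) := by
  unfold cdot
  rw [← Finsupp.sum_finset_sum_index]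
  · refine Finset.sum_congr rfl fun x _ => ?_
    rw [Mono, Finsupp.sum_single_index (by simp), ← Finsupp.sum_finset_sum_index]
    · refine Finset.sum_congr rfl fun y _ => ?_
      rw [Mono, Finsupp.sum_single_index (by simp)]
      simp
    · simp
    · intros; rw [mul_add, add_smul]
  · simp
  · intros
    rw [← Finsupp.sum_add]
    refine Finsupp.sum_congr fun _ _ => ?_
    rw [add_mul, add_smul]

end SQ

/-- For all dotted compositions `α` and `β`, `L_α • L_β = L_{α·β}`. -/
theorem cdot_fund_fund (α β : DComp) : cdot (Fund α) (Fund β) = Fund (α ++ β) := by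
  classical
  rw [SQ.fund_eq, SQ.fund_eq, SQ.fund_eq, SQ.cdot_sum, ← Finset.sum_product']
  refine Finset.sum_bij (fun p _ => p.1 ++ p.2) ?_ ?_ ?_ ?_
  · intro p hp
    simp only [Finset.mem_product, Set.Finite.mem_toFinset, Set.mem_setOf_eq] at hp ⊢
    exact SQ.le_append hp.1 hp.2
  · intro p hp q hq h
    simp only [Finset.mem_product, Set.Finite.mem_toFinset, Set.mem_setOf_eq] at hp hq
    have := SQ.app_inj ((SQ.le_wt hp.1).trans (SQ.le_wt hq.1).symm) h
    exact Prod.ext this.1 this.2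
  · intro γ hγ
    simp only [Set.Finite.mem_toFinset, Set.mem_setOf_eq] at hγ
    obtain ⟨x, y, rfl, hx, hy⟩ := SQ.le_split hγ α β rfl
    exact ⟨(x, y), by simp [hx, hy], rfl⟩
  · intro p _
    rfl
end

section
/- Let α and β be dotted compositions such that the last entry of α and the first entry of β are both undotted. Then L_α • L_β + L_α ⊙ L_β = L_{α⊙β} in sQSym. -/
namespace SQ

open DEntry DComp

def inc : DComp → DComp
  | [] => []
  | undot m :: l => undot (m + 1) :: l
  | dot k :: l => dot (k + 1) :: l

theorem inc_inj : Function.Injective inc := by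
  intro x y h
  rcases x with _ | ⟨_ | _, _⟩ <;> rcases y with _ | ⟨_ | _, _⟩ <;> simp_all [inc]

theorem cons_inj (x : DEntry) : Function.Injective (fun l : DComp => x :: l) := by
  intro a b h
  simpa using h

theorem cover_inv {δ ε : DComp} {x : DEntry} (h : StrongCover δ (x :: ε)) :
    (∃ δ', δ = x :: δ' ∧ StrongCover δ' ε) ∨
    (∃ a b, x = undot (a + b) ∧ δ = undot a :: undot b :: ε) := by
  obtain ⟨l, r, a, b, h1, h2⟩ := h
  rcases l with _ | ⟨y, l⟩
  · simp only [List.nil_append, List.cons.injEq] at h1 h2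
    right
    exact ⟨a, b, h2.1, by rw [h1, h2.2]⟩
  · simp only [List.cons_append, List.cons.injEq] at h1 h2
    left
    exact ⟨l ++ undot a :: undot b :: r, by rw [h1, h2.1], l, r, a, b, rfl, h2.2⟩

theorem cover_nil {δ : DComp} (h : StrongCover δ []) : False := by
  obtain ⟨l, r, a, b, h1, h2⟩ := h
  simp at h2

theorem cover_cons {δ ε : DComp} (x : DEntry) (h : StrongCover δ ε) :
    StrongCover (x :: δ) (x :: ε) := by
  obtain ⟨l, r, a, b, h1, h2⟩ := h
  exact ⟨x :: l, r, a, b, by simp [h1], by simp [h2]⟩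

theorem cover_inc {δ ε : DComp} (h : StrongCover δ ε) : StrongCover (inc δ) (inc ε) := by
  obtain ⟨l, r, a, b, h1, h2⟩ := h
  rcases l with _ | ⟨_ | _, l⟩
  · exact ⟨[], r, a + 1, b, by simp [h1, inc], by simp [h2, inc, add_right_comm]⟩
  · exact ⟨_ :: l, r, a, b, by rw [h1]; simp [inc]; rfl, by simp [h2, inc]⟩
  · exact ⟨_ :: l, r, a, b, by rw [h1]; simp [inc]; rfl, by simp [h2, inc]⟩

def S (α : DComp) : Set DComp := {β | StrongLe β α}

theorem le_cons {δ ε : DComp} (x : DEntry) (h : StrongLe δ ε) :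
    StrongLe (x :: δ) (x :: ε) :=
  Relation.ReflTransGen.lift (fun l : DComp => x :: l) (fun _ _ => cover_cons x) _ _ h

theorem le_inc {δ ε : DComp} (h : StrongLe δ ε) : StrongLe (inc δ) (inc ε) :=
  Relation.ReflTransGen.lift inc (fun _ _ => cover_inc) _ _ h

theorem S_sub {γ : DComp} (T : Set DComp) (h0 : γ ∈ T)
    (h1 : ∀ δ ε, StrongCover δ ε → ε ∈ T → δ ∈ T) : S γ ⊆ T := by
  intro δ h
  induction h using Relation.ReflTransGen.head_induction_on with
  | refl => exact h0
  | head h _ ih => exact h1 _ _ h ih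

theorem S_nil : S [] = {[]} := by
  apply Set.Subset.antisymm
  · refine S_sub {[]} rfl ?_
    rintro δ ε h rfl
    exact (cover_nil h).elim
  · rintro _ rfl
    exact Relation.ReflTransGen.refl

theorem S_cons (x : DEntry) (hx : ∀ a b, x ≠ undot (a + b)) (α : DComp) :
    S (x :: α) = (fun l : DComp => x :: l) '' S α := by
  apply Set.Subset.antisymm
  · apply S_sub
    · exact ⟨α, Relation.ReflTransGen.refl, rfl⟩
    · rintro δ _ h ⟨ε, hε, rfl⟩
      rcases cover_inv h with ⟨δ', rfl, h'⟩ | ⟨a, b, h', _⟩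
      · exact ⟨δ', Relation.ReflTransGen.head h' hε, rfl⟩
      · exact (hx a b h').elim
  · rintro _ ⟨δ, h, rfl⟩
    exact le_cons x h

theorem one_ne (a b : ℕ+) : undot 1 ≠ undot (a + b) := by
  intro h
  injection h with h
  have := congrArg PNat.val h
  have h1 := a.pos
  have h2 := b.pos
  simp only [PNat.add_coe, PNat.one_coe] at this
  change 1 = (a : ℕ) + b at this
  omega

theorem S_succ (n : ℕ+) (α : DComp) :
    S (undot (n + 1) :: α) =
      (fun l : DComp => undot 1 :: l) '' S (undot n :: α) ∪ inc '' S (undot n :: α) := by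
  apply Set.Subset.antisymm
  · apply S_sub
    · right
      exact ⟨undot n :: α, Relation.ReflTransGen.refl, rfl⟩
    · rintro δ _ h (⟨ε, hε, rfl⟩ | ⟨ε, hε, rfl⟩)
      · rcases cover_inv h with ⟨δ', rfl, h'⟩ | ⟨a, b, h', _⟩
        · left
          exact ⟨δ', Relation.ReflTransGen.head h' hε, rfl⟩
        · exact (one_ne a b h').elim
      · rcases ε with _ | ⟨m | k, ε⟩
        · exact (cover_nil h).elim
        · rcases cover_inv h with ⟨δ', rfl, h'⟩ | ⟨a, b, h', rfl⟩
          · right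
            exact ⟨undot m :: δ', Relation.ReflTransGen.head (cover_cons _ h') hε, rfl⟩
          · injection h' with h'
            induction a using PNat.recOn with
            | one =>
              left
              have : b = m := by
                rw [add_comm m 1] at h'
                exact (add_left_cancel h').symm
              subst this
              exact ⟨_, hε, rfl⟩
            | succ a _ =>
              right
              have : m = a + b := by
                rw [add_right_comm] at h'
                exact add_right_cancel h'
              subst this
              exact ⟨undot a :: undot b :: ε,
                Relation.ReflTransGen.head ⟨[], ε, a, b, rfl, rfl⟩ hε, rfl⟩
        · rcases cover_inv h with ⟨δ', rfl, h'⟩ | ⟨a, b, h', _⟩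
          · right
            exact ⟨dot k :: δ', Relation.ReflTransGen.head (cover_cons _ h') hε, rfl⟩
          · cases h'
  · rintro _ (⟨δ, h, rfl⟩ | ⟨δ, h, rfl⟩)
    · refine Relation.ReflTransGen.tail (le_cons _ h) ⟨[], α, 1, n, rfl, ?_⟩
      simp [add_comm]
    · exact le_inc h

theorem S_fin (α : DComp) : (S α).Finite := by
  induction α with
  | nil => rw [S_nil]; exact Set.finite_singleton _
  | cons x α ih =>
    rcases x with n | k
    · induction n using PNat.recOn with
      | one => rw [S_cons _ one_ne]; exact ih.image _
      | succ n ihn => rw [S_succ]; exact (ihn.image _).union (ihn.image _)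
    · rw [S_cons _ (by simp)]; exact ih.image _

noncomputable def C (x : DEntry) : sQSym →+ sQSym :=
  Finsupp.mapDomain.addMonoidHom (fun l : DComp => x :: l)

noncomputable def I : sQSym →+ sQSym := Finsupp.mapDomain.addMonoidHom inc

theorem map_fund (f : DComp → DComp) (hf : Function.Injective f) (α : DComp) :
    Finsupp.mapDomain f (Fund α) = ∑ᶠ β ∈ f '' S α, Mono β := by
  rw [finsum_mem_image hf.injOn]
  have := AddMonoidHom.map_finsum_mem Mono
    (Finsupp.mapDomain.addMonoidHom f : sQSym →+ sQSym) (S_fin α)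
  simpa [Mono, Fund, S, Finsupp.mapDomain_single] using this

theorem fund_nil : Fund [] = Mono [] := by
  change ∑ᶠ β ∈ S [], Mono β = _
  rw [S_nil, finsum_mem_singleton]

theorem fund_cons (x : DEntry) (hx : ∀ a b, x ≠ undot (a + b)) (α : DComp) :
    Fund (x :: α) = C x (Fund α) := by
  change ∑ᶠ β ∈ S _, Mono β = Finsupp.mapDomain _ _
  rw [S_cons x hx, map_fund _ (cons_inj x)]

theorem fund_succ (n : ℕ+) (α : DComp) :
    Fund (undot (n + 1) :: α) = C (undot 1) (Fund (undot n :: α)) + I (Fund (undot n :: α)) := by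
  change ∑ᶠ β ∈ S _, Mono β = Finsupp.mapDomain _ _ + Finsupp.mapDomain _ _
  rw [S_succ, map_fund _ (cons_inj _), map_fund _ inc_inj, finsum_mem_union]
  · rw [Set.disjoint_left]
    rintro _ ⟨δ, _, rfl⟩ ⟨ε, _, h⟩
    rcases ε with _ | ⟨m | k, ε⟩
    · simp [inc] at h
    · simp only [inc, List.cons.injEq] at h
      exact one_ne _ _ h.1.symm
    · simp [inc] at h
  · exact (S_fin _).image _
  · exact (S_fin _).image _

theorem C_nil (x : DEntry) (F : sQSym) : C x F [] = 0 := by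
  apply Finsupp.mapDomain_of_notMem_range
  simp

theorem I_nil (F : sQSym) : I F [] = F [] :=
  Finsupp.mapDomain_apply inc_inj F []

theorem fund_ne (α : DComp) (h : α ≠ []) : Fund α [] = 0 := by
  rcases α with _ | ⟨n | k, α⟩
  · exact (h rfl).elim
  · induction n using PNat.recOn with
    | one => rw [fund_cons _ one_ne, C_nil]
    | succ n ih => rw [fund_succ, Finsupp.add_apply, C_nil, I_nil, ih (by simp), add_zero]
  · rw [fund_cons _ (by simp), C_nil]

noncomputable def near (α β : DComp) : sQSym :=
  match nearConcat α β with
  | some γ => Mono γ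
  | none => 0

theorem cdot_eq (F G : sQSym) :
    cdot F G = F.sum fun α a => G.sum fun β b => (a * b) • Mono (α ++ β) := rfl

theorem odot_eq (F G : sQSym) :
    odot F G = F.sum fun α a => G.sum fun β b => (a * b) • near α β := by
  unfold odot near
  congr! 5
  split <;> simp

/-- generic bilinear extension -/
noncomputable def bil (p : DComp → DComp → sQSym) (F G : sQSym) : sQSym :=
  F.sum fun α a => G.sum fun β b => (a * b) • p α β

theorem bil_add (p) (F F' G : sQSym) : bil p (F + F') G = bil p F G + bil p F' G := by
  unfold bil
  apply Finsupp.sum_add_index'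
  · simp
  · intro α a b
    simp [add_mul, add_smul, Finsupp.sum_add]

theorem bil_map (p : DComp → DComp → sQSym) (f g : DComp → DComp) (F G : sQSym) (hF : F [] = 0)
    (h : ∀ α β, α ≠ [] → p (f α) β = Finsupp.mapDomain g (p α β)) :
    bil p (Finsupp.mapDomain f F) G = Finsupp.mapDomain g (bil p F G) := by
  unfold bil
  rw [Finsupp.sum_mapDomain_index (by simp)
    (by intro α a b; simp [add_mul, add_smul, Finsupp.sum_add])]
  simp only [Finsupp.sum]
  rw [Finsupp.mapDomain_finsetSum]
  apply Finset.sum_congr rfl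
  intro α hα
  rw [Finsupp.mapDomain_finsetSum]
  apply Finset.sum_congr rfl
  intro β _
  rw [Finsupp.mapDomain_smul, h]
  rintro rfl
  simp [hF] at hα

theorem bil_single (p : DComp → DComp → sQSym) (α : DComp) (g : DComp → DComp) (G : sQSym)
    (hG : G [] = 0) (h : ∀ β, β ≠ [] → p α β = Mono (g β)) :
    bil p (Mono α) G = Finsupp.mapDomain g G := by
  unfold bil Mono
  rw [Finsupp.sum_single_index (by simp)]
  unfold Finsupp.mapDomain
  apply Finset.sum_congr rfl
  intro β hβ
  dsimp only
  rw [h]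
  · simp [Mono]
  rintro rfl
  simp [hG] at hβ

noncomputable def app (α β : DComp) : sQSym := Mono (α ++ β)

theorem map_mono (g : DComp → DComp) (α : DComp) :
    Finsupp.mapDomain g (Mono α) = Mono (g α) := by
  simp [Mono, Finsupp.mapDomain_single]

theorem app_cons (x : DEntry) (α β : DComp) :
    app (x :: α) β = Finsupp.mapDomain (fun l : DComp => x :: l) (app α β) := by
  simp [app, map_mono]

theorem app_inc (α β : DComp) (h : α ≠ []) :
    app (inc α) β = Finsupp.mapDomain inc (app α β) := by
  rcases α with _ | ⟨_ | _, _⟩ <;> simp_all [app, map_mono, inc]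

theorem near_cons (x : DEntry) (α β : DComp) (h : α ≠ []) :
    near (x :: α) β = Finsupp.mapDomain (fun l : DComp => x :: l) (near α β) := by
  rcases β with _ | ⟨y, β⟩
  · simp [near, nearConcat]
  rcases α with _ | ⟨z, α⟩
  · exact (h rfl).elim
  simp only [near, nearConcat, List.getLast?_cons_cons]
  obtain ⟨w, hw⟩ : ∃ w, (z :: α).getLast? = some w := by simp [List.getLast?_cons]
  rw [hw]
  cases hh : add? w y <;> simp [hh, map_mono]

theorem near_inc (α β : DComp) (h : α ≠ []) :
    near (inc α) β = Finsupp.mapDomain inc (near α β) := by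
  rcases α with _ | ⟨z, _ | ⟨w, α⟩⟩
  · exact (h rfl).elim
  · rcases β with _ | ⟨y, β⟩
    · simp [near, nearConcat]
    · rcases z with _ | _ <;> rcases y with _ | _ <;>
        simp [near, nearConcat, inc, add?, map_mono, add_right_comm]
  · have h1 : ∀ z, near (z :: w :: α) β =
      Finsupp.mapDomain (fun l : DComp => z :: l) (near (w :: α) β) :=
      fun z => near_cons z _ _ (by simp)
    rcases z with _ | _ <;> simp only [inc, h1, ← Finsupp.mapDomain_comp] <;> rfl

/-- the sum of the two products -/
noncomputable def tot (F G : sQSym) : sQSym := bil app F G + bil near F G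

theorem tot_add (F F' G : sQSym) : tot (F + F') G = tot F G + tot F' G := by
  simp only [tot, bil_add]
  abel

theorem tot_C (x : DEntry) (F G : sQSym) (hF : F [] = 0) : tot (C x F) G = C x (tot F G) := by
  rw [tot, tot, map_add]
  exact congrArg₂ _ (bil_map _ _ _ _ _ hF fun α β _ => app_cons x α β)
    (bil_map _ _ _ _ _ hF fun α β h => near_cons x α β h)

theorem tot_I (F G : sQSym) (hF : F [] = 0) : tot (I F) G = I (tot F G) := by
  rw [tot, tot, map_add]
  exact congrArg₂ _ (bil_map _ _ _ _ _ hF app_inc) (bil_map _ _ _ _ _ hF near_inc)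

theorem tot_one (G : sQSym) (hG : G [] = 0) :
    tot (Mono [undot 1]) G = C (undot 1) G + I G := by
  refine congrArg₂ _ (bil_single _ _ _ _ hG fun β _ => rfl) (bil_single _ _ _ _ hG ?_)
  rintro (_ | ⟨_ | _, _⟩) h
  · exact (h rfl).elim
  · simp [near, nearConcat, inc, add?, add_comm]
  · simp [near, nearConcat, inc, add?, add_comm]

theorem fund_one : Fund [undot 1] = Mono [undot 1] := by
  rw [fund_cons _ one_ne, fund_nil]
  exact map_mono _ _

theorem step {n m : ℕ+} {α γ : DComp} {G : sQSym}
    (h : tot (Fund (undot n :: α)) G = Fund (undot m :: γ)) :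
    tot (Fund (undot (n + 1) :: α)) G = Fund (undot (m + 1) :: γ) := by
  have h0 := fund_ne (undot n :: α) (by simp)
  rw [fund_succ, fund_succ, tot_add, tot_C _ _ _ h0, tot_I _ _ h0, h]

theorem step_cons {x : DEntry} (hx : ∀ a b, x ≠ undot (a + b)) {α γ : DComp} {G : sQSym}
    (hα : α ≠ []) (h : tot (Fund α) G = Fund γ) :
    tot (Fund (x :: α)) G = Fund (x :: γ) := by
  rw [fund_cons _ hx, fund_cons _ hx, tot_C _ _ _ (fund_ne α hα), h]

theorem main (l β : DComp) (a b : ℕ+) :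
    tot (Fund (l ++ [undot a])) (Fund (undot b :: β)) = Fund (l ++ undot (a + b) :: β) := by
  induction l with
  | nil =>
    simp only [List.nil_append]
    induction a using PNat.recOn with
    | one => rw [fund_one, tot_one _ (fund_ne _ (by simp)), add_comm 1 b, fund_succ]
    | succ a ih => rw [add_right_comm]; exact step ih
  | cons x l ih =>
    rcases x with n | k
    · induction n using PNat.recOn with
      | one => exact step_cons one_ne (by simp) ih
      | succ n ihn => exact step ihn
    · exact step_cons (by simp) (by simp) ih

end SQ

/-- If the last entry of `α` and the first entry of `β` are both
undotted, then `L_α • L_β + L_α ⊙ L_β = L_{α⊙β}`. -/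
theorem cdot_add_odot_fund (α β : DComp)
    (hα : ∃ a : ℕ+, α.getLast? = some (DEntry.undot a))
    (hβ : ∃ b : ℕ+, β.head? = some (DEntry.undot b))
    (γ : DComp) (hγ : DComp.nearConcat α β = some γ) :
    cdot (Fund α) (Fund β) + odot (Fund α) (Fund β) = Fund γ := by
  obtain ⟨a, ha⟩ := hα
  obtain ⟨b, hb⟩ := hβ
  rcases β with _ | ⟨y, β⟩
  · simp at hb
  simp only [List.head?_cons, Option.some.injEq] at hb
  subst hb
  obtain ⟨l, rfl⟩ := List.getLast?_eq_some_iff.mp ha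
  have : γ = l ++ DEntry.undot (a + b) :: β := by
    simpa [DComp.nearConcat, DEntry.add?, eq_comm] using hγ
  subst this
  rw [SQ.odot_eq]
  exact SQ.main l β a b
end

section
/- Let F and G be elements of sQSym homogeneous in the fermionic degree, of fermionic degrees m_F and m_G respectively. Then S(F • G) = (−1)^{m_F m_G} ( S(G) • S(F) + S(G) ⊙ S(F) ). -/
namespace Aux

theorem add_ne (x h : DEntry) : DEntry.add? x h ≠ some x := by
  cases x <;> cases h <;> simp [DEntry.add?]
  intro h
  have := congrArg PNat.val h
  simp at this

theorem add_inj {x h h' z : DEntry} (e : DEntry.add? x h = some z)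
    (e' : DEntry.add? x h' = some z) : h = h' := by
  cases x <;> cases h <;> cases h' <;> simp_all [DEntry.add?] <;> subst_vars <;> simp_all

theorem add_assoc (x h y : DEntry) :
    (DEntry.add? x h).bind (fun z => DEntry.add? z y) =
      (DEntry.add? h y).bind (fun u => DEntry.add? x u) := by
  cases x <;> cases h <;> cases y <;> simp [DEntry.add?, _root_.add_assoc]

theorem weak_cons (x : DEntry) {β γ : DComp} (h : DComp.WeakLe β γ) :
    DComp.WeakLe (x :: β) (x :: γ) := by
  induction h with
  | refl => exact Relation.ReflTransGen.refl
  | tail _ hc ih =>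
    refine Relation.ReflTransGen.tail ih ?_
    obtain ⟨l, r, a, b, c, rfl, h2, rfl⟩ := hc
    exact ⟨x :: l, r, a, b, c, rfl, h2, rfl⟩

theorem weak_nil {γ : DComp} : DComp.WeakLe [] γ ↔ γ = [] := by
  constructor
  · intro h
    induction h with
    | refl => rfl
    | tail _ hc ih =>
      obtain ⟨l, r, a, b, c, h1, h2, h3⟩ := hc
      subst ih
      simp at h1
  · rintro rfl
    exact Relation.ReflTransGen.refl

theorem weak_cons_iff (x : DEntry) (β γ : DComp) :
    DComp.WeakLe (x :: β) γ ↔ (∃ γ', DComp.WeakLe β γ' ∧ x :: γ' = γ) ∨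
      (∃ h t z, DComp.WeakLe β (h :: t) ∧ DEntry.add? x h = some z ∧ γ = z :: t) := by
  constructor
  · intro h
    induction h with
    | refl => exact Or.inl ⟨β, Relation.ReflTransGen.refl, rfl⟩
    | tail _ hc ih =>
      obtain ⟨l, r, a, b, c, h1, h2, rfl⟩ := hc
      rcases ih with ⟨γ', hg, rfl⟩ | ⟨h, t, z, hg, hz, rfl⟩
      · cases l with
        | nil =>
          simp only [List.nil_append, List.cons.injEq] at h1
          obtain ⟨rfl, rfl⟩ := h1
          exact Or.inr ⟨b, r, c, hg, h2, rfl⟩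
        | cons w l =>
          simp only [List.cons_append, List.cons.injEq] at h1
          obtain ⟨rfl, rfl⟩ := h1
          exact Or.inl ⟨l ++ c :: r, hg.tail ⟨l, r, a, b, c, rfl, h2, rfl⟩, rfl⟩
      · cases l with
        | nil =>
          simp only [List.nil_append, List.cons.injEq] at h1
          obtain ⟨rfl, rfl⟩ := h1
          have := add_assoc x h b
          rw [hz, Option.bind_some, h2] at this
          obtain ⟨u, hu, hu'⟩ := Option.bind_eq_some_iff.1 this.symm
          exact Or.inr ⟨u, r, c, hg.tail ⟨[], r, h, b, u, rfl, hu, rfl⟩, hu', rfl⟩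
        | cons w l =>
          simp only [List.cons_append, List.cons.injEq] at h1
          obtain ⟨rfl, rfl⟩ := h1
          exact Or.inr ⟨h, l ++ c :: r, z,
            hg.tail ⟨h :: l, r, a, b, c, rfl, h2, rfl⟩, hz, rfl⟩
  · rintro (⟨γ', hg, rfl⟩ | ⟨h, t, z, hg, hz, rfl⟩)
    · exact weak_cons x hg
    · exact (weak_cons x hg).tail ⟨[], t, x, h, z, rfl, hz, rfl⟩

/-- list of coarsenings -/
def C : DComp → List DComp
  | [] => [[]]
  | x :: β => (C β).map (x :: ·) ++ (C β).filterMap (fun γ => DComp.nearConcat [x] γ)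

theorem near_single {x : DEntry} {γ δ : DComp} : DComp.nearConcat [x] γ = some δ ↔
    ∃ h t z, γ = h :: t ∧ DEntry.add? x h = some z ∧ δ = z :: t := by
  cases γ with
  | nil => simp [DComp.nearConcat]
  | cons h t =>
    simp only [DComp.nearConcat, List.getLast?_singleton, Option.map_eq_some_iff]
    constructor
    · rintro ⟨z, hz, rfl⟩
      exact ⟨h, t, z, rfl, hz, rfl⟩
    · rintro ⟨h', t', z, e, hz, rfl⟩
      cases e
      exact ⟨z, hz, rfl⟩

theorem mem_C (α γ : DComp) : γ ∈ C α ↔ DComp.WeakLe α γ := by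
  induction α generalizing γ with
  | nil => simp [C, weak_nil]
  | cons x β ih =>
    rw [weak_cons_iff]
    simp only [C, List.mem_append, List.mem_map, List.mem_filterMap, ih, near_single]
    refine or_congr Iff.rfl ?_
    constructor
    · rintro ⟨a, ha, h, t, z, rfl, hz, rfl⟩
      exact ⟨h, t, z, ha, hz, rfl⟩
    · rintro ⟨h, t, z, ha, hz, rfl⟩
      exact ⟨_, ha, h, t, z, rfl, hz, rfl⟩

theorem nodup_C (α : DComp) : (C α).Nodup := by
  induction α with
  | nil => simp [C]
  | cons x β ih =>
    simp only [C]
    refine List.Nodup.append (ih.map (fun a b h => by simpa using h)) (ih.filterMap ?_) ?_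
    · intro a a' b hb hb'
      obtain ⟨h, t, z, rfl, hz, rfl⟩ := near_single.1 hb
      obtain ⟨h', t', z', rfl, hz', e⟩ := near_single.1 hb'
      cases e
      rw [add_inj hz hz']
    · intro δ h1 h2
      obtain ⟨a, _, rfl⟩ := List.mem_map.1 h1
      obtain ⟨b, _, hb⟩ := List.mem_filterMap.1 h2
      obtain ⟨h, t, z, rfl, hz, e⟩ := near_single.1 hb
      cases e
      exact add_ne _ _ hz

noncomputable def U (α : DComp) : sQSym := ((C α).map Mono).sum

theorem finsum_eq (α : DComp) : ∑ᶠ γ ∈ {γ | DComp.WeakLe α γ}, Mono γ = U α := by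
  have : {γ | DComp.WeakLe α γ} = ((C α).toFinset : Set DComp) := by
    ext γ; simp [mem_C]
  rw [this, finsum_mem_coe_finset, List.sum_toFinset _ (nodup_C α), U]

noncomputable def N (α β : DComp) : sQSym :=
  match DComp.nearConcat α β with
  | some γ => Mono γ
  | none => 0

noncomputable def cL : sQSym →ₗ[ℚ] sQSym →ₗ[ℚ] sQSym :=
  Finsupp.linearCombination ℚ (fun α => Finsupp.linearCombination ℚ (fun β => Mono (α ++ β)))

noncomputable def oL : sQSym →ₗ[ℚ] sQSym →ₗ[ℚ] sQSym :=
  Finsupp.linearCombination ℚ (fun α => Finsupp.linearCombination ℚ (fun β => N α β))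

noncomputable def aL : sQSym →ₗ[ℚ] sQSym :=
  Finsupp.linearCombination ℚ
    (fun α => (-1 : ℚ) ^ (α.length + Nat.choose (DComp.fdeg α) 2) • U α.reverse)

theorem cdot_eq (F G : sQSym) : cdot F G = cL F G := by
  simp only [cdot, cL, Finsupp.linearCombination_apply, Finsupp.sum, LinearMap.sum_apply,
    LinearMap.smul_apply, Finset.smul_sum, smul_smul]

theorem odot_eq (F G : sQSym) : odot F G = oL F G := by
  simp only [odot, oL, Finsupp.linearCombination_apply, Finsupp.sum, LinearMap.sum_apply,
    LinearMap.smul_apply, Finset.smul_sum, smul_smul]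
  refine Finset.sum_congr rfl fun α _ => Finset.sum_congr rfl fun β _ => ?_
  unfold N
  cases DComp.nearConcat α β <;> simp

theorem antipode_eq (F : sQSym) : antipode F = aL F := by
  simp only [antipode, aL, Finsupp.linearCombination_apply, smul_smul, finsum_eq]

@[simp] theorem cL_Mono (α β : DComp) : cL (Mono α) (Mono β) = Mono (α ++ β) := by
  simp [cL, Mono]

@[simp] theorem oL_Mono (α β : DComp) : oL (Mono α) (Mono β) = N α β := by
  simp [oL, Mono]

theorem aL_Mono (α : DComp) : aL (Mono α) =
    (-1 : ℚ) ^ (α.length + Nat.choose (DComp.fdeg α) 2) • U α.reverse := by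
  simp [aL, Mono]

theorem hom_ext {f g : sQSym →ₗ[ℚ] sQSym} (h : ∀ α, f (Mono α) = g (Mono α)) : f = g :=
  Finsupp.lhom_ext' fun α => LinearMap.ext_ring (h α)

theorem U_cons (x : DEntry) (β : DComp) :
    U (x :: β) = cL (Mono [x]) (U β) + oL (Mono [x]) (U β) := by
  simp only [U, C, List.map_append, List.sum_append]
  generalize C β = L
  congr 1
  · induction L with
    | nil => simp
    | cons a L ih => simp_all
  · induction L with
    | nil => simp
    | cons a L ih =>
      simp only [List.map_cons, List.sum_cons, map_add, oL_Mono, ← ih, N]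
      cases h : DComp.nearConcat [x] a <;> simp [h]

theorem cL_nil (B : sQSym) : cL (Mono []) B = B := by
  have : cL (Mono []) = LinearMap.id := hom_ext fun α => by simp
  rw [this]; rfl

theorem oL_nil (B : sQSym) : oL (Mono []) B = 0 := by
  have : oL (Mono []) = 0 := hom_ext fun α => by
    cases α <;> simp [N, DComp.nearConcat]
  rw [this]; rfl

theorem oL_nil_right (A : DComp) : N A [] = 0 := by
  simp [N, DComp.nearConcat]

theorem near_concat_snoc (l r : DComp) (x y : DEntry) :
    DComp.nearConcat (l ++ [x]) (y :: r) = (DEntry.add? x y).map (fun z => l ++ z :: r) := by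
  simp [DComp.nearConcat]

theorem N_snoc (l r : DComp) (x y : DEntry) :
    N (l ++ [x]) (y :: r) = ((DEntry.add? x y).map (fun z => Mono (l ++ z :: r))).getD 0 := by
  rw [N, near_concat_snoc]
  cases DEntry.add? x y <;> rfl

theorem assoc_cc (α β : DComp) (B : sQSym) :
    cL (Mono α) (cL (Mono β) B) = cL (cL (Mono α) (Mono β)) B := by
  have : cL (Mono α) ∘ₗ cL (Mono β) = cL (cL (Mono α) (Mono β)) := hom_ext fun δ => by simp
  exact congrArg (· B) this

theorem assoc_co (x : DEntry) (β : DComp) (hβ : β ≠ []) (B : sQSym) :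
    cL (Mono [x]) (oL (Mono β) B) = oL (cL (Mono [x]) (Mono β)) B := by
  have : cL (Mono [x]) ∘ₗ oL (Mono β) = oL (cL (Mono [x]) (Mono β)) := hom_ext fun δ => by
    obtain ⟨l, w, rfl⟩ := (List.eq_nil_or_concat' β).resolve_left hβ
    cases δ with
    | nil => simp [oL_nil_right]
    | cons y r =>
      have e : [x] ++ (l ++ [w]) = (x :: l) ++ [w] := rfl
      simp only [LinearMap.comp_apply, oL_Mono, cL_Mono, e, N_snoc]
      cases DEntry.add? w y <;> simp
  exact congrArg (· B) this

theorem assoc_oc (x : DEntry) (β : DComp) (hβ : β ≠ []) (B : sQSym) :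
    oL (Mono [x]) (cL (Mono β) B) = cL (oL (Mono [x]) (Mono β)) B := by
  have : oL (Mono [x]) ∘ₗ cL (Mono β) = cL (oL (Mono [x]) (Mono β)) := hom_ext fun δ => by
    obtain ⟨h, t, rfl⟩ := List.exists_cons_of_ne_nil hβ
    have e : [x] = [] ++ [x] := rfl
    simp only [LinearMap.comp_apply, oL_Mono, cL_Mono, List.cons_append]
    rw [e, N_snoc, N_snoc]
    cases DEntry.add? x h <;> simp
  exact congrArg (· B) this

theorem assoc_oo (x : DEntry) (β : DComp) (hβ : β ≠ []) (B : sQSym) :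
    oL (Mono [x]) (oL (Mono β) B) = oL (oL (Mono [x]) (Mono β)) B := by
  have : oL (Mono [x]) ∘ₗ oL (Mono β) = oL (oL (Mono [x]) (Mono β)) := hom_ext fun δ => by
    have e : [x] = [] ++ [x] := rfl
    cases δ with
    | nil =>
      obtain ⟨h, t, rfl⟩ := List.exists_cons_of_ne_nil hβ
      simp only [LinearMap.comp_apply, oL_Mono, oL_nil_right, map_zero]
      rw [e, N_snoc]
      cases DEntry.add? x h <;> simp [oL_nil_right]
    | cons y r =>
      obtain ⟨l, w, rfl⟩ := (List.eq_nil_or_concat' β).resolve_left hβ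
      simp only [LinearMap.comp_apply, oL_Mono, N_snoc]
      cases l with
      | nil =>
        have := add_assoc x w y
        rw [e]
        simp only [List.nil_append]
        rw [← List.nil_append [x], N_snoc]
        cases h1 : DEntry.add? x w <;> cases h2 : DEntry.add? w y <;>
          simp only [h1, h2, Option.bind_some, Option.bind_none] at this <;>
          simp only [Option.map_some, Option.map_none, Option.getD_some, Option.getD_none,
            oL_Mono, map_zero, LinearMap.zero_apply, List.nil_append]
        · rw [← List.nil_append [x], N_snoc, ← this]; rfl
        · rename_i z; rw [← List.nil_append [z], N_snoc, this]; rfl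
        · rename_i z u
          rw [← List.nil_append [z], ← List.nil_append [x], N_snoc, N_snoc, this]
      | cons h t =>
        rw [e, List.cons_append, N_snoc]
        cases h1 : DEntry.add? x h <;> cases h2 : DEntry.add? w y <;>
          simp only [Option.map_some, Option.map_none, Option.getD_some, Option.getD_none,
            oL_Mono, map_zero, LinearMap.zero_apply, List.nil_append, List.cons_append]
        · rw [← List.nil_append [x], N_snoc, h1]; rfl
        · rename_i z; rw [← List.cons_append, N_snoc, h2]; rfl
        · rename_i z u
          rw [← List.nil_append [x], N_snoc, h1, ← List.cons_append, N_snoc, h2]; rfl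
  exact congrArg (· B) this

theorem assoc_list (x : DEntry) (L : List DComp) (hL : ∀ γ ∈ L, γ ≠ []) (B : sQSym) :
    cL (Mono [x]) (cL (L.map Mono).sum B + oL (L.map Mono).sum B)
      + oL (Mono [x]) (cL (L.map Mono).sum B + oL (L.map Mono).sum B) =
    cL (cL (Mono [x]) (L.map Mono).sum + oL (Mono [x]) (L.map Mono).sum) B
      + oL (cL (Mono [x]) (L.map Mono).sum + oL (Mono [x]) (L.map Mono).sum) B := by
  induction L with
  | nil => simp
  | cons a L ih =>
    have ih := ih fun γ hγ => hL γ (List.mem_cons_of_mem _ hγ)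
    have ha := hL a List.mem_cons_self
    simp only [List.map_cons, List.sum_cons, map_add, LinearMap.add_apply] at ih ⊢
    rw [assoc_cc, assoc_co x a ha, assoc_oc x a ha, assoc_oo x a ha]
    linear_combination (norm := module) ih

theorem C_ne_nil (y : DEntry) (a : DComp) : ∀ γ ∈ C (y :: a), γ ≠ [] := by
  rintro γ h rfl
  rw [mem_C, weak_cons_iff] at h
  simp at h

theorem U_append (α β : DComp) : U (α ++ β) = cL (U α) (U β) + oL (U α) (U β) := by
  have h0 : U [] = Mono [] := by simp [U, C]
  induction α with
  | nil => simp [h0, cL_nil, oL_nil]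
  | cons x α ih =>
    rw [List.cons_append, U_cons, U_cons]
    cases α with
    | nil => simp [h0, oL_nil_right]
    | cons y a =>
      rw [ih]
      exact assoc_list x (C (y :: a)) (C_ne_nil y a) _

theorem choose_add (m n : ℕ) : (m + n).choose 2 = m.choose 2 + n.choose 2 + m * n := by
  induction n with
  | zero => simp
  | succ n ih =>
    rw [← Nat.add_assoc, Nat.choose_succ_succ' (m + n) 1, Nat.choose_succ_succ' n 1, ih]
    simp
    ring

theorem main_Mono (α β : DComp) : aL (cL (Mono α) (Mono β)) =
    ((-1 : ℚ) ^ (DComp.fdeg α * DComp.fdeg β)) •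
      (cL (aL (Mono β)) (aL (Mono α)) + oL (aL (Mono β)) (aL (Mono α))) := by
  have hf : DComp.fdeg (α ++ β) = DComp.fdeg α + DComp.fdeg β := by simp [DComp.fdeg]
  rw [cL_Mono, aL_Mono, aL_Mono, aL_Mono, List.reverse_append, U_append, hf, choose_add]
  simp only [map_smul, LinearMap.smul_apply, smul_smul, ← smul_add, List.length_append]
  congr 1
  ring

end Aux

/-- For `F, G ∈ sQSym` homogeneous in the fermionic degree, of
fermionic degrees `m_F` and `m_G` respectively,
`S(F • G) = (−1)^{m_F m_G} (S(G) • S(F) + S(G) ⊙ S(F))`. -/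
theorem antipode_cdot (F G : sQSym) (mF mG : ℕ)
    (hF : F ∈ Submodule.span ℚ (Mono '' {α | DComp.fdeg α = mF}))
    (hG : G ∈ Submodule.span ℚ (Mono '' {α | DComp.fdeg α = mG})) :
    antipode (cdot F G) =
      ((-1 : ℚ) ^ (mF * mG)) •
        (cdot (antipode G) (antipode F) + odot (antipode G) (antipode F)) := by
  simp only [Aux.cdot_eq, Aux.odot_eq, Aux.antipode_eq]
  induction hF using Submodule.span_induction with
  | zero => simp
  | add a b _ _ ha hb =>
    simp only [map_add, LinearMap.add_apply, smul_add] at ha hb ⊢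
    rw [ha, hb]; abel
  | smul c a _ ha =>
    simp only [map_smul, LinearMap.smul_apply, ← smul_add] at ha ⊢
    rw [ha, smul_comm]
  | mem a ha =>
    obtain ⟨α, hα, rfl⟩ := ha
    induction hG using Submodule.span_induction with
    | zero => simp
    | add a b _ _ ha hb =>
      simp only [map_add, LinearMap.add_apply, smul_add] at ha hb ⊢
      rw [ha, hb]; abel
    | smul c a _ ha =>
      simp only [map_smul, LinearMap.smul_apply, ← smul_add] at ha ⊢
      rw [ha, smul_comm]
    | mem b hb =>
      obtain ⟨β, hβ, rfl⟩ := hb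
      have h1 : DComp.fdeg α = mF := hα
      have h2 : DComp.fdeg β = mG := hβ
      rw [Aux.main_Mono, h1, h2]
end

section
/- Let F and G be elements of sQSym homogeneous in the fermionic degree, of fermionic degrees m_F and m_G respectively. Then S(F ⊙ G) = (−1)^{m_F m_G − 1} S(G) ⊙ S(F). -/
namespace AntipodeAux

theorem add_comm' (x y : DEntry) : DEntry.add? x y = DEntry.add? y x := by
  cases x <;> cases y <;> simp [DEntry.add?, add_comm]

theorem add_assoc' (x y z : DEntry) :
    (DEntry.add? x y).bind (fun u => DEntry.add? u z) =
      (DEntry.add? y z).bind (fun u => DEntry.add? x u) := by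
  cases x <;> cases y <;> cases z <;> simp [DEntry.add?, add_assoc]

theorem add_ne (x y : DEntry) : DEntry.add? x y ≠ some x := by
  intro h
  have h2 := congrArg (Option.map (fun e : DEntry => (e.val, e.isDot))) h
  cases x <;> cases y <;> simp [DEntry.add?, DEntry.val, DEntry.isDot] at h2

theorem add_cancel (x y y' z : DEntry) (h : DEntry.add? x y = some z)
    (h' : DEntry.add? x y' = some z) : y = y' := by
  have hs : (DEntry.add? x y).isSome = true := by rw [h]; rfl
  rw [← h'] at h
  clear h'
  cases x <;> cases y <;> cases y' <;> simp [DEntry.add?] at h hs ⊢ <;> exact h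

/-- merge an entry into the head of a list -/
def mg (x : DEntry) : DComp → Option DComp
  | [] => none
  | y :: r => (DEntry.add? x y).map (fun z => z :: r)

theorem mg_eq_some (x : DEntry) (l m : DComp) :
    mg x l = some m ↔ ∃ y r z, l = y :: r ∧ DEntry.add? x y = some z ∧ m = z :: r := by
  cases l with
  | nil => simp [mg]
  | cons y r =>
    simp only [mg, Option.map_eq_some_iff]
    constructor
    · rintro ⟨z, h, rfl⟩; exact ⟨y, r, z, rfl, h, rfl⟩
    · rintro ⟨y', r', z, h, h2, rfl⟩
      cases h; exact ⟨z, h2, rfl⟩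

/-- list of all coarsenings -/
def K : DComp → List DComp
  | [] => [[]]
  | x :: r => (K r).map (fun l => x :: l) ++ (K r).filterMap (mg x)

theorem K_nodup (a : DComp) : (K a).Nodup := by
  induction a with
  | nil => simp [K]
  | cons x r ih =>
    rw [K, List.nodup_append']
    refine ⟨ih.map (fun a b h => by simpa using h), ih.filterMap ?_, ?_⟩
    · intro l l' m h h'
      rw [Option.mem_def, mg_eq_some] at h h'
      obtain ⟨y, s, z, rfl, h1, rfl⟩ := h
      obtain ⟨y', s', z', rfl, h1', h2⟩ := h'
      cases h2
      rw [add_cancel x y y' z h1 h1']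
    · intro m h h'
      rw [List.mem_map] at h
      rw [List.mem_filterMap] at h'
      obtain ⟨l, _, rfl⟩ := h
      obtain ⟨l', _, h'⟩ := h'
      rw [mg_eq_some] at h'
      obtain ⟨y, s, z, rfl, h1, h2⟩ := h'
      cases h2
      exact add_ne _ _ h1

theorem weakCover_cons (x : DEntry) {a b : DComp} (h : DComp.WeakCover a b) :
    DComp.WeakCover (x :: a) (x :: b) := by
  obtain ⟨l, r, u, v, z, rfl, h, rfl⟩ := h
  exact ⟨x :: l, r, u, v, z, rfl, h, rfl⟩

theorem weakLe_cons (x : DEntry) {a b : DComp} (h : DComp.WeakLe a b) :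
    DComp.WeakLe (x :: a) (x :: b) :=
  by
  induction h with
  | refl => exact Relation.ReflTransGen.refl
  | tail _ hc ih => exact ih.tail (weakCover_cons x hc)

theorem mem_cons_iff (x : DEntry) (r c : DComp) : c ∈ K (x :: r) ↔
    (∃ d ∈ K r, c = x :: d) ∨
      (∃ y s z, y :: s ∈ K r ∧ DEntry.add? x y = some z ∧ c = z :: s) := by
  rw [K, List.mem_append, List.mem_map, List.mem_filterMap]
  constructor
  · rintro (⟨d, h, rfl⟩ | ⟨d, h, h'⟩)
    · exact Or.inl ⟨d, h, rfl⟩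
    · rw [mg_eq_some] at h'
      obtain ⟨y, s, z, rfl, h1, rfl⟩ := h'
      exact Or.inr ⟨y, s, z, h, h1, rfl⟩
  · rintro (⟨d, h, rfl⟩ | ⟨y, s, z, h, h1, rfl⟩)
    · exact Or.inl ⟨d, h, rfl⟩
    · exact Or.inr ⟨y :: s, h, (mg_eq_some _ _ _).2 ⟨y, s, z, rfl, h1, rfl⟩⟩

theorem cover_cons_cases (x : DEntry) (a c : DComp) (h : DComp.WeakCover (x :: a) c) :
    (∃ d, DComp.WeakCover a d ∧ c = x :: d) ∨
      (∃ y s z, a = y :: s ∧ DEntry.add? x y = some z ∧ c = z :: s) := by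
  obtain ⟨l, r, u, v, z, h1, h, rfl⟩ := h
  cases l with
  | nil =>
    simp only [List.nil_append, List.cons.injEq] at h1
    obtain ⟨rfl, rfl⟩ := h1
    exact Or.inr ⟨v, r, z, rfl, h, rfl⟩
  | cons p l =>
    simp only [List.cons_append, List.cons.injEq] at h1
    obtain ⟨rfl, rfl⟩ := h1
    exact Or.inl ⟨_, ⟨l, r, u, v, z, rfl, h, rfl⟩, rfl⟩

theorem mem_K_self (a : DComp) : a ∈ K a := by
  induction a with
  | nil => simp [K]
  | cons x r ih => exact (mem_cons_iff _ _ _).2 (Or.inl ⟨r, ih, rfl⟩)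

theorem mem_K_cover (a : DComp) : ∀ b c, b ∈ K a → DComp.WeakCover b c → c ∈ K a := by
  induction a with
  | nil =>
    intro b c h hc
    simp only [K, List.mem_singleton] at h
    subst h
    obtain ⟨l, r, u, v, z, h1, -⟩ := hc
    simp at h1
  | cons x r ih =>
    intro b c h hc
    rw [mem_cons_iff] at h ⊢
    obtain ⟨d, h, rfl⟩ | ⟨y, s, z, h, h1, rfl⟩ := h
    · obtain ⟨e, he, rfl⟩ | ⟨y, s, z, rfl, h1, rfl⟩ := cover_cons_cases _ _ _ hc
      · exact Or.inl ⟨e, ih _ _ h he, rfl⟩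
      · exact Or.inr ⟨y, s, z, h, h1, rfl⟩
    · obtain ⟨e, he, rfl⟩ | ⟨w, t, v, rfl, h2, rfl⟩ := cover_cons_cases _ _ _ hc
      · exact Or.inr ⟨y, e, z, ih _ _ h (weakCover_cons y he), h1, rfl⟩
      · have := add_assoc' x y w
        rw [h1, Option.bind_some, h2] at this
        obtain ⟨u, hu, hv⟩ := Option.bind_eq_some_iff.1 this.symm
        exact Or.inr ⟨u, t, v, ih _ _ h ⟨[], t, y, w, u, rfl, hu, rfl⟩, hv, rfl⟩

theorem mem_K_iff (a c : DComp) : c ∈ K a ↔ DComp.WeakLe a c := by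
  constructor
  · induction a generalizing c with
    | nil =>
      intro h
      simp only [K, List.mem_singleton] at h
      subst h
      exact Relation.ReflTransGen.refl
    | cons x r ih =>
      intro h
      rw [mem_cons_iff] at h
      obtain ⟨d, h, rfl⟩ | ⟨y, s, z, h, h1, rfl⟩ := h
      · exact weakLe_cons x (ih _ h)
      · exact Relation.ReflTransGen.tail (weakLe_cons x (ih _ h))
          ⟨[], s, x, y, z, rfl, h1, rfl⟩
  · intro h
    induction h with
    | refl => exact mem_K_self a
    | tail _ hc ih => exact mem_K_cover a _ _ ih hc

/-- sum of the coarsenings -/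
noncomputable def C (a : DComp) : sQSym := ((K a).map Mono).sum

theorem finsum_eq_C (a : DComp) : ∑ᶠ γ ∈ {γ | DComp.WeakLe a γ}, Mono γ = C a := by
  have : {γ | DComp.WeakLe a γ} = ((K a).toFinset : Set DComp) := by
    ext c; simp [mem_K_iff]
  rw [this, finsum_mem_coe_finset, C, List.sum_toFinset _ (K_nodup a)]

/-- optional monomial -/
noncomputable def oM : Option DComp → sQSym
  | some c => Mono c
  | none => 0

/-- linear map with prescribed values on monomials -/
noncomputable def L (f : DComp → sQSym) : sQSym →ₗ[ℚ] sQSym := Finsupp.linearCombination ℚ f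

theorem L_Mono (f : DComp → sQSym) (a : DComp) : L f (Mono a) = f a := by
  simp [L, Mono, Finsupp.linearCombination_single]

theorem lin_ext {f g : sQSym →ₗ[ℚ] sQSym} (h : ∀ a, f (Mono a) = g (Mono a)) : f = g := by
  apply Finsupp.lhom_ext'
  intro a
  apply LinearMap.ext_ring
  exact h a

noncomputable def prep (x : DEntry) := L (fun a => Mono (x :: a))
noncomputable def mer (x : DEntry) := L (fun a => oM (mg x a))
noncomputable def T (x : DEntry) := prep x + mer x
noncomputable def od : sQSym →ₗ[ℚ] sQSym →ₗ[ℚ] sQSym :=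
  Finsupp.linearCombination ℚ (fun a => L (fun b => oM (DComp.nearConcat a b)))

theorem od_Mono (a b : DComp) : od (Mono a) (Mono b) = oM (DComp.nearConcat a b) := by
  rw [← L_Mono (fun b => oM (DComp.nearConcat a b)) b]
  simp [od, Mono, Finsupp.linearCombination_single]

theorem odot_eq (F G : sQSym) : odot F G = od F G := by
  unfold odot od L
  rw [Finsupp.linearCombination_apply, Finsupp.sum, Finsupp.sum, LinearMap.sum_apply]
  refine Finset.sum_congr rfl fun a _ => ?_
  rw [LinearMap.smul_apply, Finsupp.linearCombination_apply, Finsupp.sum, Finsupp.sum,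
    Finset.smul_sum]
  refine Finset.sum_congr rfl fun b _ => ?_
  rw [smul_smul]
  cases DComp.nearConcat a b <;> simp [oM]

noncomputable def sg (a : DComp) : ℚ := (-1 : ℚ) ^ (a.length + Nat.choose (DComp.fdeg a) 2)

noncomputable def Sl := L (fun a => sg a • C a.reverse)

theorem antipode_eq (F : sQSym) : antipode F = Sl F := by
  unfold antipode Sl L
  rw [Finsupp.linearCombination_apply]
  refine Finset.sum_congr rfl fun a _ => ?_
  simp only [finsum_eq_C, smul_smul, sg]

theorem C_cons (x : DEntry) (r : DComp) : C (x :: r) = T x (C r) := by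
  unfold C
  rw [K]
  induction K r with
  | nil => simp
  | cons l t ih =>
    simp only [List.map_append, List.sum_append, List.map_cons, List.sum_cons, map_add] at ih ⊢
    rw [← ih]
    have : T x (Mono l) = Mono (x :: l) + oM (mg x l) := by
      simp [T, prep, mer, L_Mono]
    rw [this, List.filterMap_cons]
    cases mg x l <;> simp [oM] <;> abel

theorem C_nil : C [] = Mono [] := by simp [C, K]

theorem nc_snoc (a b : DComp) (x y : DEntry) : DComp.nearConcat (a ++ [x]) (y :: b) =
    (DEntry.add? x y).map (fun z => a ++ z :: b) := by
  simp [DComp.nearConcat]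

theorem nc_nil_left (b : DComp) : DComp.nearConcat [] b = none := by
  cases b <;> simp [DComp.nearConcat]

theorem nc_nil_right (b : DComp) : DComp.nearConcat b [] = none := by
  simp [DComp.nearConcat]

theorem nc_single (x : DEntry) (b : DComp) : DComp.nearConcat [x] b = mg x b := by
  cases b <;> simp [DComp.nearConcat, mg]

theorem nc_cons (x y : DEntry) (a b : DComp) : DComp.nearConcat (x :: y :: a) b =
    (DComp.nearConcat (y :: a) b).map (fun l => x :: l) := by
  cases b with
  | nil => simp [DComp.nearConcat]
  | cons z b =>
    obtain ⟨c, w, h⟩ : ∃ c w, y :: a = c ++ [w] :=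
      ⟨_, _, (List.dropLast_append_getLast (List.cons_ne_nil y a)).symm⟩
    rw [h, ← List.cons_append, nc_snoc, nc_snoc, Option.map_map]
    rfl

theorem nc_rev (a b : DComp) : DComp.nearConcat b.reverse a.reverse =
    (DComp.nearConcat a b).map List.reverse := by
  cases b with
  | nil => simp [nc_nil_left, nc_nil_right]
  | cons y b =>
    rcases List.eq_nil_or_concat' a with rfl | ⟨c, w, rfl⟩
    · simp [nc_nil_left, nc_nil_right]
    · rw [nc_snoc, List.reverse_cons, List.reverse_append]
      simp only [List.reverse_singleton, List.singleton_append]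
      rw [nc_snoc, add_comm', Option.map_map]
      congr 1
      funext z
      simp

theorem prep_Mono (x : DEntry) (a : DComp) : prep x (Mono a) = Mono (x :: a) := L_Mono _ _
theorem mer_Mono (x : DEntry) (a : DComp) : mer x (Mono a) = oM (mg x a) := L_Mono _ _

theorem prep_oM (x : DEntry) (o : Option DComp) :
    prep x (oM o) = oM (o.map (fun l => x :: l)) := by
  cases o <;> simp [oM, prep_Mono]

theorem mer_oM (x : DEntry) (o : Option DComp) : mer x (oM o) = oM (o.bind (mg x)) := by
  cases o <;> simp [oM, mer_Mono]

theorem od_oM (o : Option DComp) (t : DComp) :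
    od (oM o) (Mono t) = oM (o.bind (fun l => DComp.nearConcat l t)) := by
  cases o <;> simp [oM, od_Mono]

theorem mg_mg (x y : DEntry) (s : DComp) : (mg y s).bind (mg x) =
    (DEntry.add? x y).bind (fun z => mg z s) := by
  cases s with
  | nil => cases DEntry.add? x y <;> simp [mg]
  | cons w s =>
    have := congrArg (Option.map (fun z => z :: s)) (add_assoc' x y w)
    simp only [Option.map_bind] at this
    simp only [mg, Option.bind_map]
    exact this.symm

theorem nc_mg (x y : DEntry) (s t : DComp) :
    (mg x (y :: s)).bind (fun l => DComp.nearConcat l t) =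
      (DComp.nearConcat (y :: s) t).bind (mg x) := by
  cases s with
  | nil =>
    rw [nc_single, mg_mg]
    simp only [mg, Option.bind_map]
    congr 1
  | cons w s =>
    rw [nc_cons]
    simp only [mg, Option.bind_map]
    cases h : DEntry.add? x y <;> cases h' : DComp.nearConcat (w :: s) t <;>
      simp [mg, h, nc_cons, h']

theorem od_T (x : DEntry) (y : DEntry) (s t : DComp) :
    od (T x (Mono (y :: s))) (Mono t) = T x (od (Mono (y :: s)) (Mono t)) := by
  simp only [T, LinearMap.add_apply, map_add, prep_Mono, mer_Mono, od_Mono, prep_oM, mer_oM,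
    od_oM, nc_cons, nc_mg]

theorem od_TT (x y : DEntry) (w v : sQSym) : od (T x (T y w)) v = T x (od (T y w) v) := by
  have key : ∀ s t, od (T x (T y (Mono s))) (Mono t) = T x (od (T y (Mono s)) (Mono t)) := by
    intro s t
    have h : T y (Mono s) = Mono (y :: s) + oM (mg y s) := by
      simp [T, prep_Mono, mer_Mono]
    rw [h]
    simp only [map_add, LinearMap.add_apply]
    rw [od_T]
    congr 1
    cases hm : mg y s with
    | none => simp [oM]
    | some m =>
      obtain ⟨_, r, z, _, _, rfl⟩ := (mg_eq_some _ _ _).1 hm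
      exact od_T x z r t
  have h1 : ∀ s, od (T x (T y (Mono s))) = (T x) ∘ₗ (od (T y (Mono s))) :=
    fun s => lin_ext (fun t => key s t)
  have h2 : (od.flip v) ∘ₗ (T x) ∘ₗ (T y) = (T x) ∘ₗ (od.flip v) ∘ₗ (T y) :=
    lin_ext (fun s => by simpa using LinearMap.congr_fun (h1 s) v)
  simpa using LinearMap.congr_fun h2 w

theorem mer_T (x y : DEntry) (w : sQSym) : mer x (T y w) =
    (match DEntry.add? x y with
    | some z => T z w
    | none => 0) := by
  cases h : DEntry.add? x y with
  | none =>
    have : mer x ∘ₗ T y = 0 := lin_ext (fun s => by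
      simp only [T, LinearMap.comp_apply, LinearMap.add_apply, map_add, prep_Mono, mer_Mono,
        mer_oM, mg_mg, h]
      simp [mg, h, oM])
    simpa using LinearMap.congr_fun this w
  | some z =>
    have : mer x ∘ₗ T y = T z := lin_ext (fun s => by
      simp only [T, LinearMap.comp_apply, LinearMap.add_apply, map_add, prep_Mono, mer_Mono,
        mer_oM, mg_mg, h]
      simp [mg, h, oM])
    simpa using LinearMap.congr_fun this w

theorem od_nil_left (v : sQSym) : od (Mono []) v = 0 := by
  have : od (Mono []) = 0 := lin_ext (fun s => by simp [od_Mono, nc_nil_left, oM])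
  simp [this]

theorem od_single (x : DEntry) (v : sQSym) : od (Mono [x]) v = mer x v := by
  have : od (Mono [x]) = mer x := lin_ext (fun s => by simp [od_Mono, nc_single, mer_Mono])
  simp [this]

theorem L_C_prep (x : DEntry) (o : Option DComp) :
    L C (oM (o.map (fun l => x :: l))) = T x (L C (oM o)) := by
  cases o <;> simp [oM, L_Mono, C_cons]

theorem C_odot (a b : DComp) : L C (oM (DComp.nearConcat a b)) = od (C a) (C b) := by
  induction a with
  | nil => simp [C_nil, od_nil_left, nc_nil_left, oM]
  | cons x a ih =>
    cases a with
    | nil =>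
      have : C [x] = Mono [x] := by
        rw [C_cons, C_nil]; simp [T, prep_Mono, mer_Mono, mg, oM]
      rw [this, od_single, nc_single]
      cases b with
      | nil => simp [C_nil, mer_Mono, mg, oM]
      | cons y r =>
        rw [C_cons, mer_T, mg]
        cases DEntry.add? x y <;> simp [oM, L_Mono, C_cons]
    | cons y a =>
      rw [nc_cons, L_C_prep, ih, C_cons x, C_cons y, od_TT]

theorem nc_stats (a b c : DComp) (h : DComp.nearConcat a b = some c) :
    c.length + 1 = a.length + b.length ∧ DComp.fdeg c = DComp.fdeg a + DComp.fdeg b := by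
  cases b with
  | nil => simp [nc_nil_right] at h
  | cons y b =>
    rcases List.eq_nil_or_concat' a with rfl | ⟨d, w, rfl⟩
    · simp [nc_nil_left] at h
    · rw [nc_snoc, Option.map_eq_some_iff] at h
      obtain ⟨z, h, rfl⟩ := h
      constructor
      · simp; omega
      · cases w <;> cases y <;> simp [DEntry.add?] at h <;> subst h <;>
          simp [DComp.fdeg, List.filter_cons, DEntry.isDot] <;> omega

theorem sg_mul (a b c : DComp) (h : DComp.nearConcat a b = some c) :
    sg c = (-1 : ℚ) ^ ((DComp.fdeg a * DComp.fdeg b : ℤ) - 1) * (sg b * sg a) := by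
  obtain ⟨h1, h2⟩ := nc_stats a b c h
  have h3 : ∀ m n : ℕ, (m + n).choose 2 = m.choose 2 + n.choose 2 + m * n := by
    intro m n
    rw [Nat.add_choose_eq]
    simp [Finset.antidiagonal, Finset.Nat.antidiagonal_succ]
    ring
  have h4 : sg c = - (-1 : ℚ) ^ (c.length + 1 + Nat.choose (DComp.fdeg c) 2) := by
    unfold sg; ring
  rw [h4, h1, h2, h3, zpow_sub_one₀ (by norm_num)]
  have : ((DComp.fdeg a * DComp.fdeg b : ℤ)) = ((DComp.fdeg a * DComp.fdeg b : ℕ) : ℤ) := by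
    push_cast; rfl
  rw [this, zpow_natCast]
  unfold sg
  rw [show ((-1 : ℚ))⁻¹ = -1 by norm_num]
  ring

theorem main_Mono (a b : DComp) : Sl (od (Mono a) (Mono b)) =
    ((-1 : ℚ) ^ ((DComp.fdeg a * DComp.fdeg b : ℤ) - 1)) • od (Sl (Mono b)) (Sl (Mono a)) := by
  rw [od_Mono]
  simp only [Sl, L_Mono, map_smul, LinearMap.smul_apply]
  rw [← C_odot, nc_rev]
  cases h : DComp.nearConcat a b with
  | none => simp [oM]
  | some c =>
    simp only [oM, Option.map_some, L_Mono, smul_smul]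
    rw [sg_mul a b c h]
    ring_nf

end AntipodeAux

/-- For `F, G ∈ sQSym` homogeneous in the fermionic degree, of
fermionic degrees `m_F` and `m_G` respectively,
`S(F ⊙ G) = (−1)^{m_F m_G − 1} S(G) ⊙ S(F)`. -/
theorem antipode_odot (F G : sQSym) (mF mG : ℕ)
    (hF : F ∈ Submodule.span ℚ (Mono '' {α | DComp.fdeg α = mF}))
    (hG : G ∈ Submodule.span ℚ (Mono '' {α | DComp.fdeg α = mG})) :
    antipode (odot F G) =
      ((-1 : ℚ) ^ ((mF * mG : ℤ) - 1)) • odot (antipode G) (antipode F) := by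
  rw [AntipodeAux.odot_eq, AntipodeAux.odot_eq, AntipodeAux.antipode_eq,
    AntipodeAux.antipode_eq, AntipodeAux.antipode_eq]
  induction hF using Submodule.span_induction with
  | zero => simp
  | add x y _ _ hx hy => simp only [map_add, LinearMap.add_apply, hx, hy, smul_add]
  | smul c x _ hx => simp only [map_smul, LinearMap.smul_apply, hx, smul_comm c]
  | mem x hx =>
    obtain ⟨a, rfl, rfl⟩ := hx
    induction hG using Submodule.span_induction with
    | zero => simp
    | add x y _ _ hx hy => simp only [map_add, LinearMap.add_apply, hx, hy, smul_add]
    | smul c x _ hx => simp only [map_smul, LinearMap.smul_apply, hx, smul_comm c]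
    | mem x hx =>
      obtain ⟨b, rfl, rfl⟩ := hx
      exact AntipodeAux.main_Mono a b
end

section
/- Let α and β be dotted compositions such that the last entry of α and the first entry of β are both undotted, and let m_α, m_β be their fermionic degrees. Then S(L_{α⊙β}) = (−1)^{m_α m_β} S(L_β) • S(L_α). -/
namespace SQ
open Relation

def GCover (f : DEntry → DEntry → Option DEntry) (β α : DComp) : Prop :=
  ∃ (l r : DComp) (x y z : DEntry),
    β = l ++ x :: y :: r ∧ f x y = some z ∧ α = l ++ z :: r

def sadd : DEntry → DEntry → Option DEntry
  | DEntry.undot a, DEntry.undot b => some (DEntry.undot (a + b))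
  | _, _ => none

abbrev GLe (f : DEntry → DEntry → Option DEntry) : DComp → DComp → Prop :=
  ReflTransGen (GCover f)

theorem weakLe_eq : DComp.WeakLe = GLe DEntry.add? := rfl

theorem strongCover_eq : DComp.StrongCover = GCover sadd := by
  funext β α
  apply propext
  constructor
  · rintro ⟨l, r, a, b, h1, h2⟩
    exact ⟨l, r, _, _, _, h1, rfl, h2⟩
  · rintro ⟨l, r, x, y, z, h1, h, h2⟩
    cases x <;> cases y <;> simp [sadd] at h
    subst h
    exact ⟨l, r, _, _, h1, h2⟩

theorem strongLe_eq : DComp.StrongLe = GLe sadd := by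
  unfold DComp.StrongLe GLe
  rw [strongCover_eq]

theorem split2 {l r A B : DComp} {x y : DEntry} (h : l ++ x :: y :: r = A ++ B) :
    (∃ r', A = l ++ x :: y :: r' ∧ r = r' ++ B) ∨
    (∃ l', l = A ++ l' ∧ B = l' ++ x :: y :: r) ∨ (A = l ++ [x] ∧ B = y :: r) := by
  rw [List.append_eq_append_iff] at h
  rcases h with ⟨as, h1, h2⟩ | ⟨cs, h1, h2⟩
  · rcases as with _ | ⟨u, _ | ⟨v, as⟩⟩
    · right; left; exact ⟨[], by simpa using h1.symm, by simpa using h2.symm⟩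
    · simp at h2; right; right; rw [h1, h2.1, h2.2]; simp
    · simp at h2; left; exact ⟨as, by rw [h1, h2.1, h2.2.1], h2.2.2⟩
  · right; left; exact ⟨cs, h1, h2⟩

theorem split1 {l r A B : DComp} {z : DEntry} (h : l ++ z :: r = A ++ B) :
    (∃ r', A = l ++ z :: r' ∧ r = r' ++ B) ∨
    (∃ l', l = A ++ l' ∧ B = l' ++ z :: r) := by
  rw [List.append_eq_append_iff] at h
  rcases h with ⟨as, h1, h2⟩ | ⟨cs, h1, h2⟩
  · rcases as with _ | ⟨u, as⟩
    · right; exact ⟨[], by simpa using h1.symm, by simpa using h2.symm⟩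
    · simp at h2; left; exact ⟨as, by rw [h1, h2.1], h2.2⟩
  · right; exact ⟨cs, h1, h2⟩

section
variable {f : DEntry → DEntry → Option DEntry}

theorem GCover.mono {a b : DComp} (h : GCover f a b) (l r : DComp) :
    GCover f (l ++ (a ++ r)) (l ++ (b ++ r)) := by
  obtain ⟨l', r', x, y, z, rfl, h, rfl⟩ := h
  exact ⟨l ++ l', r' ++ r, x, y, z, by simp, h, by simp⟩

theorem GLe.mono {a b : DComp} (h : GLe f a b) (l r : DComp) :
    GLe f (l ++ (a ++ r)) (l ++ (b ++ r)) :=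
  ReflTransGen.lift (p := GCover f) (fun a => l ++ (a ++ r)) (fun _ _ h => GCover.mono h l r) _ _ h

theorem GLe.append {a b c d : DComp} (h : GLe f a b) (h' : GLe f c d) :
    GLe f (a ++ c) (b ++ d) := by
  have h1 := GLe.mono h [] c
  have h2 := GLe.mono h' b []
  simp only [List.nil_append, List.append_nil] at h1 h2
  exact h1.trans h2

def AssocR (f : DEntry → DEntry → Option DEntry) : Prop :=
  ∀ w u s y t, f w u = some s → f s y = some t → ∃ v, f u y = some v ∧ f w v = some t

def AssocL (f : DEntry → DEntry → Option DEntry) : Prop :=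
  ∀ w u s y t, f u w = some s → f y s = some t → ∃ v, f y u = some v ∧ f v w = some t

theorem lem1 (hf : AssocR f) {A ρ : DComp} {x y z : DEntry} (R : DComp)
    (h : GLe f A (ρ ++ [x])) (hz : f x y = some z) :
    ∀ N u, A = N ++ [u] → ∃ z', f u y = some z' ∧ GLe f (N ++ z' :: R) (ρ ++ z :: R) := by
  induction h using ReflTransGen.head_induction_on with
  | refl =>
    intro N u h
    have h := List.append_inj' h rfl
    simp at h
    obtain ⟨rfl, rfl⟩ := h
    exact ⟨z, hz, .refl⟩
  | head hc _ ih =>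
    obtain ⟨l, r, p, q, s, h1, hs, h2⟩ := hc
    intro N u h
    rw [h1] at h
    rcases split2 h with ⟨r', rfl, rfl⟩ | ⟨l', rfl, h3⟩ | ⟨rfl, h3⟩
    · obtain ⟨z', h4, h5⟩ := ih (l ++ s :: r') u (by simp [h2])
      refine ⟨z', h4, .head ?_ h5⟩
      exact ⟨l, r' ++ z' :: R, p, q, s, by simp, hs, by simp⟩
    · have := congrArg List.length h3
      simp at this
      omega
    · simp at h3
      obtain ⟨rfl, rfl⟩ := h3
      obtain ⟨z', h4, h5⟩ := ih l s h2
      obtain ⟨v, hv1, hv2⟩ := hf _ _ _ _ _ hs h4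
      exact ⟨v, hv1, .head ⟨l, R, p, v, z', by simp, hv2, rfl⟩ h5⟩

theorem lem2 (hf : AssocL f) {A ρ : DComp} {x y z : DEntry} (R : DComp)
    (h : GLe f A (x :: ρ)) (hz : f y x = some z) :
    ∀ N u, A = u :: N → ∃ z', f y u = some z' ∧ GLe f (R ++ z' :: N) (R ++ z :: ρ) := by
  induction h using ReflTransGen.head_induction_on with
  | refl =>
    intro N u h
    simp at h
    obtain ⟨rfl, rfl⟩ := h
    exact ⟨z, hz, .refl⟩
  | head hc _ ih =>
    obtain ⟨l, r, p, q, s, h1, hs, h2⟩ := hc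
    intro N u h
    rw [h1] at h
    rcases l with _ | ⟨a, l⟩
    · simp at h
      obtain ⟨rfl, rfl⟩ := h
      obtain ⟨z', h4, h5⟩ := ih r s (by simpa using h2)
      obtain ⟨v, hv1, hv2⟩ := hf _ _ _ _ _ hs h4
      exact ⟨v, hv1, .head ⟨R, r, v, q, z', by simp, hv2, rfl⟩ h5⟩
    · simp at h
      obtain ⟨rfl, rfl⟩ := h
      obtain ⟨z', h4, h5⟩ := ih (l ++ s :: r) a (by simp [h2])
      refine ⟨z', h4, .head ?_ h5⟩
      exact ⟨R ++ z' :: l, r, p, q, s, by simp, hs, by simp⟩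

theorem lem12 (hf : AssocR f) (hf' : AssocL f) {N M ρ σ : DComp} {u v x y z : DEntry}
    (h1 : GLe f (N ++ [u]) (ρ ++ [x])) (h2 : GLe f (v :: M) (y :: σ)) (hz : f x y = some z) :
    ∃ w, f u v = some w ∧ GLe f (N ++ w :: M) (ρ ++ z :: σ) := by
  obtain ⟨z', h3, h4⟩ := lem1 hf σ h1 hz N u rfl
  obtain ⟨w, h5, h6⟩ := lem2 hf' N h2 h3 M v rfl
  exact ⟨w, h5, h6.trans h4⟩
end

theorem assocR_add : AssocR DEntry.add? := by
  intro w u s y t h1 h2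
  cases w <;> cases u <;> simp [DEntry.add?] at h1 <;> subst h1 <;> cases y <;>
    simp [DEntry.add?] at h2 <;> subst h2 <;> simp [DEntry.add?, add_assoc]

theorem assocL_add : AssocL DEntry.add? := by
  intro w u s y t h1 h2
  cases w <;> cases u <;> simp [DEntry.add?] at h1 <;> subst h1 <;> cases y <;>
    simp [DEntry.add?] at h2 <;> subst h2 <;> simp [DEntry.add?, add_assoc]

theorem assocR_sadd : AssocR sadd := by
  intro w u s y t h1 h2
  cases w <;> cases u <;> simp [sadd] at h1 <;> subst h1 <;> cases y <;>
    simp [sadd] at h2 <;> subst h2 <;> simp [sadd, add_assoc]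

theorem assocL_sadd : AssocL sadd := by
  intro w u s y t h1 h2
  cases w <;> cases u <;> simp [sadd] at h1 <;> subst h1 <;> cases y <;>
    simp [sadd] at h2 <;> subst h2 <;> simp [sadd, add_assoc]

theorem weak_iff (N M γ : DComp) (p q : ℕ+) :
    GLe DEntry.add? (N ++ DEntry.undot p :: DEntry.undot q :: M) γ ↔
    (∃ ρ σ, GLe DEntry.add? (N ++ [DEntry.undot p]) ρ ∧ GLe DEntry.add? (DEntry.undot q :: M) σ ∧
      γ = ρ ++ σ) ∨ GLe DEntry.add? (N ++ DEntry.undot (p + q) :: M) γ := by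
  constructor
  · intro h
    induction h with
    | refl => exact .inl ⟨_, _, .refl, .refl, by simp⟩
    | tail _ hc ih =>
      rcases ih with ⟨ρ, σ, h1, h2, h3⟩ | ih
      · obtain ⟨l, r, x, y, z, h4, hz, rfl⟩ := hc
        rw [h4] at h3
        rcases split2 h3 with ⟨r', rfl, rfl⟩ | ⟨l', rfl, rfl⟩ | ⟨rfl, rfl⟩
        · left
          exact ⟨l ++ z :: r', σ, h1.tail ⟨l, r', x, y, z, rfl, hz, rfl⟩, h2, by simp⟩
        · left
          exact ⟨ρ, l' ++ z :: r, h1, h2.tail ⟨l', r, x, y, z, rfl, hz, rfl⟩, by simp⟩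
        · right
          obtain ⟨w, hw, h⟩ := lem12 assocR_add assocL_add h1 h2 hz
          simp [DEntry.add?] at hw
          subst hw
          exact h
      · right; exact ih.tail hc
  · rintro (⟨ρ, σ, h1, h2, rfl⟩ | h)
    · have := GLe.append h1 h2
      simpa using this
    · exact .head ⟨N, M, _, _, _, rfl, rfl, rfl⟩ h

theorem strong_iff (N M δ : DComp) (a b : ℕ+) :
    GLe sadd δ (N ++ DEntry.undot (a + b) :: M) ↔
    (∃ μ ν, GLe sadd μ (N ++ [DEntry.undot a]) ∧ GLe sadd ν (DEntry.undot b :: M) ∧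
      δ = μ ++ ν) ∨
    (∃ μ ν p q, GLe sadd (μ ++ [DEntry.undot p]) (N ++ [DEntry.undot a]) ∧
      GLe sadd (DEntry.undot q :: ν) (DEntry.undot b :: M) ∧
      δ = μ ++ DEntry.undot (p + q) :: ν) := by
  constructor
  · intro h
    induction h using ReflTransGen.head_induction_on with
    | refl => exact .inr ⟨_, _, _, _, .refl, .refl, by simp⟩
    | head hc _ ih =>
      obtain ⟨l, r, x, y, z, h1, hz, h2⟩ := hc
      rcases ih with ⟨μ, ν, h4, h5, h3⟩ | ⟨μ, ν, p, q, h4, h5, h3⟩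
      · left
        rw [h2] at h3
        rcases split1 h3 with ⟨r', rfl, rfl⟩ | ⟨l', rfl, rfl⟩
        · exact ⟨l ++ x :: y :: r', ν, .head ⟨l, r', x, y, z, rfl, hz, rfl⟩ h4, h5, by simp [h1]⟩
        · exact ⟨μ, l' ++ x :: y :: r, h4, .head ⟨l', r, x, y, z, rfl, hz, rfl⟩ h5, by simp [h1]⟩
      · rw [h2] at h3
        rcases split1 h3 with ⟨r', rfl, rfl⟩ | ⟨l', rfl, h6⟩
        · right
          exact ⟨l ++ x :: y :: r', ν, p, q, .head ⟨l, r' ++ [DEntry.undot p], x, y, z, by simp, hz, by simp⟩ h4, h5, by simp [h1]⟩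
        · rcases l' with _ | ⟨e, l'⟩
          · simp at h6
            obtain ⟨rfl, rfl⟩ := h6
            cases x with
            | dot _ => simp [sadd] at hz
            | undot c =>
            cases y with
            | dot _ => simp [sadd] at hz
            | undot d =>
            simp [sadd] at hz
            rcases lt_trichotomy c p with hcp | rfl | hcp
            · obtain ⟨e, rfl⟩ : ∃ e, p = c + e := ⟨p - c, (PNat.add_sub_of_lt hcp).symm⟩
              right
              refine ⟨μ ++ [DEntry.undot c], ν, e, q, .head ⟨μ, [], _, _, _, by simp; exact ⟨rfl, rfl⟩, rfl, rfl⟩ h4, h5, ?_⟩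
              rw [add_assoc] at hz
              simp [h1, add_left_cancel hz]
            · left
              refine ⟨_, _, h4, h5, ?_⟩
              simp [h1, add_left_cancel hz]
            · obtain ⟨e, rfl⟩ : ∃ e, c = p + e := ⟨c - p, (PNat.add_sub_of_lt hcp).symm⟩
              right
              rw [add_assoc] at hz
              have hz := add_left_cancel hz
              subst hz
              exact ⟨μ, DEntry.undot d :: ν, p, e, h4, .head ⟨[], ν, _, _, _, rfl, rfl, rfl⟩ h5, by simp [h1]⟩
          · simp at h6
            obtain ⟨rfl, rfl⟩ := h6
            right
            exact ⟨μ, l' ++ x :: y :: r, p, q, h4, .head ⟨DEntry.undot q :: l', r, x, y, z, rfl, hz, rfl⟩ h5, by simp [h1]⟩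
  · rintro (⟨μ, ν, h1, h2, rfl⟩ | ⟨μ, ν, p, q, h1, h2, rfl⟩)
    · refine (GLe.append h1 h2).tail ⟨N, M, _, _, _, by simp; exact ⟨rfl, rfl⟩, rfl, rfl⟩
    · obtain ⟨w, hw, h⟩ := lem12 assocR_sadd assocL_sadd h1 h2 (z := DEntry.undot (a + b)) rfl
      simp [sadd] at hw
      subst hw
      exact h

open DComp

theorem deg_append (a b : DComp) : deg (a ++ b) = deg a + deg b := by simp [deg]
theorem deg_cons (e : DEntry) (b : DComp) : deg (e :: b) = e.val + deg b := by simp [deg]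
theorem deg_nil : deg [] = 0 := rfl
theorem fdeg_append (a b : DComp) : fdeg (a ++ b) = fdeg a + fdeg b := by simp [fdeg]
theorem fdeg_cons (e : DEntry) (b : DComp) :
    fdeg (e :: b) = (if e.isDot then 1 else 0) + fdeg b := by
  unfold fdeg; rw [List.filter_cons]; split <;> simp [add_comm]
theorem fdeg_nil : fdeg [] = 0 := rfl
theorem fdeg_reverse (a : DComp) : fdeg a.reverse = fdeg a := by simp [fdeg]

theorem cover_inv_s6 {β α : DComp} (h : WeakCover β α) : deg β = deg α ∧ fdeg β = fdeg α := by
  obtain ⟨l, r, x, y, z, rfl, h, rfl⟩ := h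
  simp only [deg_append, deg_cons, fdeg_append, fdeg_cons]
  cases x <;> cases y <;> simp [DEntry.add?] at h <;> subst h <;>
    simp [DEntry.val, DEntry.isDot] <;> omega

theorem le_inv {β α : DComp} (h : GLe DEntry.add? β α) : deg β = deg α ∧ fdeg β = fdeg α := by
  induction h with
  | refl => exact ⟨rfl, rfl⟩
  | tail _ h ih => have := cover_inv_s6 h; omega

theorem sle_le {β α : DComp} (h : GLe sadd β α) : GLe DEntry.add? β α := by
  refine ReflTransGen.mono ?_ _ _ h
  rintro β α ⟨l, r, x, y, z, h1, h, h2⟩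
  refine ⟨l, r, x, y, z, h1, ?_, h2⟩
  cases x <;> cases y <;> simp [sadd] at h
  simp [DEntry.add?, h]

def Bd (d : ℕ) (γ : DComp) : Prop := ∃ ρ σ, γ = ρ ++ σ ∧ deg ρ = d

theorem Bd.refine {d : ℕ} {β α : DComp} (h : GLe DEntry.add? β α) (hb : Bd d α) : Bd d β := by
  induction h using ReflTransGen.head_induction_on with
  | refl => exact hb
  | head hc _ ih =>
    obtain ⟨l, r, x, y, z, h1, h, h2⟩ := hc
    obtain ⟨ρ, σ, h3, h4⟩ := ih
    rw [h2] at h3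
    rcases split1 h3 with ⟨r', rfl, rfl⟩ | ⟨l', rfl, rfl⟩
    · refine ⟨l ++ x :: y :: r', σ, by simp [h1], ?_⟩
      rw [← h4]
      exact (cover_inv_s6 ⟨l, r', x, y, z, rfl, h, rfl⟩).1
    · exact ⟨ρ, l' ++ x :: y :: r, by simp [h1], h4⟩

theorem not_bd (N M : DComp) (p q : ℕ+) : ¬ Bd (deg N + p) (N ++ DEntry.undot (p + q) :: M) := by
  rintro ⟨ρ, σ, h, hd⟩
  have hp := p.pos
  have hq := q.pos
  rcases split1 h with ⟨r', rfl, rfl⟩ | ⟨l', rfl, rfl⟩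
  · simp [deg_append, deg_cons, DEntry.val] at hd
    omega
  · simp [deg_append] at hd
    omega

theorem zero_nil {a : DComp} (h : deg a = 0) (h' : fdeg a = 0) : a = [] := by
  cases a with
  | nil => rfl
  | cons e a =>
    rw [deg_cons] at h
    rw [fdeg_cons] at h'
    cases e with
    | undot p => have := p.pos; simp [DEntry.val] at h
    | dot p => simp [DEntry.isDot] at h'

theorem app_inj_s6 {a b c d : DComp} (h : a ++ b = c ++ d) (h1 : deg a = deg c)
    (h2 : fdeg a = fdeg c) : a = c ∧ b = d := by
  rw [List.append_eq_append_iff] at h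
  rcases h with ⟨as, rfl, rfl⟩ | ⟨as, rfl, rfl⟩ <;> 
  · rw [deg_append] at h1
    rw [fdeg_append] at h2
    have : as = [] := zero_nil (by omega) (by omega)
    subst this
    simp

theorem nc_inj {μ ν μ' ν' : DComp} {p q p' q' : ℕ+}
    (h : μ ++ DEntry.undot (p + q) :: ν = μ' ++ DEntry.undot (p' + q') :: ν')
    (h1 : deg μ + p = deg μ' + p') : μ = μ' ∧ p = p' ∧ q = q' ∧ ν = ν' := by
  have hp := p.pos
  have hq := q.pos
  have hp' := p'.pos
  have hq' := q'.pos
  rcases split1 h with ⟨r', rfl, rfl⟩ | ⟨l', rfl, h3⟩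
  · simp [deg_append, deg_cons, DEntry.val] at h1
    omega
  · cases l' with
    | nil =>
      simp [deg_append, deg_nil] at h1 h3
      obtain ⟨h3, rfl⟩ := h3
      subst h1
      simp at h3
      simp [h3]
    | cons e l' =>
      simp at h3
      obtain ⟨rfl, rfl⟩ := h3
      simp [deg_append, deg_cons, DEntry.val] at h1
      omega

theorem shape_last {μ N : DComp} {a : ℕ+} (h : GLe sadd μ (N ++ [DEntry.undot a])) :
    ∃ μ' p, μ = μ' ++ [DEntry.undot p] := by
  induction h using ReflTransGen.head_induction_on with
  | refl => exact ⟨_, _, rfl⟩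
  | head hc _ ih =>
    obtain ⟨l, r, x, y, z, h1, h, h2⟩ := hc
    obtain ⟨μ', p, h3⟩ := ih
    rcases List.eq_nil_or_concat r with rfl | ⟨r, e, rfl⟩
    · cases x <;> cases y <;> simp [sadd] at h
      rename_i x y
      exact ⟨l ++ [DEntry.undot x], y, by simp [h1]⟩
    · rw [h2] at h3
      have h3 : (l ++ z :: r) ++ [e] = μ' ++ [DEntry.undot p] := by simpa using h3
      have := List.append_inj' h3 rfl
      simp at this
      exact ⟨l ++ x :: y :: r, p, by simp [h1, this.2]⟩

theorem shape_head {μ N : DComp} {a : ℕ+} (h : GLe sadd μ (DEntry.undot a :: N)) :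
    ∃ μ' p, μ = DEntry.undot p :: μ' := by
  induction h using ReflTransGen.head_induction_on with
  | refl => exact ⟨_, _, rfl⟩
  | head hc _ ih =>
    obtain ⟨l, r, x, y, z, h1, h, h2⟩ := hc
    obtain ⟨μ', p, h3⟩ := ih
    cases l with
    | nil =>
      cases x <;> cases y <;> simp [sadd] at h
      exact ⟨_, _, h1⟩
    | cons e l =>
      rw [h2] at h3
      simp at h3
      exact ⟨l ++ x :: y :: r, p, by simp [h1, h3.1]⟩

theorem len_le (a : DComp) : a.length ≤ deg a + fdeg a := by
  induction a with
  | nil => simp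
  | cons e a ih =>
    rw [deg_cons, fdeg_cons]
    cases e with
    | undot p => have := p.pos; simp [DEntry.val, DEntry.isDot]; omega
    | dot p => simp [DEntry.isDot]; omega

theorem fin_ent (d : ℕ) : {e : DEntry | e.val ≤ d}.Finite := by
  have h1 : ((fun n : ℕ => DEntry.dot n) '' Set.Iic d).Finite := (Set.finite_Iic d).image _
  have h2 : ((fun n : ℕ => DEntry.undot n.succPNat) '' Set.Iic d).Finite :=
    (Set.finite_Iic d).image _
  refine (h1.union h2).subset ?_
  intro e he
  cases e with
  | undot p =>
    right
    refine ⟨p.natPred, ?_, by simp⟩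
    have := p.natPred_add_one
    simp [DEntry.val] at he ⊢
    omega
  | dot n => left; exact ⟨n, he, rfl⟩

theorem fin_len (d n : ℕ) : {a : DComp | deg a ≤ d ∧ a.length ≤ n}.Finite := by
  induction n with
  | zero =>
    refine (Set.finite_singleton ([] : DComp)).subset ?_
    rintro a ⟨_, h⟩
    simpa using h
  | succ n ih =>
    refine ((Set.finite_singleton ([] : DComp)).union
      (Set.Finite.image2 List.cons (fin_ent d) ih)).subset ?_
    rintro a ⟨h1, h2⟩
    cases a with
    | nil => simp
    | cons e a =>
      right
      rw [deg_cons] at h1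
      simp at h2
      exact ⟨e, by simp; omega, a, ⟨by omega, h2⟩, rfl⟩

theorem fin_weak (ν : DComp) : {γ | WeakLe ν γ}.Finite := by
  refine (fin_len (deg ν) (deg ν + fdeg ν)).subset ?_
  intro γ h
  have h1 := le_inv h
  have := len_le γ
  exact ⟨by omega, by omega⟩

theorem fin_strong (α : DComp) : {δ | StrongLe δ α}.Finite := by
  refine (fin_len (deg α) (deg α + fdeg α)).subset ?_
  intro γ h
  rw [strongLe_eq] at h
  have h1 := le_inv (sle_le h)
  have := len_le γ
  exact ⟨by omega, by omega⟩

noncomputable def W (ν : DComp) : sQSym := ∑ γ ∈ (fin_weak ν).toFinset, Mono γ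

theorem W_eq (ν : DComp) : ∑ᶠ γ ∈ {γ | WeakLe ν γ}, Mono γ = W ν :=
  finsum_mem_eq_finite_toFinset_sum _ (fin_weak ν)

theorem Fund_eq (α : DComp) : Fund α = ∑ δ ∈ (fin_strong α).toFinset, Mono δ :=
  finsum_mem_eq_finite_toFinset_sum _ (fin_strong α)

noncomputable def sgn (α : DComp) : ℚ := (-1 : ℚ) ^ (α.length + Nat.choose (DComp.fdeg α) 2)

noncomputable def SL : sQSym →ₗ[ℚ] sQSym :=
  Finsupp.linearCombination ℚ (fun α : DComp => sgn α • W α.reverse)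

noncomputable def CL : sQSym →ₗ[ℚ] sQSym →ₗ[ℚ] sQSym :=
  Finsupp.linearCombination ℚ (fun α : DComp =>
    Finsupp.linearCombination ℚ (fun β : DComp => Mono (α ++ β)))

theorem antipode_eq (F : sQSym) : antipode F = SL F := by
  unfold antipode SL
  rw [Finsupp.linearCombination_apply]
  simp only [W_eq, mul_smul, sgn]

theorem cdot_eq_s6 (F G : sQSym) : cdot F G = CL F G := by
  unfold cdot CL
  rw [Finsupp.linearCombination_apply, Finsupp.sum, Finsupp.sum, LinearMap.sum_apply]
  refine Finset.sum_congr rfl fun α _ => ?_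
  rw [LinearMap.smul_apply, Finsupp.linearCombination_apply, Finsupp.smul_sum]
  simp only [mul_smul]

theorem SL_mono (α : DComp) : SL (Mono α) = sgn α • W α.reverse := by
  simp [SL, Mono]

theorem CL_mono (α β : DComp) : CL (Mono α) (Mono β) = Mono (α ++ β) := by
  simp [CL, Mono]

theorem W_split (N M : DComp) (p q : ℕ+) :
    W (N ++ DEntry.undot p :: DEntry.undot q :: M) =
      CL (W (N ++ [DEntry.undot p])) (W (DEntry.undot q :: M)) +
      W (N ++ DEntry.undot (p + q) :: M) := by
  have hC : CL (W (N ++ [DEntry.undot p])) (W (DEntry.undot q :: M)) =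
      ∑ γ ∈ ((fin_weak (N ++ [DEntry.undot p])).toFinset ×ˢ
        (fin_weak (DEntry.undot q :: M)).toFinset).image (fun x => x.1 ++ x.2), Mono γ := by
    rw [Finset.sum_image, Finset.sum_product]
    · simp only [W, map_sum, LinearMap.sum_apply, CL_mono]
      try rw [Finset.sum_comm]
    · rintro ⟨a, b⟩ h1 ⟨c, d⟩ h2 h
      simp at h1 h2 h
      have h3 := le_inv h1.1
      have h4 := le_inv h2.1
      have := app_inj_s6 h (by omega) (by omega)
      simp [this]
  rw [hC]
  unfold W
  rw [← Finset.sum_union]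
  · refine Finset.sum_congr ?_ fun _ _ => rfl
    ext γ
    simp only [Set.Finite.mem_toFinset, Set.mem_ofPred_eq, Finset.mem_union, Finset.mem_image,
      Finset.mem_product, Prod.exists]
    rw [weakLe_eq, weak_iff]
    simp only [and_assoc, eq_comm]
  · rw [Finset.disjoint_left]
    intro γ h1 h2
    simp only [Set.Finite.mem_toFinset, Set.mem_ofPred_eq, Finset.mem_image,
      Finset.mem_product, Prod.exists] at h1 h2
    obtain ⟨ρ, σ, ⟨h3, h4⟩, rfl⟩ := h1
    refine not_bd N M p q (Bd.refine h2 ⟨ρ, σ, rfl, ?_⟩)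
    have := (le_inv h3).1
    simp [deg_append, deg_cons, deg_nil, DEntry.val] at this
    exact this.symm

noncomputable def nc (μ ν : DComp) : DComp := (nearConcat μ ν).getD []

theorem nc_eq (μ ν : DComp) (p q : ℕ+) :
    nc (μ ++ [DEntry.undot p]) (DEntry.undot q :: ν) = μ ++ DEntry.undot (p + q) :: ν := by
  simp [nc, nearConcat, DEntry.add?]

theorem Fund_split (N M : DComp) (a b : ℕ+) :
    Fund (N ++ DEntry.undot (a + b) :: M) =
      ∑ x ∈ (fin_strong (N ++ [DEntry.undot a])).toFinset ×ˢ
        (fin_strong (DEntry.undot b :: M)).toFinset, (Mono (x.1 ++ x.2) + Mono (nc x.1 x.2)) := by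
  rw [Finset.sum_add_distrib, Fund_eq]
  have e1 : ∑ x ∈ (fin_strong (N ++ [DEntry.undot a])).toFinset ×ˢ
        (fin_strong (DEntry.undot b :: M)).toFinset, Mono (x.1 ++ x.2) =
      ∑ γ ∈ ((fin_strong (N ++ [DEntry.undot a])).toFinset ×ˢ
        (fin_strong (DEntry.undot b :: M)).toFinset).image (fun x => x.1 ++ x.2), Mono γ := by
    rw [Finset.sum_image]
    rintro ⟨a, b⟩ h1 ⟨c, d⟩ h2 h
    simp [strongLe_eq] at h1 h2 h
    have h3 := le_inv (sle_le h1.1)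
    have h4 := le_inv (sle_le h2.1)
    have := app_inj_s6 h (by omega) (by omega)
    simp [this]
  have e2 : ∑ x ∈ (fin_strong (N ++ [DEntry.undot a])).toFinset ×ˢ
        (fin_strong (DEntry.undot b :: M)).toFinset, Mono (nc x.1 x.2) =
      ∑ γ ∈ ((fin_strong (N ++ [DEntry.undot a])).toFinset ×ˢ
        (fin_strong (DEntry.undot b :: M)).toFinset).image (fun x => nc x.1 x.2), Mono γ := by
    rw [Finset.sum_image]
    rintro ⟨a, b⟩ h1 ⟨c, d⟩ h2 h
    simp [strongLe_eq] at h1 h2 h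
    have h3 := le_inv (sle_le h1.1)
    have h4 := le_inv (sle_le h2.1)
    obtain ⟨a, p, rfl⟩ := shape_last h1.1
    obtain ⟨c, p', rfl⟩ := shape_last h2.1
    obtain ⟨b, q, rfl⟩ := shape_head h1.2
    obtain ⟨d, q', rfl⟩ := shape_head h2.2
    rw [nc_eq, nc_eq] at h
    have := nc_inj h (by
      have := h3.1.trans h4.1.symm
      simpa [deg_append, deg_cons, deg_nil, DEntry.val] using this)
    simp [this]
  rw [e1, e2, ← Finset.sum_union]
  · refine Finset.sum_congr ?_ fun _ _ => rfl
    ext γ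
    simp only [Set.Finite.mem_toFinset, Set.mem_ofPred_eq, Finset.mem_union, Finset.mem_image,
      Finset.mem_product, Prod.exists]
    rw [strongLe_eq, strong_iff]
    apply or_congr
    · simp only [and_assoc, eq_comm]
    · constructor
      · rintro ⟨μ, ν, p, q, h1, h2, rfl⟩
        exact ⟨_, _, ⟨h1, h2⟩, nc_eq _ _ _ _⟩
      · rintro ⟨μ, ν, ⟨h1, h2⟩, rfl⟩
        obtain ⟨μ, p, rfl⟩ := shape_last h1
        obtain ⟨ν, q, rfl⟩ := shape_head h2
        exact ⟨_, _, _, _, h1, h2, nc_eq _ _ _ _⟩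
  · rw [Finset.disjoint_left]
    intro γ h1 h2
    simp only [Set.Finite.mem_toFinset, Set.mem_ofPred_eq, Finset.mem_image,
      Finset.mem_product, Prod.exists, strongLe_eq] at h1 h2
    obtain ⟨ρ, σ, ⟨h3, h4⟩, rfl⟩ := h1
    obtain ⟨μ, ν, ⟨h1, h2⟩, h⟩ := h2
    have d1 := (le_inv (sle_le h3)).1
    have d2 := (le_inv (sle_le h1)).1
    obtain ⟨μ, p, rfl⟩ := shape_last h1
    obtain ⟨ν, q, rfl⟩ := shape_head h2
    rw [nc_eq] at h
    refine not_bd μ ν p q ⟨ρ, σ, h, ?_⟩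
    rw [d1, ← d2]
    simp [deg_append, deg_cons, deg_nil, DEntry.val]

theorem choose_add (m n : ℕ) : (m + n).choose 2 = m.choose 2 + n.choose 2 + m * n := by
  induction n with
  | zero => simp
  | succ n ih =>
    rw [← add_assoc, Nat.choose_succ_succ' (m + n) 1, Nat.choose_succ_succ' n 1, ih]
    simp
    ring

theorem term_eq (μ ν : DComp) (p q : ℕ+) :
    SL (Mono ((μ ++ [DEntry.undot p]) ++ (DEntry.undot q :: ν)) +
      Mono (μ ++ DEntry.undot (p + q) :: ν)) =
    ((-1 : ℚ) ^ (fdeg (μ ++ [DEntry.undot p]) * fdeg (DEntry.undot q :: ν))) •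
      CL (SL (Mono (DEntry.undot q :: ν))) (SL (Mono (μ ++ [DEntry.undot p]))) := by
  rw [map_add]
  simp only [SL_mono, map_smul, LinearMap.smul_apply]
  have hW := W_split ν.reverse μ.reverse q p
  have e : ((μ ++ [DEntry.undot p]) ++ (DEntry.undot q :: ν)).reverse =
    ν.reverse ++ DEntry.undot q :: DEntry.undot p :: μ.reverse := by simp
  have e' : (μ ++ DEntry.undot (p + q) :: ν).reverse =
    ν.reverse ++ DEntry.undot (q + p) :: μ.reverse := by simp [add_comm]
  have e1 : (μ ++ [DEntry.undot p]).reverse = DEntry.undot p :: μ.reverse := by simp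
  have e2 : (DEntry.undot q :: ν).reverse = ν.reverse ++ [DEntry.undot q] := by simp
  rw [e, e', e1, e2, hW]
  have s1 : sgn ((μ ++ [DEntry.undot p]) ++ (DEntry.undot q :: ν)) =
      (-1) ^ (fdeg (μ ++ [DEntry.undot p]) * fdeg (DEntry.undot q :: ν)) *
      (sgn (DEntry.undot q :: ν) * sgn (μ ++ [DEntry.undot p])) := by
    unfold sgn
    rw [fdeg_append, choose_add, List.length_append]
    ring
  have s2 : sgn (μ ++ DEntry.undot (p + q) :: ν) =
      - sgn ((μ ++ [DEntry.undot p]) ++ (DEntry.undot q :: ν)) := by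
    unfold sgn
    simp [fdeg_append, fdeg_cons, fdeg_nil, DEntry.isDot]
    ring
  rw [s2, smul_add, neg_smul, s1]
  simp only [mul_smul]
  rw [add_neg_cancel_right]
  try rw [smul_comm (sgn (DEntry.undot q :: ν))]

theorem main_s6 (N M : DComp) (a b : ℕ+) :
    SL (Fund (N ++ DEntry.undot (a + b) :: M)) =
    ((-1 : ℚ) ^ (fdeg (N ++ [DEntry.undot a]) * fdeg (DEntry.undot b :: M))) •
      CL (SL (Fund (DEntry.undot b :: M))) (SL (Fund (N ++ [DEntry.undot a]))) := by
  rw [Fund_split, Fund_eq, Fund_eq]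
  simp only [map_sum, LinearMap.sum_apply]
  rw [Finset.sum_product, Finset.smul_sum]
  simp only [Finset.smul_sum]
  refine Finset.sum_congr rfl fun μ hμ => Finset.sum_congr rfl fun ν hν => ?_
  simp [strongLe_eq] at hμ hν
  first
  | have i1 := le_inv (sle_le hμ)
    have i2 := le_inv (sle_le hν)
    obtain ⟨μ, p, rfl⟩ := shape_last hμ
    obtain ⟨ν, q, rfl⟩ := shape_head hν
    rw [← i1.2, ← i2.2, nc_eq, term_eq]
  | have i1 := le_inv (sle_le hν)
    have i2 := le_inv (sle_le hμ)
    obtain ⟨μ, p, rfl⟩ := shape_last hν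
    obtain ⟨ν, q, rfl⟩ := shape_head hμ
    rw [← i1.2, ← i2.2, nc_eq, term_eq]

end SQ

/-- If the last entry of `α` and the first entry of `β` are both
undotted, then `S(L_{α⊙β}) = (−1)^{m_α m_β} S(L_β) • S(L_α)`. -/
theorem antipode_fund_nearConcat (α β : DComp)
    (hα : ∃ a : ℕ+, α.getLast? = some (DEntry.undot a))
    (hβ : ∃ b : ℕ+, β.head? = some (DEntry.undot b))
    (γ : DComp) (hγ : DComp.nearConcat α β = some γ) :
    antipode (Fund γ) =
      ((-1 : ℚ) ^ (DComp.fdeg α * DComp.fdeg β)) •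
        cdot (antipode (Fund β)) (antipode (Fund α)) := by
  obtain ⟨a, ha⟩ := hα
  obtain ⟨b, hb⟩ := hβ
  obtain ⟨N, rfl⟩ := List.getLast?_eq_some_iff.mp ha
  obtain ⟨M, rfl⟩ := List.head?_eq_some_iff.mp hb
  simp [DComp.nearConcat, DEntry.add?] at hγ
  subst hγ
  simp only [SQ.antipode_eq, SQ.cdot_eq_s6]
  exact SQ.main_s6 N M a b
end
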